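/- arXiv:2210.09631 — 3 statements merged into one kernel-verified Lean document; each statement's English description precedes it below -/
import Mathlib

section
/- Let F(x,y) = h_n·x^n + h_k·x^k·y^(n−k) + h_0·y^n be an irreducible trinomial binary form of degree n ≥ 6. Then the number of regular pairs (p,q) ∈ ℤ² with |F(p,q)| = 1 is at most v(n)·z(n). -/
/-- `v(n) = 3` if `n` is odd, `4` if `n` is even. -/
def v (n : ℕ) : ℕ := if Odd n then 3 else 4

/-- The function `z(n)` from the paper. -/
def z (n : ℕ) : ℕ :=
  if n = 6 then 15
  else if n = 7 then 12
  else if n = 8 then 11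
  else if n = 9 then 9
  else if n ≤ 11 then 8
  else if n ≤ 16 then 7
  else if n ≤ 38 then 6
  else if n ≤ 218 then 5
  else 4

open Polynomial

theorem X_sub_C_pow_dvd_iff_hasseDeriv {R : Type*} [CommRing R] (p : R[X]) (r : R) (s : ℕ) :
    (X - C r) ^ s ∣ p ↔ ∀ i < s, (hasseDeriv i p).eval r = 0 := by
  rw [X_sub_C_pow_dvd_iff, X_pow_dvd_iff]
  simp only [← taylor_apply, taylor_coeff]

theorem irreducible_pow_dvd_of_X_sub_C_pow_dvd {f : ℚ[X]} (hf : Irreducible f) {α : ℝ}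
    (hα : aeval α f = 0) (s : ℕ) : ∀ d : ℚ[X],
    (X - C α) ^ s ∣ d.map (algebraMap ℚ ℝ) → f ^ s ∣ d := by
  induction s with
  | zero => intro d _; simp
  | succ s ih =>
    intro d hd
    have hroot : aeval α d = 0 := by
      have h1 : (X - C α) ∣ d.map (algebraMap ℚ ℝ) := (dvd_pow_self _ (Nat.succ_ne_zero s)).trans hd
      rw [dvd_iff_isRoot, IsRoot.def, eval_map_algebraMap] at h1
      exact h1
    have hfd : f ∣ d := by
      have h2 := minpoly.dvd ℚ α hroot
      rw [← minpoly.eq_of_irreducible hf hα] at h2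
      exact (dvd_mul_right _ _).trans h2
    obtain ⟨d2, rfl⟩ := hfd
    obtain ⟨f1, hf1⟩ : (X - C α) ∣ f.map (algebraMap ℚ ℝ) := by
      rw [dvd_iff_isRoot, IsRoot.def, eval_map_algebraMap]; exact hα
    have hf1α : f1.eval α ≠ 0 := by
      have h3 := hf.separable.aeval_derivative_ne_zero hα
      intro h4
      apply h3
      rw [← eval_map_algebraMap, ← derivative_map, hf1]
      simp [h4]
    have h5 : (X - C α) ^ s ∣ f1 * d2.map (algebraMap ℚ ℝ) := by
      rw [Polynomial.map_mul, hf1, pow_succ', mul_assoc] at hd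
      exact (mul_dvd_mul_iff_left (X_sub_C_ne_zero α)).1 hd
    have hcop : IsCoprime ((X - C α) ^ s) f1 := by
      apply IsCoprime.pow_left
      rw [(irreducible_X_sub_C α).coprime_iff_not_dvd, dvd_iff_isRoot]
      exact hf1α
    have h6 := ih d2 (hcop.dvd_of_dvd_mul_left h5)
    rw [pow_succ']
    exact mul_dvd_mul_left _ h6

theorem exists_of_wronskian_eq_zero {A B : ℚ[X]} (hAB : A ≠ 0 ∨ B ≠ 0)
    (hW : wronskian A B = 0) : ∃ (d : ℚ[X]) (c₁ c₂ : ℚ), d ≠ 0 ∧ (c₁ ≠ 0 ∨ c₂ ≠ 0) ∧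
      A = C c₁ * d ∧ B = C c₂ * d := by
  have hd : gcd A B ≠ 0 := by
    rw [Ne, gcd_eq_zero_iff]; tauto
  obtain ⟨A', B', hA, hB, hU⟩ := extract_gcd A B
  have hcop : IsCoprime A' B' := (_root_.gcd_isUnit_iff A' B').1 hU
  generalize gcd A B = d at hd hA hB
  have hw : wronskian A' B' = 0 := by
    have : d ^ 2 * wronskian A' B' = 0 := by
      rw [← hW, hA, hB]; simp only [wronskian, derivative_mul]; ring
    simpa [hd] using this
  obtain ⟨h1, h2⟩ := hcop.wronskian_eq_zero_iff.1 hw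
  have h1' := eq_C_of_derivative_eq_zero h1
  have h2' := eq_C_of_derivative_eq_zero h2
  refine ⟨d, A'.coeff 0, B'.coeff 0, hd, ?_, ?_, ?_⟩
  · by_contra! h
    rw [h1', h.1] at hA
    rw [h2', h.2] at hB
    simp at hA hB
    tauto
  · rw [mul_comm, ← h1']; exact hA
  · rw [mul_comm, ← h2']; exact hB

theorem wronskian_ne_zero_of_pow_dvd {f : ℚ[X]} (hf : Irreducible f) {α : ℝ}
    (hα : aeval α f = 0) (hdeg : 2 ≤ f.natDegree) {A B : ℚ[X]} (hAB : A ≠ 0 ∨ B ≠ 0) {m s : ℕ}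
    (hA : A.natDegree ≤ m) (hB : B.natDegree ≤ m) (hms : m < s * f.natDegree)
    (hdvd : (X - C α) ^ s ∣ A.map (algebraMap ℚ ℝ) + C α * B.map (algebraMap ℚ ℝ)) :
    wronskian A B ≠ 0 := by
  intro hW
  obtain ⟨d, c₁, c₂, hd, hc, rfl, rfl⟩ := exists_of_wronskian_eq_zero hAB hW
  have hne : (c₁ : ℝ) + α * c₂ ≠ 0 := by
    intro h
    have h1 : aeval α (C c₁ + C c₂ * X : ℚ[X]) = 0 := by
      simp; linarith
    have h2 := minpoly.dvd ℚ α h1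
    rw [← minpoly.eq_of_irreducible hf hα] at h2
    have h3 : f ∣ C c₁ + C c₂ * X := (dvd_mul_right _ _).trans h2
    have hz : (C c₁ + C c₂ * X : ℚ[X]) = 0 := by
      apply eq_zero_of_dvd_of_natDegree_lt h3
      refine lt_of_le_of_lt ?_ (Nat.lt_of_lt_of_le one_lt_two hdeg)
      compute_degree
    have e0 := congrArg (fun p => coeff p 0) hz
    have e1 := congrArg (fun p => coeff p 1) hz
    simp [coeff_C] at e0 e1
    tauto
  have h2 : (X - C α) ^ s ∣ d.map (algebraMap ℚ ℝ) := by
    have e : (C c₁ * d).map (algebraMap ℚ ℝ) + C α * (C c₂ * d).map (algebraMap ℚ ℝ) =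
        C ((c₁ : ℝ) + α * c₂) * d.map (algebraMap ℚ ℝ) := by
      simp [Polynomial.map_mul]; ring
    rw [e] at hdvd
    exact (IsUnit.dvd_mul_left (isUnit_C.2 hne.isUnit)).1 hdvd
  have h3 := natDegree_le_of_dvd (irreducible_pow_dvd_of_X_sub_C_pow_dvd hf hα s d h2) hd
  rw [natDegree_pow] at h3
  have h4 : d.natDegree ≤ m := by
    rcases hc with hc | hc
    · rwa [natDegree_C_mul hc] at hA
    · rwa [natDegree_C_mul hc] at hB
  omega

theorem pow_dvd_wronskian {R : Type*} [CommRing R] {G A B l : R[X]} {e : ℕ} {r : R}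
    (hG : G = A + C r * B) (h : l ^ (e + 1) ∣ G) : l ^ e ∣ wronskian A B := by
  have e1 : wronskian A B = G * derivative B - derivative G * B := by
    rw [hG]; simp only [wronskian, derivative_add, derivative_mul, derivative_C]; ring
  rw [e1]
  refine dvd_sub (((pow_dvd_pow l (Nat.le_succ e)).trans h).mul_right _) (Dvd.dvd.mul_right ?_ _)
  simpa using pow_sub_one_dvd_derivative_of_pow_dvd h

theorem isPrimitive_C_mul_X_sub_C {p q : ℤ} (hpq : IsCoprime p q) :
    (C q * X - C p : ℤ[X]).IsPrimitive := by
  intro r hr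
  rw [C_dvd_iff_dvd_coeff] at hr
  have h0 := hr 0
  have h1 := hr 1
  simp only [coeff_sub, coeff_C_mul, coeff_X_one, coeff_X_zero, coeff_C_zero,
    coeff_C_of_ne_zero one_ne_zero, mul_one, mul_zero, sub_zero, zero_sub, dvd_neg] at h0 h1
  exact hpq.isUnit_of_dvd' h0 h1

theorem isPrimitive_pow {l : ℤ[X]} (hl : l.IsPrimitive) (e : ℕ) : (l ^ e).IsPrimitive := by
  induction e with
  | zero => simp
  | succ e ih => rw [pow_succ]; exact ih.mul hl

theorem abs_coeff_mul_le {A B : ℤ[X]} {a b : ℤ} (hA : ∀ i, |A.coeff i| ≤ a)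
    (hB : ∀ i, |B.coeff i| ≤ b) (N : ℕ) : |(A * B).coeff N| ≤ (N + 1) * (a * b) := by
  rw [coeff_mul]
  refine (Finset.abs_sum_le_sum_abs _ _).trans ?_
  refine (Finset.sum_le_card_nsmul _ _ (a * b) ?_).trans ?_
  · intro x _
    rw [abs_mul]
    exact mul_le_mul (hA _) (hB _) (abs_nonneg _) ((abs_nonneg _).trans (hA 0))
  · simp

theorem abs_coeff_derivative_le {B : ℤ[X]} {m : ℕ} {Y : ℤ} (hB : B.natDegree ≤ m)
    (hBY : ∀ i, |B.coeff i| ≤ Y) (i : ℕ) : |(derivative B).coeff i| ≤ Y * m := by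
  have hY : 0 ≤ Y := (abs_nonneg _).trans (hBY 0)
  rw [coeff_derivative, abs_mul]
  by_cases h : i + 1 ≤ m
  · have h1 : |(i : ℤ) + 1| ≤ m := by
      rw [abs_of_nonneg (by positivity)]; exact_mod_cast h
    exact mul_le_mul (hBY _) h1 (abs_nonneg _) hY
  · rw [coeff_eq_zero_of_natDegree_lt (by omega)]
    simp; positivity

theorem abs_coeff_wronskian_le {A B : ℤ[X]} {m : ℕ} {Y : ℤ} (hA : A.natDegree ≤ m)
    (hB : B.natDegree ≤ m) (hAY : ∀ i, |A.coeff i| ≤ Y) (hBY : ∀ i, |B.coeff i| ≤ Y)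
    {N : ℕ} (hN : N ≤ 2 * m) : |(wronskian A B).coeff N| ≤ 4 * (m + 1) ^ 2 * Y ^ 2 := by
  have hY : 0 ≤ Y := (abs_nonneg _).trans (hAY 0)
  have h1 := abs_coeff_mul_le hAY (abs_coeff_derivative_le hB hBY) N
  have h2 := abs_coeff_mul_le (abs_coeff_derivative_le hA hAY) hBY N
  rw [wronskian, coeff_sub]
  refine (abs_sub _ _).trans ((add_le_add h1 h2).trans ?_)
  have h3 : (N : ℤ) ≤ 2 * m := by exact_mod_cast hN
  have h4 : (0 : ℤ) ≤ m := by positivity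
  nlinarith [mul_nonneg (mul_nonneg hY hY) (mul_nonneg h4 (sub_nonneg.2 h3)),
    mul_nonneg (mul_nonneg hY hY) h4, mul_nonneg hY hY]

theorem pow_le_of_hasseDeriv_eq_zero {A B : ℤ[X]} {m ι : ℕ} {Y p q : ℤ} {r : ℚ}
    (hA : A.natDegree ≤ m)
    (hB : B.natDegree ≤ m) (hAY : ∀ i, |A.coeff i| ≤ Y) (hBY : ∀ i, |B.coeff i| ≤ Y)
    (hW : wronskian A B ≠ 0) (hq : 0 < q) (hpq : IsCoprime p q)
    (h : ∀ i < ι + 1, (hasseDeriv i (A.map (Int.castRingHom ℚ)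
      + C r * B.map (Int.castRingHom ℚ))).eval (p / q : ℚ) = 0) :
    q ^ ι ≤ 4 * (m + 1) ^ 2 * Y ^ 2 := by
  rw [← X_sub_C_pow_dvd_iff_hasseDeriv] at h
  have h1 := pow_dvd_wronskian rfl h
  have hq0 : (q : ℚ) ≠ 0 := by exact_mod_cast hq.ne'
  have e1 : wronskian (A.map (Int.castRingHom ℚ)) (B.map (Int.castRingHom ℚ)) =
      (wronskian A B).map (Int.castRingHom ℚ) := by
    simp [wronskian, derivative_map]
  have hl : ((C q * X - C p) ^ ι : ℤ[X]) ∣ wronskian A B := by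
    rw [IsPrimitive.Int.dvd_iff_map_cast_dvd_map_cast _ _
      (isPrimitive_pow (isPrimitive_C_mul_X_sub_C hpq) ι), ← e1]
    have e2 : ((C q * X - C p) ^ ι : ℤ[X]).map (Int.castRingHom ℚ)
        = C ((q : ℚ) ^ ι) * (X - C (p / q : ℚ)) ^ ι := by
      rw [Polynomial.map_pow, C_pow, ← mul_pow]
      congr 1
      rw [mul_sub, ← C_mul, mul_div_cancel₀ _ hq0]
      simp
    rw [e2]
    exact (IsUnit.mul_left_dvd (isUnit_C.2 (pow_ne_zero ι hq0).isUnit)).2 h1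
  obtain ⟨V, hV⟩ := hl
  have h3 : q ^ ι ∣ (wronskian A B).coeff (wronskian A B).natDegree := by
    change _ ∣ (wronskian A B).leadingCoeff
    rw [hV, leadingCoeff_mul, leadingCoeff_pow]
    refine Dvd.intro V.leadingCoeff ?_
    congr 2
    have : (C q * X - C p : ℤ[X]) = C q * X + C (-p) := by simp [sub_eq_add_neg]
    rw [this, leadingCoeff_linear hq.ne']
  have h4 := Int.le_of_dvd (abs_pos.2 (leadingCoeff_ne_zero.2 hW)) ((dvd_abs _ _).2 h3)
  refine h4.trans (abs_coeff_wronskian_le hA hB hAY hBY ?_)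
  have := natDegree_wronskian_lt_add hW
  omega

/-- Coordinates of `(a * α) ^ l` on the powers `α ^ d`, `d < n`, when
`a * α ^ n + b * α ^ k + c = 0`. -/
def powerCoords (a b c : ℤ) (n k : ℕ) : ℕ → ℕ → ℤ
  | 0, d => if d = 0 then 1 else 0
  | l + 1, d => (if d = 0 then 0 else a * powerCoords a b c n k l (d - 1))
      - powerCoords a b c n k l (n - 1) * ((if d = k then b else 0) + (if d = 0 then c else 0))

theorem powerCoords_spec {a b c : ℤ} {n k : ℕ} (hkn : k < n) {α : ℝ}
    (hα : a * α ^ n + b * α ^ k + c = 0) (l : ℕ) :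
    (a : ℝ) ^ l * α ^ l = ∑ d ∈ Finset.range n, (powerCoords a b c n k l d : ℝ) * α ^ d := by
  obtain ⟨N, rfl⟩ : ∃ N, n = N + 1 := ⟨n - 1, by omega⟩
  induction l with
  | zero => simp [powerCoords]
  | succ l ih =>
    have e : (a : ℝ) ^ (l + 1) * α ^ (l + 1) = a * α * (a ^ l * α ^ l) := by ring
    rw [e, ih, Finset.sum_range_succ, mul_add]
    have h1 : ∑ d ∈ Finset.range (N + 1), (powerCoords a b c (N + 1) k (l + 1) d : ℝ) * α ^ d =
        (∑ d ∈ Finset.range (N + 1),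
          (((if d = 0 then 0 else a * powerCoords a b c (N + 1) k l (d - 1) : ℤ)) : ℝ) * α ^ d)
        - powerCoords a b c (N + 1) k l N * ((∑ d ∈ Finset.range (N + 1),
          if d = k then (b : ℝ) * α ^ d else 0)
          + ∑ d ∈ Finset.range (N + 1), if d = 0 then (c : ℝ) * α ^ d else 0) := by
      rw [← Finset.sum_add_distrib, Finset.mul_sum, ← Finset.sum_sub_distrib]
      refine Finset.sum_congr rfl fun d _ => ?_
      simp only [powerCoords, add_tsub_cancel_right]
      push_cast
      split_ifs <;> ring
    rw [h1, Finset.sum_ite_eq', Finset.sum_ite_eq', if_pos (by simpa using hkn),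
      if_pos (by simp), Finset.sum_range_succ', Finset.mul_sum]
    have h2 : (a : ℝ) * α * (powerCoords a b c (N + 1) k l N * α ^ N)
        = powerCoords a b c (N + 1) k l N * (a * α ^ (N + 1)) := by ring
    have h3 : (a : ℝ) * α ^ (N + 1) = - (b * α ^ k) - c := by linarith
    rw [h2, h3]
    simp only [add_tsub_cancel_right, Nat.add_eq_zero_iff, one_ne_zero, and_false, if_false,
      if_true, pow_zero]
    push_cast
    rw [zero_mul, add_zero, sub_eq_add_neg]
    congr 1
    · refine Finset.sum_congr rfl fun d _ => ?_
      ring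
    · ring

theorem abs_powerCoords_le {a b c H : ℤ} {n k : ℕ} (hk : 0 < k) (ha : |a| ≤ H) (hb : |b| ≤ H)
    (hc : |c| ≤ H) (l : ℕ) : ∀ d, |powerCoords a b c n k l d| ≤ (2 * H) ^ l := by
  have hH : 0 ≤ H := (abs_nonneg _).trans ha
  induction l with
  | zero => intro d; simp only [powerCoords]; split_ifs <;> simp
  | succ l ih =>
    intro d
    have hP : (0 : ℤ) ≤ (2 * H) ^ l := by positivity
    have hbc : |(if d = k then b else 0) + (if d = 0 then c else 0)| ≤ H := by
      split_ifs
      · omega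
      · simpa using hb
      · simpa using hc
      · simpa using hH
    have h1 : |if d = 0 then 0 else a * powerCoords a b c n k l (d - 1)| ≤ H * (2 * H) ^ l := by
      split_ifs
      · simp; positivity
      · rw [abs_mul]; exact mul_le_mul ha (ih _) (abs_nonneg _) hH
    have h2 : |powerCoords a b c n k l (n - 1) *
        ((if d = k then b else 0) + (if d = 0 then c else 0))| ≤ (2 * H) ^ l * H := by
      rw [abs_mul]; exact mul_le_mul (ih _) hbc (abs_nonneg _) hP
    simp only [powerCoords]
    refine (abs_sub _ _).trans ((add_le_add h1 h2).trans (le_of_eq ?_))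
    ring

theorem hasseDeriv_map_sum_monomial_eval {m : ℕ} (t : Fin (m + 1) → ℤ) (i : ℕ) (α : ℝ) :
    (hasseDeriv i ((∑ l : Fin (m + 1), monomial (l : ℕ) (t l)).map (Int.castRingHom ℝ))).eval α =
      ∑ l, (t l : ℝ) * (((l : ℕ).choose i : ℕ) * α ^ ((l : ℕ) - i)) := by
  rw [Polynomial.map_sum, map_sum, eval_finsetSum]
  refine Finset.sum_congr rfl fun l _ => ?_
  rw [map_monomial, hasseDeriv_monomial, eval_monomial]
  simp; ring

theorem coeff_sum_fin_monomial {m : ℕ} (t : Fin (m + 1) → ℤ) (i : ℕ) :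
    (∑ l : Fin (m + 1), monomial (l : ℕ) (t l)).coeff i = if h : i < m + 1 then t ⟨i, h⟩ else 0 := by
  rw [finsetSum_coeff]
  simp only [coeff_monomial]
  split_ifs with h
  · rw [Finset.sum_eq_single ⟨i, h⟩]
    · simp
    · intro b _ hb
      rw [if_neg]; intro h2; apply hb; ext; exact h2
    · simp
  · refine Finset.sum_eq_zero fun l _ => if_neg ?_
    have := l.2; omega

theorem exists_siegel_pair {a b c H : ℤ} {n k w : ℕ} (hk : 0 < k) (hkn : k < n) (hw : 0 < w)
    (ha0 : a ≠ 0) (ha : |a| ≤ H) (hb : |b| ≤ H) (hc : |c| ≤ H) {α : ℝ}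
    (hα : a * α ^ n + b * α ^ k + c = 0) {m : ℕ} (hm : m = 2 * n * w) :
    ∃ A B : ℤ[X], (A ≠ 0 ∨ B ≠ 0) ∧ A.natDegree ≤ m ∧ B.natDegree ≤ m ∧
      (∀ i, |A.coeff i| ≤ ((2 * m + 2) * 2 ^ m * (2 * H) ^ (m + 1)) ^ 3) ∧
      (∀ i, |B.coeff i| ≤ ((2 * m + 2) * 2 ^ m * (2 * H) ^ (m + 1)) ^ 3) ∧
      (X - C α) ^ (3 * w) ∣
        A.map (Int.castRingHom ℝ) + C α * B.map (Int.castRingHom ℝ) := by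
  have hH : 1 ≤ H := (Int.one_le_abs ha0).trans ha
  set M : Matrix (Fin (3 * w) × Fin n) (Fin (m + 1) ⊕ Fin (m + 1)) ℤ := fun r =>
    Sum.elim (fun l => ((l : ℕ).choose r.1 : ℤ) * (a ^ (m + 1 - ((l : ℕ) - r.1)) *
        powerCoords a b c n k ((l : ℕ) - r.1) r.2))
      (fun l => ((l : ℕ).choose r.1 : ℤ) * (a ^ (m + 1 - ((l : ℕ) - r.1 + 1)) *
        powerCoords a b c n k ((l : ℕ) - r.1 + 1) r.2)) with hM
  have hentry : ∀ r l, |M r l| ≤ 2 ^ m * (2 * H) ^ (m + 1) := by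
    have key : ∀ (l : Fin (m + 1)) (i e : ℕ) (d : ℕ), e ≤ m + 1 →
        |((l : ℕ).choose i : ℤ) * (a ^ (m + 1 - e) * powerCoords a b c n k e d)|
          ≤ 2 ^ m * (2 * H) ^ (m + 1) := by
      intro l i e d he
      rw [abs_mul, abs_mul, abs_pow]
      have h1 : |((l : ℕ).choose i : ℤ)| ≤ 2 ^ m := by
        rw [Nat.abs_cast]
        have h2 : (l : ℕ).choose i ≤ 2 ^ m :=
          (Nat.choose_le_two_pow _ _).trans (Nat.pow_le_pow_right (by norm_num) (by omega))
        exact_mod_cast h2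
      have h3 : |a| ^ (m + 1 - e) ≤ (2 * H) ^ (m + 1 - e) :=
        pow_le_pow_left₀ (abs_nonneg _) (by linarith) _
      have h4 := mul_le_mul h3 (abs_powerCoords_le (n := n) hk ha hb hc e d) (abs_nonneg _)
        (by positivity)
      rw [← pow_add, Nat.sub_add_cancel he] at h4
      exact mul_le_mul h1 h4 (by positivity) (by positivity)
    rintro r (l | l)
    · exact key _ _ _ _ (by omega)
    · exact key _ _ _ _ (by omega)
  have hcard1 : Fintype.card (Fin (3 * w) × Fin n) = 3 * w * n := by simp
  have hcard2 : Fintype.card (Fin (m + 1) ⊕ Fin (m + 1)) = 2 * m + 2 := by simp; ring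
  have hnw : 0 < n * w := Nat.mul_pos (by omega) hw
  have hmn : m = 2 * (n * w) := by rw [hm]; ring
  have hmn' : 3 * w * n = 3 * (n * w) := by ring
  obtain ⟨t, ht0, hMt, htn⟩ := Int.Matrix.exists_ne_zero_int_vec_norm_le M
    (by rw [hcard1, hcard2]; omega) (by rw [hcard1]; omega)
  set Y : ℤ := ((2 * m + 2) * 2 ^ m * (2 * H) ^ (m + 1)) ^ 3 with hY
  have hH' : (1 : ℝ) ≤ H := by exact_mod_cast hH
  have hbase : (1 : ℝ) ≤ (2 * m + 2) * 2 ^ m * (2 * H) ^ (m + 1) := by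
    have h1 : (1 : ℝ) ≤ 2 * m + 2 := by linarith [(Nat.cast_nonneg m : (0 : ℝ) ≤ m)]
    have h2 : (1 : ℝ) ≤ 2 ^ m := one_le_pow₀ (by norm_num)
    have h3 : (1 : ℝ) ≤ (2 * H) ^ (m + 1) := one_le_pow₀ (by linarith)
    exact one_le_mul_of_one_le_of_one_le (one_le_mul_of_one_le_of_one_le h1 h2) h3
  have htY : ∀ x, |t x| ≤ Y := by
    intro x
    have h1 : (|t x| : ℝ) ≤ ‖t‖ := by
      have := norm_le_pi_norm t x
      rwa [Int.norm_eq_abs] at this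
    have h2 := h1.trans htn
    rw [hcard1, hcard2] at h2
    let : SeminormedAddCommGroup (Matrix (Fin (3 * w) × Fin n) (Fin (m + 1) ⊕ Fin (m + 1)) ℤ) :=
      Matrix.seminormedAddCommGroup
    have h4 : ‖M‖ ≤ 2 ^ m * (2 * H) ^ (m + 1) := by
      refine (Matrix.norm_le_iff (by positivity)).2 fun r l => ?_
      rw [Int.norm_eq_abs]
      exact_mod_cast hentry r l
    have h5 : (((2 * m + 2 : ℕ) : ℝ) * max 1 ‖M‖) ≤ (2 * m + 2) * 2 ^ m * (2 * H) ^ (m + 1) := by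
      have h8 : (1 : ℝ) ≤ 2 ^ m * (2 * H) ^ (m + 1) :=
        one_le_mul_of_one_le_of_one_le (one_le_pow₀ (by norm_num)) (one_le_pow₀ (by linarith))
      push_cast
      rw [mul_assoc]
      exact mul_le_mul_of_nonneg_left (max_le h8 h4) (by positivity)
    have h6 : (((3 * w * n : ℕ) : ℝ) / (((2 * m + 2 : ℕ) : ℝ) - ((3 * w * n : ℕ) : ℝ))) ≤ 3 := by
      rw [hmn', hmn]
      have h0 : (0 : ℝ) ≤ (n * w : ℕ) := Nat.cast_nonneg _
      rw [div_le_iff₀ (by push_cast at h0 ⊢; linarith)]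
      push_cast at h0 ⊢
      linarith
    have h7 : (|t x| : ℝ) ≤ ((2 * m + 2) * 2 ^ m * (2 * H) ^ (m + 1)) ^ 3 := by
      refine h2.trans ((Real.rpow_le_rpow (by positivity) h5 ?_).trans ?_)
      · rw [hmn', hmn]
        have h0 : (0 : ℝ) ≤ (n * w : ℕ) := Nat.cast_nonneg _
        apply div_nonneg (Nat.cast_nonneg _)
        push_cast at h0 ⊢; linarith
      · refine (Real.rpow_le_rpow_of_exponent_le hbase h6).trans (le_of_eq ?_)
        rw [← Real.rpow_natCast _ 3]; norm_num
    exact_mod_cast h7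
  have hY0 : 0 ≤ Y := (abs_nonneg _).trans (htY (Sum.inl 0))
  have hcoef : ∀ u : Fin (m + 1) → ℤ, (∀ l, |u l| ≤ Y) → ∀ i,
      |(∑ l : Fin (m + 1), monomial (l : ℕ) (u l)).coeff i| ≤ Y := by
    intro u hu i
    rw [coeff_sum_fin_monomial]
    split_ifs
    · exact hu _
    · simpa using hY0
  have hdeg : ∀ u : Fin (m + 1) → ℤ, (∑ l : Fin (m + 1), monomial (l : ℕ) (u l)).natDegree ≤ m := by
    intro u
    rw [natDegree_le_iff_coeff_eq_zero]
    intro N hN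
    rw [coeff_sum_fin_monomial, dif_neg (by omega)]
  refine ⟨∑ l : Fin (m + 1), monomial (l : ℕ) (t (Sum.inl l)), ∑ l : Fin (m + 1), monomial (l : ℕ) (t (Sum.inr l)), ?_,
    hdeg _, hdeg _, hcoef _ fun _ => htY _, hcoef _ fun _ => htY _, ?_⟩
  · by_contra! h
    apply ht0
    funext x
    rcases x with l | l
    · have := congrArg (fun p => coeff p l) h.1
      rw [coeff_sum_fin_monomial, dif_pos l.2] at this
      simpa using this
    · have := congrArg (fun p => coeff p l) h.2
      rw [coeff_sum_fin_monomial, dif_pos l.2] at this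
      simpa using this
  · rw [X_sub_C_pow_dvd_iff_hasseDeriv]
    intro i hi
    have haR : (a : ℝ) ≠ 0 := by exact_mod_cast ha0
    have hE : (a : ℝ) ^ (m + 1) ≠ 0 := pow_ne_zero _ haR
    apply (mul_eq_zero.1 ?_).resolve_left hE
    have hC : hasseDeriv i (C α * (∑ l : Fin (m + 1), monomial (l : ℕ) (t (Sum.inr l))).map
        (Int.castRingHom ℝ)) = C α * hasseDeriv i ((∑ l : Fin (m + 1),
        monomial (l : ℕ) (t (Sum.inr l))).map (Int.castRingHom ℝ)) := by
      rw [← smul_eq_C_mul, ← smul_eq_C_mul, map_smul]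
    rw [map_add, eval_add, hC, eval_mul, eval_C, hasseDeriv_map_sum_monomial_eval,
      hasseDeriv_map_sum_monomial_eval]
    have hrow : ∀ d : Fin n, (∑ l, (M (⟨i, hi⟩, d) (Sum.inl l) : ℝ) * t (Sum.inl l)) +
        ∑ l, (M (⟨i, hi⟩, d) (Sum.inr l) : ℝ) * t (Sum.inr l) = 0 := by
      intro d
      have h1 := congrFun hMt (⟨i, hi⟩, d)
      simp only [Matrix.mulVec, dotProduct, Fintype.sum_sum_type, Pi.zero_apply] at h1
      exact_mod_cast h1
    have hpow : ∀ e : ℕ, e ≤ m + 1 → (a : ℝ) ^ (m + 1) * α ^ e =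
        ∑ d : Fin n, (a : ℝ) ^ (m + 1 - e) * powerCoords a b c n k e d * α ^ (d : ℕ) := by
      intro e he
      have h1 := powerCoords_spec hkn hα e
      rw [← Fin.sum_univ_eq_sum_range (fun d => (powerCoords a b c n k e d : ℝ) * α ^ d)] at h1
      calc (a : ℝ) ^ (m + 1) * α ^ e = a ^ (m + 1 - e) * (a ^ e * α ^ e) := by
            rw [← mul_assoc, ← pow_add, Nat.sub_add_cancel he]
        _ = _ := by rw [h1, Finset.mul_sum]; exact Finset.sum_congr rfl fun d _ => by ring
    have e1 : (a : ℝ) ^ (m + 1) * ((∑ l : Fin (m + 1), (t (Sum.inl l) : ℝ) *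
          (((l : ℕ).choose i : ℕ) * α ^ ((l : ℕ) - i))) + α * ∑ l : Fin (m + 1),
          (t (Sum.inr l) : ℝ) * (((l : ℕ).choose i : ℕ) * α ^ ((l : ℕ) - i)))
        = ∑ d : Fin n, ((∑ l, (M (⟨i, hi⟩, d) (Sum.inl l) : ℝ) * t (Sum.inl l)) +
        ∑ l, (M (⟨i, hi⟩, d) (Sum.inr l) : ℝ) * t (Sum.inr l)) * α ^ (d : ℕ) := by
      simp_rw [add_mul]
      rw [Finset.sum_add_distrib, mul_add]
      simp_rw [Finset.sum_mul]
      rw [Finset.sum_comm, Finset.sum_comm (s := Finset.univ) (t := Finset.univ)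
        (f := fun (d : Fin n) l => (M (⟨i, hi⟩, d) (Sum.inr l) : ℝ) * t (Sum.inr l) * α ^ (d : ℕ))]
      rw [Finset.mul_sum, Finset.mul_sum, Finset.mul_sum]
      congr 1
      · refine Finset.sum_congr rfl fun l _ => ?_
        calc _ = (t (Sum.inl l) : ℝ) * ((l : ℕ).choose i : ℕ) *
              (a ^ (m + 1) * α ^ ((l : ℕ) - i)) := by ring
          _ = _ := by
            rw [hpow _ (by omega), Finset.mul_sum]
            refine Finset.sum_congr rfl fun d _ => ?_
            simp only [hM, Sum.elim_inl]; push_cast; ring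
      · refine Finset.sum_congr rfl fun l _ => ?_
        calc _ = (t (Sum.inr l) : ℝ) * ((l : ℕ).choose i : ℕ) *
              (a ^ (m + 1) * α ^ ((l : ℕ) - i + 1)) := by ring
          _ = _ := by
            rw [hpow _ (by omega), Finset.mul_sum]
            refine Finset.sum_congr rfl fun d _ => ?_
            simp only [hM, Sum.elim_inr]; push_cast; ring
    rw [e1]
    exact Finset.sum_eq_zero fun d _ => by rw [hrow d, zero_mul]

theorem abs_coeff_hasseDeriv_le {p : ℝ[X]} {m : ℕ} {Y : ℝ} (hp : p.natDegree ≤ m)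
    (hY : ∀ i, |p.coeff i| ≤ Y) (i l : ℕ) : |(hasseDeriv i p).coeff l| ≤ 2 ^ m * Y := by
  have hY0 : 0 ≤ Y := (abs_nonneg _).trans (hY 0)
  rw [hasseDeriv_coeff, abs_mul, Nat.abs_cast]
  by_cases h : l + i ≤ m
  · refine mul_le_mul ?_ (hY _) (abs_nonneg _) (by positivity)
    have h2 : (l + i).choose i ≤ 2 ^ m :=
      (Nat.choose_le_two_pow _ _).trans (Nat.pow_le_pow_right (by norm_num) h)
    exact_mod_cast h2
  · rw [coeff_eq_zero_of_natDegree_lt (by omega), abs_zero, mul_zero]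
    positivity

theorem abs_eval_le {p : ℝ[X]} {m : ℕ} {Y R t : ℝ} (hp : p.natDegree ≤ m)
    (hY : ∀ i, |p.coeff i| ≤ Y) (hR : 1 ≤ R) (ht : |t| ≤ R) :
    |p.eval t| ≤ (m + 1) * (Y * R ^ m) := by
  have hY0 : 0 ≤ Y := (abs_nonneg _).trans (hY 0)
  rw [eval_eq_sum_range' (Nat.lt_succ_of_le hp)]
  refine (Finset.abs_sum_le_sum_abs _ _).trans ?_
  refine (Finset.sum_le_card_nsmul _ _ (Y * R ^ m) ?_).trans (by simp)
  intro l hl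
  rw [abs_mul, abs_pow]
  refine mul_le_mul (hY l) ?_ (by positivity) hY0
  exact (pow_le_pow_left₀ (abs_nonneg _) ht l).trans
    (pow_le_pow_right₀ hR (Nat.lt_succ_iff.1 (Finset.mem_range.1 hl)))

theorem abs_hasseDeriv_eval_le {p : ℝ[X]} {m : ℕ} {Y R t : ℝ} (hp : p.natDegree ≤ m)
    (hY : ∀ i, |p.coeff i| ≤ Y) (hR : 1 ≤ R) (ht : |t| ≤ R) (i : ℕ) :
    |(hasseDeriv i p).eval t| ≤ (m + 1) * (2 ^ m * Y * R ^ m) :=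
  abs_eval_le ((natDegree_hasseDeriv_le p i).trans ((Nat.sub_le _ _).trans hp))
    (fun l => abs_coeff_hasseDeriv_le hp hY i l) hR ht

theorem abs_hasseDeriv_eval_le_of_pow_dvd {p : ℝ[X]} {m s ι i : ℕ} {Y R α β δ : ℝ}
    (hp : p.natDegree ≤ m) (hY : ∀ i, |p.coeff i| ≤ Y) (hR : 1 ≤ R) (hα : |α| ≤ R)
    (hdvd : (X - C α) ^ s ∣ p) (hi : i ≤ ι) (hδ : |α - β| ≤ δ) (hδ1 : δ ≤ 1) :
    |(hasseDeriv i p).eval β| ≤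
      (m + 1) * (2 ^ m * ((m + 1) * (2 ^ m * Y * R ^ m)) * δ ^ (s - ι)) := by
  have hY0 : 0 ≤ Y := (abs_nonneg _).trans (hY 0)
  have hδ0 : 0 ≤ δ := (abs_nonneg _).trans hδ
  have hdi : (hasseDeriv i p).natDegree ≤ m :=
    (natDegree_hasseDeriv_le p i).trans ((Nat.sub_le _ _).trans hp)
  rw [X_sub_C_pow_dvd_iff_hasseDeriv] at hdvd
  rw [← taylor_eval_sub α, eval_eq_sum_range' (n := m + 1)
    (by rw [natDegree_taylor]; omega)]
  refine (Finset.abs_sum_le_sum_abs _ _).trans ?_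
  refine (Finset.sum_le_card_nsmul _ _
    (2 ^ m * ((m + 1) * (2 ^ m * Y * R ^ m)) * δ ^ (s - ι)) ?_).trans (by simp)
  intro j _
  have hcomp : (taylor α (hasseDeriv i p)).coeff j =
      ((j + i).choose j : ℕ) * (hasseDeriv (j + i) p).eval α := by
    rw [taylor_coeff]
    have := congrArg (fun L => L p) (hasseDeriv_comp (R := ℝ) j i)
    simp only [LinearMap.comp_apply, LinearMap.smul_apply] at this
    rw [this, eval_smul, nsmul_eq_mul]
  rw [hcomp, abs_mul, abs_mul, Nat.abs_cast, abs_pow, abs_sub_comm]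
  by_cases hs : j + i < s
  · rw [hdvd _ hs]; simp; positivity
  by_cases hm : j + i ≤ m
  · have h2 : (j + i).choose j ≤ 2 ^ m :=
      (Nat.choose_le_two_pow _ _).trans (Nat.pow_le_pow_right (by norm_num) hm)
    have h2' : (((j + i).choose j : ℕ) : ℝ) ≤ 2 ^ m := by exact_mod_cast h2
    have h3 : |α - β| ^ j ≤ δ ^ (s - ι) :=
      (pow_le_pow_left₀ (abs_nonneg _) hδ j).trans
        (pow_le_pow_of_le_one hδ0 hδ1 (by omega))
    have h4 := abs_hasseDeriv_eval_le hp hY hR hα (j + i)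
    exact mul_le_mul (mul_le_mul h2' h4 (abs_nonneg _) (by positivity)) h3 (by positivity)
      (by positivity)
  · rw [hasseDeriv_eq_zero_of_lt_natDegree _ _ (by omega)]; simp; positivity

theorem pow_mul_eval_div {K : Type*} [Field K] {P : ℤ[X]} {m : ℕ} (hP : P.natDegree ≤ m)
    {p q : ℤ} (hq : (q : K) ≠ 0) : (q : K) ^ m * (P.map (Int.castRingHom K)).eval (p / q : K) =
      ((∑ l ∈ Finset.range (m + 1), P.coeff l * p ^ l * q ^ (m - l) : ℤ) : K) := by
  have h1 : (P.map (Int.castRingHom K)).natDegree < m + 1 :=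
    Nat.lt_succ_of_le (natDegree_map_le.trans hP)
  rw [eval_eq_sum_range' h1, Finset.mul_sum]
  push_cast
  refine Finset.sum_congr rfl fun l hl => ?_
  have hl' : l ≤ m := Nat.lt_succ_iff.1 (Finset.mem_range.1 hl)
  rw [coeff_map, div_pow, ← Nat.sub_add_cancel hl', pow_add, Nat.add_sub_cancel]
  field_simp
  simp [mul_comm]

theorem hasseDeriv_map_int {K : Type*} [Field K] (P : ℤ[X]) (i : ℕ) :
    hasseDeriv i (P.map (Int.castRingHom K)) = (hasseDeriv i P).map (Int.castRingHom K) := by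
  ext l
  simp [hasseDeriv_coeff]

theorem pow_mul_mul_hasseDeriv_eval {K : Type*} [Field K] {A B : ℤ[X]} {m : ℕ}
    (hA : A.natDegree ≤ m) (hB : B.natDegree ≤ m) {p q p' q' : ℤ} (hq : (q : K) ≠ 0)
    (hq' : (q' : K) ≠ 0) (i : ℕ) :
    (q : K) ^ m * q' * (hasseDeriv i (A.map (Int.castRingHom K)
      + C (p' / q' : K) * B.map (Int.castRingHom K))).eval (p / q : K) =
      ((q' * (∑ l ∈ Finset.range (m + 1), (hasseDeriv i A).coeff l * p ^ l * q ^ (m - l)) +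
        p' * ∑ l ∈ Finset.range (m + 1), (hasseDeriv i B).coeff l * p ^ l * q ^ (m - l) : ℤ)
          : K) := by
  rw [Int.cast_add, Int.cast_mul, Int.cast_mul,
    ← pow_mul_eval_div ((natDegree_hasseDeriv_le A i).trans ((Nat.sub_le _ _).trans hA)) hq,
    ← pow_mul_eval_div ((natDegree_hasseDeriv_le B i).trans ((Nat.sub_le _ _).trans hB)) hq,
    ← hasseDeriv_map_int, ← hasseDeriv_map_int, map_add, ← smul_eq_C_mul, map_smul, eval_add,
    eval_smul, smul_eq_mul]
  field_simp

/-- Thue's method with two very good approximations to a root of a trinomial. -/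
theorem thue_contradiction {a b c H : ℤ} {n k w ι : ℕ} (hk : 0 < k) (hkn : k < n) (hw : 0 < w)
    (ha0 : a ≠ 0) (ha : |a| ≤ H) (hb : |b| ≤ H) (hc : |c| ≤ H)
    (hirr : Irreducible (C (a : ℚ) * X ^ n + C (b : ℚ) * X ^ k + C (c : ℚ)))
    {α : ℝ} (hα : a * α ^ n + b * α ^ k + c = 0) (hαH : |α| ≤ 2 * H)
    {m : ℕ} (hm : m = 2 * n * w) {Y : ℤ}
    (hYdef : Y = ((2 * m + 2) * 2 ^ m * (2 * H) ^ (m + 1)) ^ 3)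
    {p₁ q₁ p₂ q₂ : ℤ} (hq₁ : 0 < q₁) (hq₂ : 0 < q₂) (hpq : IsCoprime p₁ q₁)
    {δ₁ δ₂ : ℝ} (hδ₁ : |α - p₁ / q₁| ≤ δ₁) (hδ₁' : δ₁ ≤ 1) (hδ₂ : |α - p₂ / q₂| ≤ δ₂)
    (h1 : 4 * (m + 1) ^ 2 * Y ^ 2 < q₁ ^ ι)
    (h2 : (q₁ : ℝ) ^ m * q₂ * ((m + 1) * (2 ^ m * ((m + 1) * (2 ^ m * (Y * (2 * H + 1)) *
      (2 * H + 1) ^ m)) * δ₁ ^ (3 * w - ι))) < 1 / 2)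
    (h3 : (q₁ : ℝ) ^ m * q₂ * (δ₂ * ((m + 1) * (2 ^ m * Y * (2 * H + 1) ^ m))) < 1 / 2) :
    False := by
  have hH : 1 ≤ H := (Int.one_le_abs ha0).trans ha
  have hHR : (1 : ℝ) ≤ H := by exact_mod_cast hH
  set R : ℝ := 2 * H + 1 with hR
  have hR1 : 1 ≤ R := by linarith
  obtain ⟨A, B, hAB, hA, hB, hAY, hBY, hdvd⟩ :=
    exists_siegel_pair hk hkn hw ha0 ha hb hc hα hm
  rw [← hYdef] at hAY hBY
  have hY0 : 0 ≤ Y := (abs_nonneg _).trans (hAY 0)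
  have hmapA : (A.map (Int.castRingHom ℚ)).map (algebraMap ℚ ℝ) = A.map (Int.castRingHom ℝ) := by
    rw [Polynomial.map_map]; congr 1
  have hmapB : (B.map (Int.castRingHom ℚ)).map (algebraMap ℚ ℝ) = B.map (Int.castRingHom ℝ) := by
    rw [Polynomial.map_map]; congr 1
  have hinj : Function.Injective (Int.castRingHom ℚ) := Int.cast_injective
  have hdegf : (C (a : ℚ) * X ^ n + C (b : ℚ) * X ^ k + C (c : ℚ)).natDegree = n := by
    have ha0' : (a : ℚ) ≠ 0 := by exact_mod_cast ha0
    rw [add_assoc]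
    rw [natDegree_add_eq_left_of_natDegree_lt]
    · exact natDegree_C_mul_X_pow n _ ha0'
    · rw [natDegree_C_mul_X_pow n _ ha0']
      refine lt_of_le_of_lt ?_ hkn
      compute_degree
  have hW : wronskian A B ≠ 0 := by
    have h := wronskian_ne_zero_of_pow_dvd (f := C (a : ℚ) * X ^ n + C (b : ℚ) * X ^ k + C (c : ℚ))
      (A := A.map (Int.castRingHom ℚ)) (B := B.map (Int.castRingHom ℚ)) (m := m) (s := 3 * w)
      hirr (α := α) (by simpa using hα) (by rw [hdegf]; omega)
      (by
        rcases hAB with h | h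
        · exact Or.inl ((Polynomial.map_ne_zero_iff hinj).2 h)
        · exact Or.inr ((Polynomial.map_ne_zero_iff hinj).2 h))
      (natDegree_map_le.trans hA) (natDegree_map_le.trans hB)
      (by
        rw [hdegf, hm]
        have : 0 < n * w := Nat.mul_pos (by omega) hw
        nlinarith)
      (by rw [hmapA, hmapB]; exact hdvd)
    intro h0
    apply h
    have : wronskian (A.map (Int.castRingHom ℚ)) (B.map (Int.castRingHom ℚ)) =
      (wronskian A B).map (Int.castRingHom ℚ) := by
        simp [wronskian, derivative_map]
    rw [this, h0, Polynomial.map_zero]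
  have hq₁Q : (q₁ : ℚ) ≠ 0 := by exact_mod_cast hq₁.ne'
  have hq₂Q : (q₂ : ℚ) ≠ 0 := by exact_mod_cast hq₂.ne'
  have hq₁R : (0 : ℝ) < q₁ := by exact_mod_cast hq₁
  have hq₂R : (0 : ℝ) < q₂ := by exact_mod_cast hq₂
  have hex : ∃ i < ι + 1, (hasseDeriv i (A.map (Int.castRingHom ℚ)
      + C (p₂ / q₂ : ℚ) * B.map (Int.castRingHom ℚ))).eval (p₁ / q₁ : ℚ) ≠ 0 := by
    by_contra! h
    exact absurd (pow_le_of_hasseDeriv_eq_zero hA hB hAY hBY hW hq₁ hpq h) (not_le.2 h1)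
  obtain ⟨i, hi, hne⟩ := hex
  have hNQ := pow_mul_mul_hasseDeriv_eval (K := ℚ) hA hB (p := p₁) (p' := p₂) hq₁Q hq₂Q i
  have hNR := pow_mul_mul_hasseDeriv_eval (K := ℝ) hA hB (p := p₁) (p' := p₂) hq₁R.ne' hq₂R.ne' i
  generalize (q₂ * (∑ l ∈ Finset.range (m + 1), (hasseDeriv i A).coeff l * p₁ ^ l * q₁ ^ (m - l)) +
        p₂ * ∑ l ∈ Finset.range (m + 1), (hasseDeriv i B).coeff l * p₁ ^ l * q₁ ^ (m - l) : ℤ)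
        = N at hNQ hNR
  have hN0 : N ≠ 0 := by
    rintro rfl
    rw [Int.cast_zero] at hNQ
    exact (mul_ne_zero (mul_ne_zero (pow_ne_zero m hq₁Q) hq₂Q) hne) hNQ
  have hN1 : (1 : ℝ) ≤ |(N : ℝ)| := by exact_mod_cast Int.one_le_abs hN0
  set G : ℝ[X] := A.map (Int.castRingHom ℝ) + C α * B.map (Int.castRingHom ℝ) with hG
  have hsplit : hasseDeriv i (A.map (Int.castRingHom ℝ)
      + C (p₂ / q₂ : ℝ) * B.map (Int.castRingHom ℝ)) =
      hasseDeriv i G - (α - p₂ / q₂) • hasseDeriv i (B.map (Int.castRingHom ℝ)) := by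
    rw [← map_smul, ← map_sub, hG]
    congr 1
    rw [smul_eq_C_mul, C_sub]; ring
  have hcA : ∀ i, |(A.map (Int.castRingHom ℝ)).coeff i| ≤ (Y : ℝ) := fun i => by
    rw [coeff_map]; simpa using (by exact_mod_cast hAY i : |(A.coeff i : ℝ)| ≤ Y)
  have hcB : ∀ i, |(B.map (Int.castRingHom ℝ)).coeff i| ≤ (Y : ℝ) := fun i => by
    rw [coeff_map]; simpa using (by exact_mod_cast hBY i : |(B.coeff i : ℝ)| ≤ Y)
  have hYR : (0 : ℝ) ≤ Y := by exact_mod_cast hY0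
  have hcG : ∀ i, |G.coeff i| ≤ (Y : ℝ) * R := fun i => by
    rw [hG, coeff_add, coeff_C_mul]
    refine (abs_add_le _ _).trans ?_
    rw [abs_mul]
    have := mul_le_mul hαH (hcB i) (abs_nonneg _) (by linarith)
    have := hcA i
    rw [hR]; linarith
  have hdG : G.natDegree ≤ m := by
    refine (natDegree_add_le _ _).trans (max_le (natDegree_map_le.trans hA) ?_)
    exact (natDegree_C_mul_le _ _).trans (natDegree_map_le.trans hB)
  have hβ : |(p₁ / q₁ : ℝ)| ≤ R := by
    have h := abs_sub_abs_le_abs_sub (p₁ / q₁ : ℝ) α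
    rw [abs_sub_comm] at h
    rw [hR]; linarith
  have hE1 := abs_hasseDeriv_eval_le_of_pow_dvd hdG hcG hR1 (by linarith) hdvd
    (Nat.lt_succ_iff.1 hi) hδ₁ hδ₁'
  have hE2 := abs_hasseDeriv_eval_le (natDegree_map_le.trans hB) hcB hR1 hβ i
  have hprod : (0 : ℝ) ≤ (q₁ : ℝ) ^ m * q₂ := by positivity
  have hfin : |(N : ℝ)| ≤ (q₁ : ℝ) ^ m * q₂ *
      ((m + 1) * (2 ^ m * ((m + 1) * (2 ^ m * (Y * R) * R ^ m)) * δ₁ ^ (3 * w - ι)) +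
        δ₂ * ((m + 1) * (2 ^ m * Y * R ^ m))) := by
    rw [← hNR, hsplit, eval_sub, eval_smul, smul_eq_mul, abs_mul, abs_of_nonneg hprod]
    refine mul_le_mul_of_nonneg_left ?_ hprod
    refine (abs_sub _ _).trans (add_le_add hE1 ?_)
    rw [abs_mul]
    exact mul_le_mul hδ₂ hE2 (abs_nonneg _) ((abs_nonneg _).trans hδ₂)
  rw [mul_add] at hfin
  linarith

theorem two_mul_add_two_pow_le {m : ℕ} (hm : 24 ≤ m) :
    (2 * (m : ℝ) + 2) ^ 5 ≤ 2 ^ (2 * m) ∧ (2 * (m : ℝ) + 2) ^ 8 ≤ 2 ^ (6 * m) := by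
  have h : (2 * (m : ℝ) + 2) ^ 5 ≤ 2 ^ (2 * m) := by
    induction m, hm using Nat.le_induction with
    | base => norm_num
    | succ m hm ih =>
      have hm' : (24 : ℝ) ≤ m := by exact_mod_cast hm
      have h1 : (2 * ((m + 1 : ℕ) : ℝ) + 2) ≤ (2 * (m : ℝ) + 2) * (26 / 25) := by
        push_cast; linarith
      calc (2 * ((m + 1 : ℕ) : ℝ) + 2) ^ 5 ≤ ((2 * (m : ℝ) + 2) * (26 / 25)) ^ 5 :=
            pow_le_pow_left₀ (by positivity) h1 5
        _ = (2 * (m : ℝ) + 2) ^ 5 * (26 / 25) ^ 5 := by ring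
        _ ≤ 2 ^ (2 * m) * 2 ^ 2 := mul_le_mul ih (by norm_num) (by positivity) (by positivity)
        _ = 2 ^ (2 * (m + 1)) := by ring
  refine ⟨h, ?_⟩
  have h1 : (1 : ℝ) ≤ 2 * m + 2 := by linarith [(Nat.cast_nonneg m : (0 : ℝ) ≤ m)]
  calc (2 * (m : ℝ) + 2) ^ 8 ≤ (2 * (m : ℝ) + 2) ^ 10 := pow_le_pow_right₀ h1 (by norm_num)
    _ = ((2 * (m : ℝ) + 2) ^ 5) ^ 2 := by ring
    _ ≤ (2 ^ (2 * m)) ^ 2 := pow_le_pow_left₀ (by positivity) h 2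
    _ = 2 ^ (4 * m) := by rw [← pow_mul]; ring_nf
    _ ≤ 2 ^ (6 * m) := pow_le_pow_right₀ (by norm_num) (by omega)

theorem sq_mul_le_pow_six {M P E Y : ℝ} (hP : 0 < P)
    (hY : Y * (4 * P) ^ 3 = (2 * M + 2) ^ 3 * E ^ 3) (hM : (2 * M + 2) ^ 8 ≤ P ^ 6) :
    4 * (M + 1) ^ 2 * Y ^ 2 ≤ E ^ 6 := by
  have e1 : 4 * (M + 1) ^ 2 * Y ^ 2 * (4 * P) ^ 6 = (2 * M + 2) ^ 8 * E ^ 6 := by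
    calc _ = (2 * M + 2) ^ 2 * (Y * (4 * P) ^ 3) ^ 2 := by ring
      _ = _ := by rw [hY]; ring
  have e2 : (2 * M + 2) ^ 8 ≤ (4 * P) ^ 6 :=
    hM.trans (pow_le_pow_left₀ hP.le (by linarith) 6)
  have e3 : 4 * (M + 1) ^ 2 * Y ^ 2 * (4 * P) ^ 6 ≤ E ^ 6 * (4 * P) ^ 6 := by
    rw [e1, mul_comm]; exact mul_le_mul_of_nonneg_left e2 (by positivity)
  exact le_of_mul_le_mul_right e3 (by positivity)

theorem sq_mul_le_pow_four_div {M P E Y A : ℝ} (hP : 0 < P)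
    (hY : Y * (4 * P) ^ 3 = (2 * M + 2) ^ 3 * E ^ 3) (hM : (2 * M + 2) ^ 5 ≤ P ^ 2)
    (hA : A * (2 * P) = E) :
    (M + 1) ^ 2 * P ^ 2 * Y * A ≤ E ^ 4 / 4 := by
  have e3 : (M + 1) ^ 2 * P ^ 2 * Y * A * (512 * P ^ 2) = (2 * M + 2) ^ 5 * E ^ 4 := by
    calc _ = (2 * M + 2) ^ 2 * (Y * (4 * P) ^ 3) * (A * (2 * P)) := by ring
      _ = _ := by rw [hY, hA]; ring
  have e4 : (M + 1) ^ 2 * P ^ 2 * Y * A * (512 * P ^ 2) ≤ (E ^ 4 / 4) * (512 * P ^ 2) := by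
    rw [e3]
    have : 0 ≤ E ^ 4 * P ^ 2 := by positivity
    linarith [mul_le_mul_of_nonneg_right hM (by positivity : (0 : ℝ) ≤ E ^ 4)]
  exact le_of_mul_le_mul_right e4 (by positivity)

set_option maxHeartbeats 1000000 in
/-- Logarithmic form of `thue_contradiction`. -/
theorem thue_contradiction_log {a b c H : ℤ} {n k w ι : ℕ} (hk : 0 < k) (hkn : k < n)
    (ha0 : a ≠ 0) (ha : |a| ≤ H) (hb : |b| ≤ H) (hc : |c| ≤ H)
    (hirr : Irreducible (C (a : ℚ) * X ^ n + C (b : ℚ) * X ^ k + C (c : ℚ)))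
    {α : ℝ} (hα : a * α ^ n + b * α ^ k + c = 0) (hαH : |α| ≤ 2 * H)
    {m : ℕ} (hm : m = 2 * n * w) (hm24 : 24 ≤ m) (hιw : ι ≤ 3 * w)
    {p₁ q₁ p₂ q₂ : ℤ} (hq₁ : 0 < q₁) (hq₂ : 0 < q₂) (hpq : IsCoprime p₁ q₁)
    {κ : ℝ} (hδ₁ : |α - p₁ / q₁| ≤ Real.exp (κ - n * Real.log q₁))
    (hδ₂ : |α - p₂ / q₂| ≤ Real.exp (κ - n * Real.log q₂))
    (hκ : κ ≤ n * Real.log q₁)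
    (h1 : (6 * m + 6) * Real.log (8 * H) < ι * Real.log q₁)
    (h2 : m * Real.log q₁ + Real.log q₂ + (4 * m + 4) * Real.log (8 * H) ≤
      (3 * w - ι) * (n * Real.log q₁ - κ))
    (h3 : m * Real.log q₁ + Real.log q₂ + (4 * m + 4) * Real.log (8 * H) ≤
      n * Real.log q₂ - κ) : False := by
  have hH : 1 ≤ H := (Int.one_le_abs ha0).trans ha
  have hHR : (1 : ℝ) ≤ H := by exact_mod_cast hH
  have hw : 0 < w := by
    rcases Nat.eq_zero_or_pos w with h | h
    · subst h; omega
    · exact h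
  obtain ⟨hp5, hp8⟩ := two_mul_add_two_pow_le hm24
  have hq₁R : (0 : ℝ) < q₁ := by exact_mod_cast hq₁
  have hq₂R : (0 : ℝ) < q₂ := by exact_mod_cast hq₂
  have hH8 : (0 : ℝ) < 8 * H := by linarith
  have hexp : ∀ (x : ℝ) (e : ℕ), 0 < x → x ^ e = Real.exp (e * Real.log x) := by
    intro x e hx
    rw [Real.exp_nat_mul, Real.exp_log hx]
  set Y : ℤ := ((2 * m + 2) * 2 ^ m * (2 * H) ^ (m + 1)) ^ 3 with hY
  have hYc : (Y : ℝ) = ((2 * m + 2) * 2 ^ m * (2 * H) ^ (m + 1)) ^ 3 := by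
    rw [hY]; push_cast; ring
  have hY' : (Y : ℝ) * (4 * 2 ^ m) ^ 3 = (2 * m + 2) ^ 3 * ((8 * H) ^ (m + 1)) ^ 3 := by
    rw [hYc, ← mul_pow, ← mul_pow]
    congr 1
    have : (8 * (H : ℝ)) ^ (m + 1) = 4 ^ (m + 1) * (2 * H) ^ (m + 1) := by
      rw [← mul_pow]; ring
    rw [this, pow_succ (4 : ℝ), show (4 : ℝ) ^ m = 2 ^ m * 2 ^ m by rw [← mul_pow]; norm_num]
    ring
  have h2m : (0 : ℝ) < 2 ^ m := by positivity
  have hY0 : (0 : ℝ) ≤ Y := by rw [hYc]; positivity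
  set E : ℝ := (8 * H) ^ (m + 1) with hE
  have hE0 : 0 < E := by positivity
  have hi : 4 * ((m : ℝ) + 1) ^ 2 * Y ^ 2 ≤ E ^ 6 := by
    exact sq_mul_le_pow_six h2m hY' (hp8.trans_eq (by rw [← pow_mul, mul_comm 6 m]))
  have hT : (m + 1) * (2 ^ m * ((m + 1) * (2 ^ m * (Y * (2 * H + 1)) * (2 * (H : ℝ) + 1) ^ m)))
      ≤ E ^ 4 / 4 := by
    have e0 : (2 * (H : ℝ) + 1) ^ (m + 1) ≤ (4 * H) ^ (m + 1) :=
      pow_le_pow_left₀ (by linarith) (by linarith) _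
    have e1 : (4 * (H : ℝ)) ^ (m + 1) * 2 ^ (m + 1) = E := by
      rw [hE, ← mul_pow]; ring
    have e2 : (m + 1) * (2 ^ m * ((m + 1) * (2 ^ m * (Y * (2 * H + 1)) * (2 * (H : ℝ) + 1) ^ m)))
      ≤ (m + 1) ^ 2 * (2 ^ m) ^ 2 * Y * (4 * H) ^ (m + 1) := by
      calc _ = (m + 1) ^ 2 * (2 ^ m) ^ 2 * Y * (2 * (H : ℝ) + 1) ^ (m + 1) := by ring
        _ ≤ _ := mul_le_mul_of_nonneg_left e0 (by positivity)
    refine e2.trans ?_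
    exact sq_mul_le_pow_four_div h2m hY' (hp5.trans_eq (by rw [← pow_mul, mul_comm 2 m]))
      (by rw [← e1, pow_succ (2 : ℝ) m]; ring)
  have hElog : ∀ e : ℕ, E ^ e = Real.exp (e * ((m + 1) * Real.log (8 * H))) := by
    intro e
    rw [hexp E e hE0, hE, Real.log_pow]
    push_cast; ring_nf
  have hκ' : Real.exp (κ - n * Real.log q₁) ≤ 1 := by
    rw [Real.exp_le_one_iff]; linarith
  refine thue_contradiction (ι := ι) hk hkn hw ha0 ha hb hc hirr hα hαH hm hY hq₁ hq₂ hpq hδ₁ hκ' hδ₂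
    ?_ ?_ ?_
  · have : (4 * (m + 1) ^ 2 * Y ^ 2 : ℝ) < q₁ ^ ι := by
      refine hi.trans_lt ?_
      rw [hElog, hexp _ _ hq₁R, Real.exp_lt_exp]
      push_cast; linarith
    exact_mod_cast this
  · have e : (q₁ : ℝ) ^ m * q₂ * ((m + 1) * (2 ^ m * ((m + 1) * (2 ^ m * (Y * (2 * H + 1)) *
      (2 * H + 1) ^ m)) * Real.exp (κ - n * Real.log q₁) ^ (3 * w - ι)))
      ≤ Real.exp (m * Real.log q₁) * Real.exp (Real.log q₂) *
        ((Real.exp ((4 : ℕ) * ((m + 1) * Real.log (8 * H))) / 4) *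
          Real.exp ((3 * w - ι) * (κ - n * Real.log q₁))) := by
      rw [← hElog, hexp _ m hq₁R, Real.exp_log hq₂R, ← Real.exp_nat_mul, Nat.cast_sub hιw]
      push_cast
      refine mul_le_mul_of_nonneg_left ?_ (by positivity)
      rw [← mul_assoc]
      exact mul_le_mul_of_nonneg_right hT (Real.exp_pos _).le
    refine e.trans_lt ?_
    have e1 : Real.exp (m * Real.log q₁) * Real.exp (Real.log q₂) *
        ((Real.exp ((4 : ℕ) * ((m + 1) * Real.log (8 * H))) / 4) *
          Real.exp ((3 * w - ι) * (κ - n * Real.log q₁))) =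
        Real.exp (m * Real.log q₁ + Real.log q₂ + (4 : ℕ) * ((m + 1) * Real.log (8 * H))
          + (3 * w - ι) * (κ - n * Real.log q₁)) / 4 := by
      rw [Real.exp_add, Real.exp_add, Real.exp_add]; ring
    rw [e1]
    have e2 : Real.exp (m * Real.log q₁ + Real.log q₂ + (4 : ℕ) * ((m + 1) * Real.log (8 * H))
          + (3 * w - ι) * (κ - n * Real.log q₁)) ≤ 1 := by
      rw [Real.exp_le_one_iff]; push_cast; linarith
    exact (div_le_div_of_nonneg_right e2 (by norm_num)).trans_lt (by norm_num)
  · have e0 : (m + 1) * (2 ^ m * Y * (2 * (H : ℝ) + 1) ^ m) ≤ E ^ 4 / 4 := by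
      refine le_trans ?_ hT
      refine mul_le_mul_of_nonneg_left ?_ (by positivity)
      have f1 : (1 : ℝ) ≤ 2 ^ m := one_le_pow₀ (by norm_num)
      have f2 : (1 : ℝ) ≤ m + 1 := by linarith [(Nat.cast_nonneg m : (0 : ℝ) ≤ m)]
      have f3 : (1 : ℝ) ≤ 2 * H + 1 := by linarith
      have f4 : (0 : ℝ) ≤ 2 ^ m * Y * (2 * (H : ℝ) + 1) ^ m := by positivity
      calc _ ≤ (2 ^ m * (m + 1) * (2 * (H : ℝ) + 1)) * (2 ^ m * Y * (2 * (H : ℝ) + 1) ^ m) :=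
            le_mul_of_one_le_left f4
              (one_le_mul_of_one_le_of_one_le (one_le_mul_of_one_le_of_one_le f1 f2) f3)
        _ = _ := by ring
    have e : (q₁ : ℝ) ^ m * q₂ * (Real.exp (κ - n * Real.log q₂) *
        ((m + 1) * (2 ^ m * Y * (2 * H + 1) ^ m)))
      ≤ Real.exp (m * Real.log q₁) * Real.exp (Real.log q₂) * (Real.exp (κ - n * Real.log q₂) *
        (Real.exp ((4 : ℕ) * ((m + 1) * Real.log (8 * H))) / 4)) := by
      rw [← hElog, hexp _ m hq₁R, Real.exp_log hq₂R]
      refine mul_le_mul_of_nonneg_left ?_ (by positivity)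
      exact mul_le_mul_of_nonneg_left e0 (Real.exp_pos _).le
    refine e.trans_lt ?_
    have e1 : Real.exp (m * Real.log q₁) * Real.exp (Real.log q₂) *
        (Real.exp (κ - n * Real.log q₂) *
        (Real.exp ((4 : ℕ) * ((m + 1) * Real.log (8 * H))) / 4)) =
        Real.exp (m * Real.log q₁ + Real.log q₂ + (4 : ℕ) * ((m + 1) * Real.log (8 * H))
          + (κ - n * Real.log q₂)) / 4 := by
      rw [Real.exp_add, Real.exp_add, Real.exp_add]; ring
    rw [e1]
    have e2 : Real.exp (m * Real.log q₁ + Real.log q₂ + (4 : ℕ) * ((m + 1) * Real.log (8 * H))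
          + (κ - n * Real.log q₂)) ≤ 1 := by
      rw [Real.exp_le_one_iff]; push_cast; linarith
    exact (div_le_div_of_nonneg_right e2 (by norm_num)).trans_lt (by norm_num)

/-- The numerical conditions on the parameters `w`, `ι` used in `thue_contradiction_log`. -/
def ThueParameters (n w ι : ℕ) (y t g κ : ℝ) : Prop :=
  24 ≤ 2 * n * w ∧ ι ≤ 3 * w ∧ (6 * (2 * n * w) + 6) * g < ι * y ∧
    2 * n * w * y + t + (4 * (2 * n * w) + 4) * g ≤ (3 * w - ι) * (n * y - κ) ∧
    2 * n * w * y + t + (4 * (2 * n * w) + 4) * g ≤ n * t - κ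

/-- A multiple of `y` slightly above `t`. -/
theorem exists_nat_mul_near {y t s : ℝ} (hy : 0 < y) (hs : 0 < s) (ht : 0 < t) :
    ∃ w : ℕ, 0 < w ∧ t ≤ s * w * y ∧ s * (w - 1) * y < t := by
  refine ⟨⌈t / (s * y)⌉₊, Nat.ceil_pos.2 (by positivity), ?_, ?_⟩
  · have := Nat.le_ceil (t / (s * y))
    rw [div_le_iff₀ (by positivity)] at this
    linarith
  · have := Nat.ceil_lt_add_one (a := t / (s * y)) (by positivity)
    have h2 : (⌈t / (s * y)⌉₊ : ℝ) - 1 < t / (s * y) := by linarith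
    rw [lt_div_iff₀ (by positivity)] at h2
    linarith

theorem exists_thueParameters_large {n : ℕ} (hn : 219 ≤ n) {y t g κ : ℝ} (hg : 0 < g)
    (hy : 20 * n * g ≤ y) (hκ : κ ≤ y / 5) (ht : 100 * y ≤ t) :
    ∃ w ι, ThueParameters n w ι y t g κ := by
  have hnR : (219 : ℝ) ≤ n := by exact_mod_cast hn
  have hy0 : 0 < y := lt_of_lt_of_le (by positivity) hy
  obtain ⟨w, hw0, hw1, hw2⟩ := exists_nat_mul_near hy0 (by norm_num : (0 : ℝ) < 4)
    (by linarith : 0 < t)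
  have hw25 : 25 ≤ w := by
    have : (25 : ℝ) * y ≤ w * y := by linarith
    exact_mod_cast le_of_mul_le_mul_right this hy0
  have hwR : (25 : ℝ) ≤ w := by exact_mod_cast hw25
  have hι1 : (18 / 25 : ℝ) * w ≤ (3 * w / 4 : ℕ) := by
    have : 18 * w ≤ 25 * (3 * w / 4) := by omega
    have : (18 * w : ℝ) ≤ 25 * (3 * w / 4 : ℕ) := by exact_mod_cast this
    linarith
  have hι2 : ((3 * w / 4 : ℕ) : ℝ) ≤ 3 / 4 * w := by
    have : 4 * (3 * w / 4) ≤ 3 * w := by omega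
    have : (4 * (3 * w / 4 : ℕ) : ℝ) ≤ 3 * w := by exact_mod_cast this
    linarith
  refine ⟨w, 3 * w / 4, by nlinarith, by omega, ?_, ?_, ?_⟩
  all_goals
    generalize ((3 * w / 4 : ℕ) : ℝ) = i at *
    have e1 : 20 * (w * (n * g)) ≤ w * y := by nlinarith
    have e2 : 219 * g ≤ n * g := by nlinarith
    have e3 : 25 * y ≤ w * y := by nlinarith
    have e4 : 219 * (w * y) ≤ n * (w * y) := by nlinarith [mul_nonneg (by linarith : (0:ℝ) ≤ w) hy0.le]
  · have e5 : 25 * (n * g) ≤ w * (n * g) := by nlinarith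
    have e6 : 18 / 25 * (w * y) ≤ i * y := by nlinarith
    nlinarith
  · have e5 : (9 / 4 * w) * (n * y - y / 5) ≤ (3 * w - i) * (n * y - κ) := by
      apply mul_le_mul <;> nlinarith
    refine le_trans ?_ e5
    linarith
  · have e5 : n * (4 * (w - 1) * y) ≤ n * t := by nlinarith
    have e6 : n * (100 * y) ≤ n * t := by nlinarith
    have e7 : 219 * t ≤ n * t := by nlinarith
    have e8 : 219 * y ≤ n * y := by nlinarith
    linarith

theorem exists_thueParameters_medium {n : ℕ} (hn : 8 ≤ n) {y t g κ : ℝ} (hg : 0 < g)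
    (hy : 45 * n * g ≤ y) (hκ : κ ≤ y / 20) (ht : (n - 2) * y ≤ t) :
    ∃ w ι, ThueParameters n w ι y t g κ := by
  have hnR : (8 : ℝ) ≤ n := by exact_mod_cast hn
  have hy0 : 0 < y := lt_of_lt_of_le (by positivity) hy
  have ht6 : 6 * y ≤ t := by nlinarith
  obtain ⟨w, hw0, hw1, hw2⟩ := exists_nat_mul_near hy0 (by norm_num : (0 : ℝ) < 7 / 2)
    (by linarith : 0 < t)
  have hw25 : 2 ≤ w := by
    have : (1 : ℝ) * y < w * y := by linarith
    have h : (1 : ℝ) < w := lt_of_mul_lt_mul_right this hy0.le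
    exact_mod_cast h
  have hwR : (2 : ℝ) ≤ w := by exact_mod_cast hw25
  have hι1 : (1 / 3 : ℝ) * w ≤ (w / 2 : ℕ) := by
    have : w ≤ 3 * (w / 2) := by omega
    have : (w : ℝ) ≤ 3 * (w / 2 : ℕ) := by exact_mod_cast this
    linarith
  have hι2 : ((w / 2 : ℕ) : ℝ) ≤ 1 / 2 * w := by
    have : 2 * (w / 2) ≤ w := by omega
    have : (2 * (w / 2 : ℕ) : ℝ) ≤ w := by exact_mod_cast this
    linarith
  refine ⟨w, w / 2, by nlinarith, by omega, ?_, ?_, ?_⟩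
  all_goals
    generalize ((w / 2 : ℕ) : ℝ) = i at *
    have e1 : 45 * (w * (n * g)) ≤ w * y := by nlinarith
    have e2 : 8 * g ≤ n * g := by nlinarith
    have e3 : 2 * y ≤ w * y := by nlinarith
    have e4 : 8 * (w * y) ≤ n * (w * y) := by nlinarith [mul_nonneg (by linarith : (0:ℝ) ≤ w) hy0.le]
  · have e5 : 2 * (n * g) ≤ w * (n * g) := by nlinarith
    have e6 : 1 / 3 * (w * y) ≤ i * y := by nlinarith
    nlinarith
  · have e5 : (5 / 2 * w) * (n * y - y / 20) ≤ (3 * w - i) * (n * y - κ) := by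
      apply mul_le_mul <;> nlinarith
    refine le_trans ?_ e5
    linarith
  · rcases hw25.eq_or_lt with h | h
    · subst h
      have e5 : (n - 1) * ((n - 2) * y) ≤ (n - 1) * t := by nlinarith
      have e6 : 8 * (n * y) ≤ n * (n * y) := by nlinarith [mul_nonneg (by linarith : (0:ℝ) ≤ n) hy0.le]
      push_cast at *
      linarith
    · have h3 : (3 : ℝ) ≤ w := by exact_mod_cast h
      have e5 : (n - 1) * (7 / 2 * (w - 1) * y) ≤ (n - 1) * t := by nlinarith
      have e6 : (3 / 2 * n - 166 / 45) * (3 * y) ≤ (3 / 2 * n - 166 / 45) * (w * y) := by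
        apply mul_le_mul_of_nonneg_left <;> nlinarith
      have e7 : 8 * y ≤ n * y := by nlinarith
      linarith

theorem exists_thueParameters_small {n : ℕ} (hn : 6 ≤ n) {y t g κ : ℝ} (hg : 0 < g)
    (hy : 100 * n * g ≤ y) (hκ : κ ≤ y / 25) (ht : 16 * y ≤ t) :
    ∃ w ι, ThueParameters n w ι y t g κ := by
  have hnR : (6 : ℝ) ≤ n := by exact_mod_cast hn
  have hy0 : 0 < y := lt_of_lt_of_le (by positivity) hy
  obtain ⟨w, hw0, hw1, hw2⟩ := exists_nat_mul_near hy0 (by norm_num : (0 : ℝ) < 4)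
    (by linarith : 0 < t)
  have hw25 : 4 ≤ w := by
    have : (4 : ℝ) * y ≤ w * y := by linarith
    exact_mod_cast le_of_mul_le_mul_right this hy0
  have hwR : (4 : ℝ) ≤ w := by exact_mod_cast hw25
  have hι1 : (1 / 7 : ℝ) * w ≤ (w / 4 : ℕ) := by
    have : w ≤ 7 * (w / 4) := by omega
    have : (w : ℝ) ≤ 7 * (w / 4 : ℕ) := by exact_mod_cast this
    linarith
  have hι2 : ((w / 4 : ℕ) : ℝ) ≤ 1 / 4 * w := by
    have : 4 * (w / 4) ≤ w := by omega
    have : (4 * (w / 4 : ℕ) : ℝ) ≤ w := by exact_mod_cast this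
    linarith
  refine ⟨w, w / 4, by nlinarith, by omega, ?_, ?_, ?_⟩
  all_goals
    generalize ((w / 4 : ℕ) : ℝ) = i at *
    have e1 : 100 * (w * (n * g)) ≤ w * y := by nlinarith
    have e2 : 6 * g ≤ n * g := by nlinarith
    have e3 : 4 * y ≤ w * y := by nlinarith
    have e4 : 6 * (w * y) ≤ n * (w * y) := by nlinarith [mul_nonneg (by linarith : (0:ℝ) ≤ w) hy0.le]
  · have e5 : 4 * (n * g) ≤ w * (n * g) := by nlinarith
    have e6 : 1 / 7 * (w * y) ≤ i * y := by nlinarith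
    nlinarith
  · have e5 : (11 / 4 * w) * (n * y - y / 25) ≤ (3 * w - i) * (n * y - κ) := by
      apply mul_le_mul <;> nlinarith
    refine le_trans ?_ e5
    linarith
  · have e5 : n * (4 * (w - 1) * y) ≤ n * t := by nlinarith
    have e6 : n * (16 * y) ≤ n * t := by nlinarith
    have e7 : 6 * t ≤ n * t := by nlinarith
    have e8 : 6 * y ≤ n * y := by nlinarith
    linarith

/-- Logarithmic sizes `ℓ i = log (max (p i) (q i))`, `y i = log (q i)` of a sequence of solutions
satisfying the gap principles. -/
structure LogChain (n Z : ℕ) (ℓ y : ℕ → ℝ) (g K : ℝ) : Prop where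
  one : ∀ i ≤ Z, Real.log 2 ≤ ℓ i
  gap : ∀ i < Z, (n - 2) * ℓ i ≤ Real.log 2 + 2 * ℓ (i + 1)
  height : g ≤ Real.log 40 + 2 * ℓ 0 + 2 * ℓ 1
  lower : ∀ i ≤ Z, ℓ i ≤ g + y i
  upper : ∀ i ≤ Z, y i ≤ ℓ i
  log_two_le : Real.log 2 ≤ g
  le_add : K ≤ g + 2 * Real.log n
  nonneg : 0 ≤ K
  lin : ∀ i < Z, 2 * K ≤ y i → 2 * K ≤ y (i + 1) → y i ≤ y (i + 1) →
    (n - 1) * y i - (n + 1) * K - Real.log 2 ≤ y (i + 1)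

namespace LogChain

variable {n Z : ℕ} {ℓ y : ℕ → ℝ} {g K : ℝ}

theorem step (h : LogChain n Z ℓ y g K) (hn : 6 ≤ n) {i : ℕ} (hi : i < Z) (hg : 2 * g ≤ y i)
    (hK : (n + 1) * K + Real.log 2 ≤ y i) : (n - 2) * y i ≤ y (i + 1) := by
  have hnR : (6 : ℝ) ≤ n := by exact_mod_cast hn
  have h0 := h.nonneg
  have h2 : 0 < Real.log 2 := Real.log_pos (by norm_num)
  have e1 := h.gap i hi
  have e2 := h.lower (i + 1) hi
  have e3 := h.upper i hi.le
  have e4 := h.log_two_le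
  have e5 : 2 * K ≤ y i := by nlinarith
  have e6 : 4 * ℓ i ≤ (n - 2) * ℓ i := by
    apply mul_le_mul_of_nonneg_right <;> linarith
  have e7 : y i ≤ y (i + 1) := by linarith
  have := h.lin i hi e5 (e5.trans e7) e7
  linarith

theorem growth (h : LogChain n Z ℓ y g K) (hn : 6 ≤ n) (j : ℕ) (hj : j + 1 ≤ Z) :
    (((n : ℝ) - 2) / 2) ^ j * (ℓ 1 - Real.log 2 / (n - 4)) ≤ ℓ (j + 1) - Real.log 2 / (n - 4) := by
  have hnR : (6 : ℝ) ≤ n := by exact_mod_cast hn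
  induction j with
  | zero => simp
  | succ j ih =>
    have e1 := ih (by omega)
    have e2 := h.gap (j + 1) hj
    have e3 : Real.log 2 = (n - 4) * (Real.log 2 / (n - 4)) := by
      field_simp [show (n : ℝ) - 4 ≠ 0 by linarith]
    generalize Real.log 2 / (n - 4) = d at *
    rw [pow_succ]
    have e4 := mul_le_mul_of_nonneg_left e1 (by linarith : (0 : ℝ) ≤ (n - 2) / 2)
    nlinarith

theorem log_two_mul_le (h : LogChain n Z ℓ y g K) (hn : 6 ≤ n) (hZ : 1 ≤ Z) :
    Real.log 2 * ((n - 5) * (n - 2)) ≤ 2 * (n - 4) * (ℓ 1 - Real.log 2 / (n - 4)) := by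
  have hnR : (6 : ℝ) ≤ n := by exact_mod_cast hn
  have e1 := h.gap 0 (by omega)
  have e2 := h.one 0 (by omega)
  have e3 : (n - 4) * (Real.log 2 / (n - 4)) = Real.log 2 := by
    field_simp [show (n : ℝ) - 4 ≠ 0 by linarith]
  have e4 : (n - 2) * Real.log 2 ≤ Real.log 2 + 2 * ℓ 1 := by nlinarith
  have e5 := mul_le_mul_of_nonneg_left e4 (by linarith : (0 : ℝ) ≤ n - 4)
  have e6 : 2 * (n - 4) * (ℓ 1 - Real.log 2 / (n - 4))
      = 2 * ((n - 4) * ℓ 1) - 2 * ((n - 4) * (Real.log 2 / (n - 4))) := by ring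
  rw [e6, e3]
  nlinarith

theorem height_le (h : LogChain n Z ℓ y g K) (hn : 6 ≤ n) (hZ : 1 ≤ Z) :
    g ≤ 16 / 3 * Real.log 2 + (2 + 4 / (n - 2)) * (ℓ 1 - Real.log 2 / (n - 4))
      + 4 * (Real.log 2 / (n - 4)) := by
  have hnR : (6 : ℝ) ≤ n := by exact_mod_cast hn
  have e1 := h.gap 0 (by omega)
  have e0 := h.height
  have e3 : (n - 4) * (Real.log 2 / (n - 4)) = Real.log 2 := by
    field_simp [show (n : ℝ) - 4 ≠ 0 by linarith]
  have e40 : Real.log 40 ≤ 16 / 3 * Real.log 2 := by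
    have : 3 * Real.log 40 ≤ 16 * Real.log 2 := by
      have := Real.log_le_log (by norm_num) (by norm_num : (40 : ℝ) ^ 3 ≤ 2 ^ 16)
      rwa [Real.log_pow, Real.log_pow] at this
    linarith
  generalize Real.log 2 / (n - 4) = d at *
  have e5 : ℓ 0 - d ≤ 2 / (n - 2) * (ℓ 1 - d) := by
    rw [div_mul_eq_mul_div, le_div_iff₀ (by linarith)]
    norm_num at e1
    linarith
  have e6 : (2 + 4 / ((n : ℝ) - 2)) * (ℓ 1 - d) = 2 * (ℓ 1 - d) + 2 * (2 / (n - 2) * (ℓ 1 - d)) := by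
    ring
  rw [e6]
  linarith

theorem start (h : LogChain n Z ℓ y g K) (hn : 6 ≤ n) {j : ℕ} (hj : j + 1 ≤ Z) {E C B M η : ℝ}
    (hE : E = ℓ 1 - Real.log 2 / (n - 4)) (hE0 : 0 ≤ E) (hη : 0 ≤ η) (hC : g ≤ C * E)
    (hB : Real.log n ≤ B * E)
    (hM : (M + 1) * C ≤ (((n : ℝ) - 2) / 2) ^ j) (hη' : (n + 1) * (C + 2 * B) ≤ η * (M * C)) :
    M * C * E ≤ y (j + 1) ∧ (n + 1) * K ≤ η * y (j + 1) := by
  have hnR : (6 : ℝ) ≤ n := by exact_mod_cast hn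
  have h2 : 0 < Real.log 2 / (n - 4) := div_pos (Real.log_pos (by norm_num)) (by linarith)
  have e1 := h.growth hn j hj
  rw [← hE] at e1
  have e2 := h.lower (j + 1) hj
  have e3 := mul_le_mul_of_nonneg_right hM hE0
  have e4 : M * C * E ≤ y (j + 1) := by linarith
  refine ⟨e4, ?_⟩
  have e5 := h.le_add
  calc (n + 1) * K ≤ (n + 1) * ((C + 2 * B) * E) := by
        apply mul_le_mul_of_nonneg_left <;> linarith
    _ = ((n + 1) * (C + 2 * B)) * E := by ring
    _ ≤ (η * (M * C)) * E := mul_le_mul_of_nonneg_right hη' hE0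
    _ = η * (M * C * E) := by ring
    _ ≤ _ := mul_le_mul_of_nonneg_left e4 hη

end LogChain

theorem log_natCast_le_of_pow_le {a e f : ℕ} (ha : 0 < a) (h : a ^ e ≤ 2 ^ f) :
    e * Real.log a ≤ f * Real.log 2 := by
  have := Real.log_le_log (by positivity) (by exact_mod_cast h : (a : ℝ) ^ e ≤ 2 ^ f)
  rwa [Real.log_pow, Real.log_pow] at this

theorem log_natCast_le {n : ℕ} (hn : 10 ≤ n) {E : ℝ}
    (hE : Real.log 2 * ((n - 5) * (n - 2)) ≤ 2 * (n - 4) * E) : Real.log n ≤ E := by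
  have hnR : (10 : ℝ) ≤ n := by exact_mod_cast hn
  have h10 := log_natCast_le_of_pow_le (a := 10) (e := 3) (f := 10) (by norm_num) (by norm_num)
  push_cast at h10
  have h2 := Real.log_two_gt_d9
  have h1 := Real.log_le_sub_one_of_pos (show (0 : ℝ) < n / 10 by positivity)
  rw [Real.log_div (by positivity) (by norm_num)] at h1
  have h3 : Real.log n ≤ (10 / 3 + (n - 10) * (3 / 20)) * Real.log 2 := by nlinarith
  refine h3.trans ?_
  have h4 : 2 * ((n : ℝ) - 4) * (10 / 3 + (n - 10) * (3 / 20)) ≤ (n - 5) * (n - 2) := by nlinarith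
  have h5 := mul_le_mul_of_nonneg_right h4 (by linarith : 0 ≤ Real.log 2)
  have h6 : 2 * ((n : ℝ) - 4) * ((10 / 3 + (n - 10) * (3 / 20)) * Real.log 2)
    ≤ 2 * (n - 4) * E := by linarith
  exact le_of_mul_le_mul_left h6 (by linarith)

namespace LogChain

variable {n Z : ℕ} {ℓ y : ℕ → ℝ} {g K : ℝ}

/-- A pair of solutions of the chain to which `thue_contradiction_log` applies. -/
def HasThuePair (n Z : ℕ) (y : ℕ → ℝ) (g K : ℝ) : Prop :=
  ∃ i j, i < j ∧ j ≤ Z ∧ 2 * K ≤ y i ∧ 2 * K ≤ y j ∧ (n + 1) * K ≤ n * y i ∧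
    ∃ w ι, ThueParameters n w ι (y i) (y j) g ((n + 1) * K)

theorem hasThuePair_medium (h : LogChain n Z ℓ y g K) (hn : 8 ≤ n) {j : ℕ} (hj : j + 2 ≤ Z)
    {E C B : ℝ} (hE : E = ℓ 1 - Real.log 2 / (n - 4)) (hE0 : 0 ≤ E) (hC : g ≤ C * E)
    (hB : Real.log n ≤ B * E)
    (hM : (45 * n + 1) * C ≤ (((n : ℝ) - 2) / 2) ^ j)
    (hη : (n + 1) * (C + 2 * B) ≤ 1 / 20 * (45 * n * C)) : HasThuePair n Z y g K := by
  have hnR : (8 : ℝ) ≤ n := by exact_mod_cast hn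
  have hg : 0 < g := (Real.log_pos (by norm_num)).trans_le h.log_two_le
  have hl := h.log_two_le
  have hK := h.nonneg
  obtain ⟨e1, e2⟩ := h.start (by omega) (by omega) hE hE0 (by norm_num) hC hB hM hη
  have e3 : 45 * n * g ≤ y (j + 1) := le_trans (by nlinarith) e1
  have e4 : 8 * g ≤ n * g := by nlinarith
  have hy0 : 0 < y (j + 1) := by linarith
  have e5 := h.step (by omega) (by omega : j + 1 < Z) (by linarith) (by linarith)
  have e6 : 2 * K ≤ y (j + 1) := by nlinarith
  refine ⟨j + 1, j + 2, by omega, hj, e6, ?_, ?_,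
    exists_thueParameters_medium hn hg e3 (by linarith) e5⟩
  · exact e6.trans (le_trans (by nlinarith) e5)
  · nlinarith

theorem hasThuePair_large (h : LogChain n Z ℓ y g K) (hn : 219 ≤ n) {j : ℕ} (hj : j + 2 ≤ Z)
    {E C B : ℝ} (hE : E = ℓ 1 - Real.log 2 / (n - 4)) (hE0 : 0 ≤ E) (hC : g ≤ C * E)
    (hB : Real.log n ≤ B * E)
    (hM : (20 * n + 1) * C ≤ (((n : ℝ) - 2) / 2) ^ j)
    (hη : (n + 1) * (C + 2 * B) ≤ 1 / 5 * (20 * n * C)) : HasThuePair n Z y g K := by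
  have hnR : (219 : ℝ) ≤ n := by exact_mod_cast hn
  have hg : 0 < g := (Real.log_pos (by norm_num)).trans_le h.log_two_le
  have hl := h.log_two_le
  have hK := h.nonneg
  obtain ⟨e1, e2⟩ := h.start (by omega) (by omega) hE hE0 (by norm_num) hC hB hM hη
  have e3 : 20 * n * g ≤ y (j + 1) := le_trans (by nlinarith) e1
  have e4 : 8 * g ≤ n * g := by nlinarith
  have hy0 : 0 < y (j + 1) := by linarith
  have e5 := h.step (by omega) (by omega : j + 1 < Z) (by linarith) (by linarith)
  have e6 : 2 * K ≤ y (j + 1) := by nlinarith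
  have e7 : 100 * y (j + 1) ≤ y (j + 2) := le_trans (by nlinarith) e5
  refine ⟨j + 1, j + 2, by omega, hj, e6, by linarith, by nlinarith,
    exists_thueParameters_large hn hg e3 (by linarith) e7⟩

theorem hasThuePair_small (h : LogChain n Z ℓ y g K) (hn : 6 ≤ n) {j : ℕ} (hj : j + 4 ≤ Z)
    {E C B M : ℝ} (hE : E = ℓ 1 - Real.log 2 / (n - 4)) (hE0 : 0 ≤ E) (hC : g ≤ C * E)
    (hB : Real.log n ≤ B * E) (hM0 : 25 * n ≤ M)
    (hM : (M + 1) * C ≤ (((n : ℝ) - 2) / 2) ^ j) (hM2 : 100 * n ≤ (n - 2) * M)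
    (hη : (n + 1) * (C + 2 * B) ≤ 1 / 10 * (M * C)) : HasThuePair n Z y g K := by
  have hnR : (6 : ℝ) ≤ n := by exact_mod_cast hn
  have hg : 0 < g := (Real.log_pos (by norm_num)).trans_le h.log_two_le
  have hl := h.log_two_le
  have hK := h.nonneg
  obtain ⟨e1, e2⟩ := h.start (by omega) (by omega) hE hE0 (by norm_num) hC hB hM hη
  have e3 : M * g ≤ y (j + 1) := le_trans (by nlinarith) e1
  have e3' : 25 * n * g ≤ y (j + 1) := le_trans (by nlinarith) e3
  have e4 : 6 * g ≤ n * g := by nlinarith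
  have hy0 : 0 < y (j + 1) := by linarith
  have e5 := h.step (by omega) (by omega : j + 1 < Z) (by linarith) (by linarith)
  have f1 : 100 * n * g ≤ y (j + 2) := by
    calc _ ≤ (n - 2) * M * g := by nlinarith
      _ = (n - 2) * (M * g) := by ring
      _ ≤ (n - 2) * y (j + 1) := by nlinarith
      _ ≤ _ := e5
  have f2 : y (j + 1) * 4 ≤ y (j + 2) := le_trans (by nlinarith) e5
  have e6 := h.step (by omega) (by omega : j + 2 < Z) (by linarith) (by linarith)
  have f3 : y (j + 2) * 4 ≤ y (j + 3) := le_trans (by nlinarith) e6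
  have e7 := h.step (by omega) (by omega : j + 3 < Z) (by linarith) (by linarith)
  have f4 : y (j + 3) * 4 ≤ y (j + 4) := le_trans (by nlinarith) e7
  have e8 : 2 * K ≤ y (j + 1) := by nlinarith
  refine ⟨j + 2, j + 4, by omega, hj, by linarith, by linarith, by nlinarith,
    exists_thueParameters_small hn hg f1 (by linarith) (by linarith)⟩

end LogChain

namespace LogChain

variable {n Z : ℕ} {ℓ y : ℕ → ℝ} {g K : ℝ}

set_option maxHeartbeats 1000000 in
theorem hasThuePair (hn : 6 ≤ n) (h : LogChain n (z n) ℓ y g K) : HasThuePair n (z n) y g K := by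
  have hnR : (6 : ℝ) ≤ n := by exact_mod_cast hn
  have hZ : 4 ≤ z n := by unfold z; split_ifs <;> norm_num
  have h2 : 0 < Real.log 2 := Real.log_pos (by norm_num)
  have hlow := h.log_two_mul_le hn (by omega)
  have hup := h.height_le hn (by omega)
  obtain ⟨E, hE⟩ : ∃ E, E = ℓ 1 - Real.log 2 / (n - 4) := ⟨_, rfl⟩
  rw [← hE] at hlow hup
  have hE0 : 0 ≤ E := by
    have : 0 ≤ Real.log 2 * ((n - 5) * (n - 2)) :=
      mul_nonneg h2.le (mul_nonneg (by linarith) (by linarith))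
    exact nonneg_of_mul_nonneg_right (this.trans hlow) (by linarith)
  have hC : ∀ {n₀ e C : ℝ}, 6 ≤ n₀ → n₀ ≤ n → 0 < e → Real.log 2 * e ≤ E →
      (16 / 3 + 4 / (n₀ - 4)) / e + 2 + 4 / (n₀ - 2) ≤ C → g ≤ C * E := by
    intro n₀ e C h6 hn₀ he heE hCe
    have f1 : 4 / ((n : ℝ) - 2) ≤ 4 / (n₀ - 2) :=
      div_le_div_of_nonneg_left (by norm_num) (by linarith) (by linarith)
    have f2 : Real.log 2 / ((n : ℝ) - 4) ≤ Real.log 2 / (n₀ - 4) :=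
      div_le_div_of_nonneg_left h2.le (by linarith) (by linarith)
    have f3 : (16 / 3 + 4 / (n₀ - 4)) * Real.log 2 ≤ (16 / 3 + 4 / (n₀ - 4)) / e * E := by
      have f4 : 0 < 4 / (n₀ - 4) := div_pos (by norm_num) (by linarith)
      calc _ = (16 / 3 + 4 / (n₀ - 4)) / e * (Real.log 2 * e) := by field_simp
        _ ≤ _ := mul_le_mul_of_nonneg_left heE (by positivity)
    calc g ≤ 16 / 3 * Real.log 2 + (2 + 4 / (n₀ - 2)) * E + 4 * (Real.log 2 / (n₀ - 4)) := by
          have := mul_le_mul_of_nonneg_right f1 hE0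
          linarith
      _ = (16 / 3 + 4 / (n₀ - 4)) * Real.log 2 + (2 + 4 / (n₀ - 2)) * E := by ring
      _ ≤ ((16 / 3 + 4 / (n₀ - 4)) / e + 2 + 4 / (n₀ - 2)) * E := by linarith
      _ ≤ _ := mul_le_mul_of_nonneg_right hCe hE0
  rcases Nat.lt_or_ge n 10 with h10 | h10
  · interval_cases n
    · have hl := log_natCast_le_of_pow_le (a := 6) (e := 5) (f := 13) (by norm_num) (by norm_num)
      push_cast at *
      exact h.hasThuePair_small (j := 11) (C := 10.4) (B := 2.6) (M := 150) (by norm_num)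
        (by norm_num [z]) (by exact_mod_cast hE) hE0
        (hC (n₀ := 6) (e := 1) (by norm_num) (by norm_num) (by norm_num) (by linarith) (by norm_num))
        (by push_cast; linarith) (by norm_num) (by norm_num) (by norm_num) (by norm_num)
    · have hl := log_natCast_le_of_pow_le (a := 7) (e := 1) (f := 3) (by norm_num) (by norm_num)
      push_cast at *
      exact h.hasThuePair_small (j := 8) (C := 6.8) (B := 2.6) (M := 175) (by norm_num)
        (by norm_num [z]) (by exact_mod_cast hE) hE0
        (hC (n₀ := 7) (e := 5 / 3) (by norm_num) (by norm_num) (by norm_num) (by linarith)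
          (by norm_num))
        (by push_cast; linarith) (by norm_num) (by norm_num) (by norm_num) (by norm_num)
    · have hl := log_natCast_le_of_pow_le (a := 8) (e := 1) (f := 3) (by norm_num) (by norm_num)
      push_cast at *
      exact h.hasThuePair_medium (j := 9) (C := 5.5) (B := 1.34) (by norm_num)
        (by norm_num [z]) (by exact_mod_cast hE) hE0
        (hC (n₀ := 8) (e := 9 / 4) (by norm_num) (by norm_num) (by norm_num) (by linarith)
          (by norm_num))
        (by push_cast; linarith) (by norm_num) (by norm_num)
    · have hl := log_natCast_le_of_pow_le (a := 9) (e := 2) (f := 7) (by norm_num) (by norm_num)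
      push_cast at *
      exact h.hasThuePair_medium (j := 7) (C := 5.5) (B := 1.34) (by norm_num)
        (by norm_num [z]) (by exact_mod_cast hE) hE0
        (hC (n₀ := 9) (e := 14 / 5) (by norm_num) (by norm_num) (by norm_num) (by linarith)
          (by norm_num))
        (by push_cast; linarith) (by norm_num) (by norm_num)
  have hB : Real.log n ≤ 1 * E := by rw [one_mul]; exact log_natCast_le h10 hlow
  have hlow' : ∀ {n₀ : ℝ}, 6 ≤ n₀ → n₀ ≤ n →
      Real.log 2 * ((n₀ - 5) * (n₀ - 2) / (2 * (n₀ - 4))) ≤ E := by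
    intro n₀ h6 hn₀
    have f : (n₀ - 5) * (n₀ - 2) / (2 * (n₀ - 4)) ≤ (n - 5) * (n - 2) / (2 * (n - 4)) := by
      rw [div_le_div_iff₀ (by linarith) (by linarith)]
      have f1 : 0 ≤ (n₀ - 4) * ((n : ℝ) - 4) := mul_nonneg (by linarith) (by linarith)
      have : 0 ≤ (n - n₀) * ((n₀ - 4) * (n - 4) + 2) := mul_nonneg (by linarith) (by linarith)
      linarith
    refine (mul_le_mul_of_nonneg_left f h2.le).trans ?_
    rw [← mul_div_assoc, div_le_iff₀ (by linarith)]
    linarith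
  have h10R : (10 : ℝ) ≤ n := by exact_mod_cast h10
  have hpow : ∀ {x : ℝ} (j : ℕ), 0 ≤ x → x ≤ ((n : ℝ) - 2) / 2 →
      x ^ j * (((n : ℝ) - 2) / 2) ≤ (((n : ℝ) - 2) / 2) ^ (j + 1) := by
    intro x j hx hxn
    rw [pow_succ]
    exact mul_le_mul_of_nonneg_right (pow_le_pow_left₀ hx hxn j) (by linarith)
  rcases Nat.lt_or_ge n 12 with h12 | h12
  · have hz : z n = 8 := by unfold z; split_ifs <;> omega
    have hp := hpow (x := 4) 5 (by norm_num) (by linarith)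
    exact h.hasThuePair_medium (j := 6) (C := 5.5) (B := 1) (by omega) (by omega) hE hE0
      (hC (n₀ := 10) (by norm_num) h10R (by norm_num) (hlow' (by norm_num) h10R) (by norm_num)) hB
      (by norm_num at hp ⊢; linarith) (by linarith)
  have h12R : (12 : ℝ) ≤ n := by exact_mod_cast h12
  rcases Nat.lt_or_ge n 17 with h17 | h17
  · have hz : z n = 7 := by unfold z; split_ifs <;> omega
    have hp := hpow (x := 5) 4 (by norm_num) (by linarith)
    exact h.hasThuePair_medium (j := 5) (C := 4) (B := 1) (by omega) (by omega) hE hE0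
      (hC (n₀ := 12) (by norm_num) h12R (by norm_num) (hlow' (by norm_num) h12R) (by norm_num)) hB
      (by norm_num at hp ⊢; linarith) (by linarith)
  have h17R : (17 : ℝ) ≤ n := by exact_mod_cast h17
  rcases Nat.lt_or_ge n 39 with h39 | h39
  · have hz : z n = 6 := by unfold z; split_ifs <;> omega
    have hp := hpow (x := 7.5) 3 (by norm_num) (by linarith)
    exact h.hasThuePair_medium (j := 4) (C := 3.1) (B := 1) (by omega) (by omega) hE hE0
      (hC (n₀ := 17) (by norm_num) h17R (by norm_num) (hlow' (by norm_num) h17R) (by norm_num)) hB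
      (by norm_num at hp ⊢; linarith) (by linarith)
  have h39R : (39 : ℝ) ≤ n := by exact_mod_cast h39
  rcases Nat.lt_or_ge n 219 with h219 | h219
  · have hz : z n = 5 := by unfold z; split_ifs <;> omega
    have hp := hpow (x := 18.5) 2 (by norm_num) (by linarith)
    exact h.hasThuePair_medium (j := 3) (C := 3.1) (B := 1) (by omega) (by omega) hE hE0
      (hC (n₀ := 17) (by norm_num) h17R (by norm_num) (hlow' (by norm_num) h17R) (by norm_num)) hB
      (by norm_num at hp ⊢; linarith) (by linarith)
  have h219R : (219 : ℝ) ≤ n := by exact_mod_cast h219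
  have hz : z n = 4 := by unfold z; split_ifs <;> omega
  have hp := hpow (x := 108.5) 1 (by norm_num) (by linarith)
  exact h.hasThuePair_large (j := 2) (C := 2.1) (B := 1) (by omega) (by omega) hE hE0
    (hC (n₀ := 219) (by norm_num) h219R (by norm_num) (hlow' (by norm_num) h219R) (by norm_num)) hB
    (by norm_num at hp ⊢; linarith) (by linarith)

end LogChain

theorem abs_root_le_two_mul {a b c H : ℤ} {n k : ℕ} (hkn : k < n) (ha0 : a ≠ 0)
    (ha : |a| ≤ H) (hb : |b| ≤ H) (hc : |c| ≤ H) {α : ℝ} (hα : a * α ^ n + b * α ^ k + c = 0) :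
    |α| ≤ 2 * H := by
  have hH : (1 : ℝ) ≤ H := by exact_mod_cast (Int.one_le_abs ha0).trans ha
  rcases le_total |α| 1 with h | h
  · linarith
  have ha1 : (1 : ℝ) ≤ |(a : ℝ)| := by exact_mod_cast Int.one_le_abs ha0
  have hbR : |(b : ℝ)| ≤ H := by exact_mod_cast hb
  have hcR : |(c : ℝ)| ≤ H := by exact_mod_cast hc
  obtain ⟨m, rfl⟩ : ∃ m, n = m + 1 := ⟨n - 1, by omega⟩
  have h1 : |α| ^ (m + 1) ≤ |(a : ℝ) * α ^ (m + 1)| := by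
    rw [abs_mul, abs_pow]; exact le_mul_of_one_le_left (by positivity) ha1
  have h2 : |(b : ℝ) * α ^ k| ≤ H * |α| ^ m := by
    rw [abs_mul, abs_pow]
    exact mul_le_mul hbR (pow_le_pow_right₀ h (by omega)) (by positivity) (by linarith)
  have h3 : |(c : ℝ)| ≤ H * |α| ^ m :=
    hcR.trans (le_mul_of_one_le_right (by linarith) (one_le_pow₀ h))
  have h4 : |(a : ℝ) * α ^ (m + 1)| ≤ |(b : ℝ) * α ^ k| + |(c : ℝ)| := by
    rw [show (a : ℝ) * α ^ (m + 1) = -(b * α ^ k + c) by linarith, abs_neg]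
    exact abs_add_le _ _
  have h5 : |α| * |α| ^ m ≤ (2 * H) * |α| ^ m := by rw [← pow_succ']; linarith
  exact le_of_mul_le_mul_right h5 (by positivity)

theorem pow_div_pow_eq_exp {x q : ℝ} (hx : 0 < x) (hq : 0 < q) (n : ℕ) :
    x ^ (n + 1) / q ^ n = Real.exp ((n + 1) * Real.log x - n * Real.log q) := by
  rw [Real.exp_sub]
  congr 1
  · rw [← Nat.cast_succ, Real.exp_nat_mul, Real.exp_log hx]
  · rw [Real.exp_nat_mul, Real.exp_log hq]

/-- Distinct good approximations to the same number repel each other. -/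
theorem log_gap_of_approx {α κ : ℝ} {n : ℕ} {p₁ q₁ p₂ q₂ : ℤ} (hq₁ : 0 < q₁) (hq₂ : 0 < q₂)
    (hne : p₁ * q₂ ≠ p₂ * q₁)
    (h1 : |α - p₁ / q₁| ≤ Real.exp (κ - n * Real.log q₁))
    (h2 : |α - p₂ / q₂| ≤ Real.exp (κ - n * Real.log q₂)) (hle : Real.log q₁ ≤ Real.log q₂) :
    (n - 1) * Real.log q₁ - κ - Real.log 2 ≤ Real.log q₂ := by
  have hq₁R : (0 : ℝ) < q₁ := by exact_mod_cast hq₁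
  have hq₂R : (0 : ℝ) < q₂ := by exact_mod_cast hq₂
  have e1 : (1 : ℝ) ≤ |(p₁ * q₂ - p₂ * q₁ : ℝ)| := by
    exact_mod_cast Int.one_le_abs (sub_ne_zero.2 hne)
  have e2 : 1 / (q₁ * q₂ : ℝ) ≤ |(p₁ / q₁ - p₂ / q₂ : ℝ)| := by
    rw [div_sub_div _ _ hq₁R.ne' hq₂R.ne', abs_div, abs_of_pos (mul_pos hq₁R hq₂R)]
    refine div_le_div_of_nonneg_right ?_ (by positivity)
    rwa [mul_comm (q₁ : ℝ) (p₂ : ℝ)]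
  have e3 : |(p₁ / q₁ - p₂ / q₂ : ℝ)| ≤ |α - p₁ / q₁| + |α - p₂ / q₂| := by
    rw [abs_sub_comm α (p₁ / q₁ : ℝ)]
    exact abs_sub_le _ _ _
  have e4 : Real.exp (κ - n * Real.log q₂) ≤ Real.exp (κ - n * Real.log q₁) := by
    rw [Real.exp_le_exp]
    have := mul_le_mul_of_nonneg_left hle (Nat.cast_nonneg n : (0 : ℝ) ≤ n)
    linarith
  have e5 : 1 / (q₁ * q₂ : ℝ) ≤ 2 * Real.exp (κ - n * Real.log q₁) := by linarith
  have e6 := Real.log_le_log (by positivity) e5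
  rw [Real.log_mul (by norm_num) (Real.exp_ne_zero _), Real.log_exp, one_div, Real.log_inv,
    Real.log_mul hq₁R.ne' hq₂R.ne'] at e6
  linarith

set_option maxHeartbeats 1000000 in
/-- A branch of the curve `|F| = 1` does not carry more than `z n` solutions. -/
theorem no_long_chain {a b c H : ℤ} {n k : ℕ} (hk : 0 < k) (hkn : k < n) (hn : 6 ≤ n)
    (ha0 : a ≠ 0) (ha : |a| ≤ H) (hb : |b| ≤ H) (hc : |c| ≤ H)
    (hirr : Irreducible (C (a : ℚ) * X ^ n + C (b : ℚ) * X ^ k + C (c : ℚ)))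
    {P Q M : ℕ → ℤ} (hQ : ∀ i ≤ z n, 0 < Q i)
    (hcop : ∀ i ≤ z n, IsCoprime (P i) (Q i)) (hM : ∀ i ≤ z n, 2 ≤ M i)
    (hgap : ∀ i < z n, M i ^ (n - 2) ≤ 2 * M (i + 1) ^ 2)
    (hH : H ≤ 5 * M 0 ^ 2 * M 1 ^ 2) (hQM : ∀ i ≤ z n, Q i ≤ M i)
    (hMQ : ∀ i ≤ z n, M i ≤ 4 * H * Q i)
    (hne : ∀ i < z n, P i * Q (i + 1) ≠ P (i + 1) * Q i)
    (happ : (∃ i ≤ z n, (4 * n ^ 2 * H) ^ 2 ≤ Q i) →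
      ∃ α : ℝ, a * α ^ n + b * α ^ k + c = 0 ∧ ∀ i ≤ z n, (4 * n ^ 2 * H) ^ 2 ≤ Q i →
        |α - P i / Q i| ≤ (4 * n ^ 2 * H) ^ (n + 1) / (Q i : ℝ) ^ n) : False := by
  have hZ : 4 ≤ z n := by unfold z; split_ifs <;> norm_num
  have hH1 : 1 ≤ H := (Int.one_le_abs ha0).trans ha
  have hHR : (1 : ℝ) ≤ H := by exact_mod_cast hH1
  have hnR : (6 : ℝ) ≤ n := by exact_mod_cast hn
  have hQR : ∀ i ≤ z n, (0 : ℝ) < Q i := fun i hi => by exact_mod_cast hQ i hi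
  have hMR : ∀ i ≤ z n, (2 : ℝ) ≤ M i := fun i hi => by exact_mod_cast hM i hi
  set K₀ : ℝ := 4 * n ^ 2 * H with hK₀
  have hK₀1 : 1 ≤ K₀ := by rw [hK₀]; nlinarith
  have hKQ : ∀ i ≤ z n, 2 * Real.log K₀ ≤ Real.log (Q i) → (4 * n ^ 2 * H) ^ 2 ≤ Q i := by
    intro i hi h
    have : Real.log (K₀ ^ 2) ≤ Real.log (Q i) := by rw [Real.log_pow]; exact_mod_cast h
    rw [Real.log_le_log_iff (by positivity) (hQR i hi)] at this
    rw [hK₀] at this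
    exact_mod_cast this
  have happ' : ∀ {i : ℕ}, i ≤ z n → 2 * Real.log K₀ ≤ Real.log (Q i) →
      ∃ α : ℝ, a * α ^ n + b * α ^ k + c = 0 ∧ ∀ i ≤ z n, 2 * Real.log K₀ ≤ Real.log (Q i) →
        |α - P i / Q i| ≤ Real.exp ((n + 1) * Real.log K₀ - n * Real.log (Q i)) := by
    intro i hi h
    obtain ⟨α, h1, h2⟩ := happ ⟨i, hi, hKQ i hi h⟩
    refine ⟨α, h1, fun j hj hj' => ?_⟩
    rw [← pow_div_pow_eq_exp (by linarith) (hQR j hj)]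
    exact h2 j hj (hKQ j hj hj')
  have hlog8 : Real.log (8 * H) = Real.log 8 + Real.log H := Real.log_mul (by norm_num) (by linarith)
  have h8 : Real.log 8 = 3 * Real.log 2 := by
    rw [show (8 : ℝ) = 2 ^ 3 by norm_num, Real.log_pow]; norm_num
  have h4 : Real.log 4 = 2 * Real.log 2 := by
    rw [show (4 : ℝ) = 2 ^ 2 by norm_num, Real.log_pow]; norm_num
  have h40 : Real.log 40 = Real.log 8 + Real.log 5 := by
    rw [← Real.log_mul (by norm_num) (by norm_num)]; norm_num
  have hl2 : 0 < Real.log 2 := Real.log_pos (by norm_num)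
  have hlH : 0 ≤ Real.log H := Real.log_nonneg hHR
  have hchain : LogChain n (z n) (fun i => Real.log (M i)) (fun i => Real.log (Q i))
      (Real.log (8 * H)) (Real.log K₀) := by
    refine ⟨fun i hi => Real.log_le_log (by norm_num) (hMR i hi), fun i hi => ?_, ?_, fun i hi => ?_,
      fun i hi => ?_, by rw [hlog8]; linarith, ?_, Real.log_nonneg hK₀1, fun i hi h1 h2 h3 => ?_⟩
    · have hi1 := hMR i hi.le
      have hi2 := hMR (i + 1) hi
      have e1 : (M i : ℝ) ^ (n - 2) ≤ 2 * (M (i + 1) : ℝ) ^ 2 := by exact_mod_cast hgap i hi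
      have e2 := Real.log_le_log (by positivity) e1
      rw [Real.log_mul (by norm_num) (by positivity), Real.log_pow, Real.log_pow,
        Nat.cast_sub (by omega)] at e2
      exact_mod_cast e2
    · have h0 := hMR 0 (by omega)
      have h1 := hMR 1 (by omega)
      have e1 : (H : ℝ) ≤ 5 * (M 0 : ℝ) ^ 2 * (M 1 : ℝ) ^ 2 := by exact_mod_cast hH
      have e2 := Real.log_le_log (by linarith) e1
      rw [Real.log_mul (by positivity) (by positivity), Real.log_mul (by norm_num) (by positivity),
        Real.log_pow, Real.log_pow] at e2
      push_cast at e2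
      rw [hlog8, h40]; linarith
    · have hi1 := hMR i hi
      have hi2 := hQR i hi
      have e1 : (M i : ℝ) ≤ 8 * H * Q i := by
        have : (M i : ℝ) ≤ 4 * H * Q i := by exact_mod_cast hMQ i hi
        nlinarith [mul_pos (by linarith : (0 : ℝ) < H) hi2]
      rw [← Real.log_mul (by positivity) (by positivity)]
      exact Real.log_le_log (by linarith) e1
    · exact Real.log_le_log (hQR i hi) (by exact_mod_cast hQM i hi)
    · rw [hK₀, Real.log_mul (by positivity) (by positivity),
        Real.log_mul (by positivity) (by positivity), Real.log_pow, hlog8, h4]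
      push_cast; linarith
    · obtain ⟨α, -, hα⟩ := happ' hi.le h1
      exact log_gap_of_approx (hQ i hi.le) (hQ (i + 1) hi) (hne i hi) (hα i hi.le h1)
        (hα (i + 1) hi h2) h3
  obtain ⟨i, j, hij, hj, h1, h2, h3, w, ι, p1, p2, p3, p4, p5⟩ := hchain.hasThuePair hn
  obtain ⟨α, hα, hα'⟩ := happ' hj h2
  refine thue_contradiction_log (w := w) (ι := ι) (m := 2 * n * w) hk hkn ha0 ha hb hc hirr hα
    (abs_root_le_two_mul hkn ha0 ha hb hc hα) rfl p1 p2 (hQ i (by omega)) (hQ j hj)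
    (hcop i (by omega)) (hα' i (by omega) h1) (hα' j hj h2) h3 ?_ ?_ ?_
  · push_cast; exact p3
  · push_cast; exact p4
  · push_cast; exact p5

theorem one_sub_pow_le {x : ℝ} (hx : 0 ≤ x) (k : ℕ) : 1 - x ^ k ≤ k * (1 - x) := by
  have := one_add_mul_le_pow (a := x - 1) (by linarith) k
  rw [add_sub_cancel] at this
  linarith

theorem one_sub_le_one_sub_pow {x : ℝ} (hx : 0 ≤ x) (hx1 : x ≤ 1) {k : ℕ} (hk : 0 < k) :
    1 - x ≤ 1 - x ^ k := by
  linarith [pow_le_of_le_one hx hx1 hk.ne']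

theorem sub_one_le_pow_sub_one {x : ℝ} (hx : 1 ≤ x) {k : ℕ} (hk : 0 < k) :
    x - 1 ≤ x ^ k - 1 := by
  linarith [le_self_pow₀ hx hk.ne']

theorem mul_sub_one_le_pow_sub_one {x : ℝ} (hx : 0 ≤ x) (k : ℕ) : k * (x - 1) ≤ x ^ k - 1 := by
  linarith [one_sub_pow_le hx k]

/-- Elimination of the middle coefficient between two solutions. -/
theorem abs_elimination_le {a b c τ : ℝ} {k j : ℕ} {p₁ q₁ p₂ q₂ : ℝ}
    (hp₁ : 0 < p₁) (hq₁ : 0 < q₁) (hp₂ : 0 < p₂) (hq₂ : 0 < q₂)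
    (h1 : |a * p₁ ^ (k + j) + b * (p₁ ^ k * q₁ ^ j) + c * q₁ ^ (k + j)| ≤ 1)
    (h2 : |a * p₂ ^ (k + j) + b * (p₂ ^ k * q₂ ^ j) + c * q₂ ^ (k + j)| ≤ 1)
    (hD : p₁ ^ k * q₁ ^ j ≤ p₂ ^ k * q₂ ^ j) (hτ : τ = p₂ * q₁ / (p₁ * q₂)) :
    |a * p₁ ^ (k + j) * (τ ^ j - 1) - c * q₁ ^ (k + j) * (1 - τ⁻¹ ^ k)| ≤ 2 := by
  have hτ0 : 0 < τ := by rw [hτ]; positivity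
  have e1 : p₁ * q₂ * τ = p₂ * q₁ := by rw [hτ]; field_simp
  have e2 : p₂ * q₁ * τ⁻¹ = p₁ * q₂ := by rw [← e1]; field_simp
  have e3 : p₁ ^ j * q₂ ^ j * τ ^ j = p₂ ^ j * q₁ ^ j := by rw [← mul_pow, ← mul_pow, e1, mul_pow]
  have e4 : p₂ ^ k * q₁ ^ k * τ⁻¹ ^ k = p₁ ^ k * q₂ ^ k := by
    rw [← mul_pow, ← mul_pow, e2, mul_pow]
  set ε₁ := a * p₁ ^ (k + j) + b * (p₁ ^ k * q₁ ^ j) + c * q₁ ^ (k + j) with hε₁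
  set ε₂ := a * p₂ ^ (k + j) + b * (p₂ ^ k * q₂ ^ j) + c * q₂ ^ (k + j) with hε₂
  have hD2 : 0 < p₂ ^ k * q₂ ^ j := by positivity
  have hD1 : 0 < p₁ ^ k * q₁ ^ j := by positivity
  have key : (p₂ ^ k * q₂ ^ j) *
      (a * p₁ ^ (k + j) * (τ ^ j - 1) - c * q₁ ^ (k + j) * (1 - τ⁻¹ ^ k))
      = (p₁ ^ k * q₁ ^ j) * ε₂ - (p₂ ^ k * q₂ ^ j) * ε₁ := by
    rw [hε₁, hε₂]
    simp only [pow_add]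
    linear_combination (a * p₁ ^ k * p₂ ^ k) * e3 + (c * q₁ ^ j * q₂ ^ j) * e4
  have : (p₂ ^ k * q₂ ^ j) *
      |a * p₁ ^ (k + j) * (τ ^ j - 1) - c * q₁ ^ (k + j) * (1 - τ⁻¹ ^ k)|
      ≤ (p₂ ^ k * q₂ ^ j) * 2 := by
    rw [← abs_of_pos hD2, ← abs_mul, key, abs_of_pos hD2]
    calc _ ≤ |p₁ ^ k * q₁ ^ j * ε₂| + |p₂ ^ k * q₂ ^ j * ε₁| := abs_sub _ _
      _ = p₁ ^ k * q₁ ^ j * |ε₂| + p₂ ^ k * q₂ ^ j * |ε₁| := by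
        rw [abs_mul _ ε₂, abs_mul _ ε₁, abs_of_pos hD1, abs_of_pos hD2]
      _ ≤ p₁ ^ k * q₁ ^ j * 1 + p₂ ^ k * q₂ ^ j * 1 := by gcongr
      _ ≤ _ := by linarith
  exact le_of_mul_le_mul_left this hD2

theorem gap_one_sign_change {u v A B τ : ℝ} {k j : ℕ} (hk : 0 < k) (hj : 0 < j) (hu : 0 < u)
    (hv : 0 < v) (hA : 1 ≤ A) (hB : 1 ≤ B) (hAB : 1 ≤ |A - B|) (hτ : τ = B / A)
    (h : |u * (τ ^ j - 1) - -v * (1 - τ⁻¹ ^ k)| ≤ 2) : u ≤ 2 * A ∧ v ≤ 2 * B := by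
  have hA0 : 0 < A := by linarith
  have hB0 : 0 < B := by linarith
  have hτ0 : 0 < τ := by rw [hτ]; positivity
  have eA : A * τ = B := by rw [hτ]; field_simp
  have eB : B * τ⁻¹ = A := by rw [← eA]; field_simp
  obtain ⟨h1, h2⟩ := abs_le.1 h
  rcases le_total A B with hle | hle
  · rw [abs_of_nonpos (by linarith)] at hAB
    have hτ1 : 1 ≤ τ := by rw [hτ, one_le_div hA0]; exact hle
    have hσ1 : τ⁻¹ ≤ 1 := inv_le_one_of_one_le₀ hτ1
    have f1 := mul_le_mul_of_nonneg_left (sub_one_le_pow_sub_one hτ1 hj) hu.le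
    have f2 := mul_le_mul_of_nonneg_left
      (one_sub_le_one_sub_pow (inv_pos.2 hτ0).le hσ1 hk) hv.le
    have f3 : 0 ≤ u * (τ - 1) := mul_nonneg hu.le (by linarith)
    have f4 : 0 ≤ v * (1 - τ⁻¹) := mul_nonneg hv.le (by linarith)
    have f5 : u * (τ - 1) * A ≤ 2 * A := by
      apply mul_le_mul_of_nonneg_right <;> linarith
    have f6 : v * (1 - τ⁻¹) * B ≤ 2 * B := by
      apply mul_le_mul_of_nonneg_right <;> linarith
    constructor
    · calc u ≤ u * (B - A) := le_mul_of_one_le_right hu.le (by linarith)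
        _ = u * (τ - 1) * A := by rw [← eA]; ring
        _ ≤ _ := f5
    · calc v ≤ v * (B - A) := le_mul_of_one_le_right hv.le (by linarith)
        _ = v * (1 - τ⁻¹) * B := by rw [← eB]; field_simp
        _ ≤ _ := f6
  · rw [abs_of_nonneg (by linarith)] at hAB
    have hτ1 : τ ≤ 1 := by rw [hτ, div_le_one hA0]; exact hle
    have hσ1 : 1 ≤ τ⁻¹ := (one_le_inv₀ hτ0).2 hτ1
    have f1 := mul_le_mul_of_nonneg_left (one_sub_le_one_sub_pow hτ0.le hτ1 hj) hu.le
    have f2 := mul_le_mul_of_nonneg_left (sub_one_le_pow_sub_one hσ1 hk) hv.le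
    have f3 : 0 ≤ u * (1 - τ) := mul_nonneg hu.le (by linarith)
    have f4 : 0 ≤ v * (τ⁻¹ - 1) := mul_nonneg hv.le (by linarith)
    have f5 : u * (1 - τ) * A ≤ 2 * A := by
      apply mul_le_mul_of_nonneg_right <;> linarith
    have f6 : v * (τ⁻¹ - 1) * B ≤ 2 * B := by
      apply mul_le_mul_of_nonneg_right <;> linarith
    constructor
    · calc u ≤ u * (A - B) := le_mul_of_one_le_right hu.le (by linarith)
        _ = u * (1 - τ) * A := by rw [← eA]; ring
        _ ≤ _ := f5
    · calc v ≤ v * (A - B) := le_mul_of_one_le_right hv.le (by linarith)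
        _ = v * (τ⁻¹ - 1) * B := by rw [← eB]; field_simp
        _ ≤ _ := f6

theorem gap_two_sign_changes {u v A B τ : ℝ} {k j : ℕ} (hk : 0 < k) (hj : 0 < j) (hu : 0 < u)
    (hv : 0 < v) (hA : 1 ≤ A) (hB : 1 ≤ B) (hAB : 1 ≤ |A - B|) (hτ : τ = B / A)
    (hb1 : k * v ≤ j * u) (hb2 : k * v ≤ j * u * τ ^ (k + j))
    (h : |u * (τ ^ j - 1) - v * (1 - τ⁻¹ ^ k)| ≤ 2) :
    u ≤ 2 * (A * max A B) ∧ v ≤ 2 * (B * max A B) := by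
  have hA0 : 0 < A := by linarith
  have hB0 : 0 < B := by linarith
  have hτ0 : 0 < τ := by rw [hτ]; positivity
  have hkR : (1 : ℝ) ≤ k := by exact_mod_cast hk
  have hjR : (1 : ℝ) ≤ j := by exact_mod_cast hj
  have eA : A * τ = B := by rw [hτ]; field_simp
  have eB : B * τ⁻¹ = A := by rw [← eA]; field_simp
  have hσ : τ * τ⁻¹ = 1 := mul_inv_cancel₀ hτ0.ne'
  have hσ0 : 0 < τ⁻¹ := inv_pos.2 hτ0
  obtain ⟨h1, h2⟩ := abs_le.1 h
  have hAB2 : 1 ≤ (A - B) ^ 2 := by rw [← sq_abs]; exact one_le_pow₀ hAB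
  rcases le_total A B with hle | hle
  · have hτ1 : 1 ≤ τ := by rw [hτ, one_le_div hA0]; exact hle
    have hσ1 : τ⁻¹ ≤ 1 := inv_le_one_of_one_le₀ hτ1
    rw [max_eq_right hle]
    have g1 := mul_sub_one_le_pow_sub_one hτ0.le j
    have g2 := one_sub_pow_le hσ0.le k
    have g3 : 0 ≤ τ - 1 - (1 - τ⁻¹) := by
      have : (τ - 1) * (1 - τ⁻¹) = τ - 1 - (1 - τ⁻¹) := by linear_combination -hσ
      rw [← this]; exact mul_nonneg (by linarith) (by linarith)
    have g4 : (τ - 1 - (1 - τ⁻¹)) * (A * B) = (A - B) ^ 2 := by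
      linear_combination B * eA + A * eB
    -- the common lower bound `w * (τ - 2 + τ⁻¹) ≤ 2` for `w = j u` and `w = k v`
    have key : ∀ w : ℝ, 0 < w → w ≤ j * u → k * v ≤ w → w * (τ - 1 - (1 - τ⁻¹)) ≤ 2 := by
      intro w hw hwu hwv
      have i1 : w * (τ - 1) ≤ u * (τ ^ j - 1) := by
        calc _ ≤ (j * u) * (τ - 1) := mul_le_mul_of_nonneg_right hwu (by linarith)
          _ = u * (j * (τ - 1)) := by ring
          _ ≤ _ := mul_le_mul_of_nonneg_left g1 hu.le
      have i2 : v * (1 - τ⁻¹ ^ k) ≤ w * (1 - τ⁻¹) := by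
        calc _ ≤ v * (k * (1 - τ⁻¹)) := mul_le_mul_of_nonneg_left g2 hv.le
          _ = (k * v) * (1 - τ⁻¹) := by ring
          _ ≤ _ := mul_le_mul_of_nonneg_right hwv (by linarith)
      linarith
    have fin : ∀ w : ℝ, 0 < w → w * (τ - 1 - (1 - τ⁻¹)) ≤ 2 → w ≤ 2 * (A * B) := by
      intro w hw h
      calc w ≤ w * (A - B) ^ 2 := le_mul_of_one_le_right hw.le hAB2
        _ = w * (τ - 1 - (1 - τ⁻¹)) * (A * B) := by rw [← g4]; ring
        _ ≤ _ := mul_le_mul_of_nonneg_right h (by positivity)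
    have k1 := fin _ (by positivity) (key (j * u) (by positivity) le_rfl hb1)
    have k2 := fin _ (by positivity) (key (k * v) (by positivity) hb1 le_rfl)
    have k3 : u ≤ j * u := le_mul_of_one_le_left hu.le hjR
    have k4 : v ≤ k * v := le_mul_of_one_le_left hv.le hkR
    have k5 : A * B ≤ B * B := mul_le_mul_of_nonneg_right hle hB0.le
    constructor <;> linarith
  · have hτ1 : τ ≤ 1 := by rw [hτ, div_le_one hA0]; exact hle
    have hσ1 : 1 ≤ τ⁻¹ := (one_le_inv₀ hτ0).2 hτ1
    rw [max_eq_left hle]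
    have hτk : τ ^ k * τ⁻¹ ^ k = 1 := by rw [← mul_pow, hσ, one_pow]
    constructor
    · have i1 : v * (τ⁻¹ ^ k - 1) ≤ j * u * τ ^ j * (1 - τ) := by
        have i2 : k * v * (τ⁻¹ ^ k - 1) ≤ k * (j * u * τ ^ j * (1 - τ)) := by
          calc _ ≤ j * u * τ ^ (k + j) * (τ⁻¹ ^ k - 1) :=
                mul_le_mul_of_nonneg_right hb2 (by linarith [one_le_pow₀ hσ1 (n := k)])
            _ = j * u * τ ^ j * (1 - τ ^ k) := by
                rw [pow_add]; linear_combination j * u * τ ^ j * hτk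
            _ ≤ j * u * τ ^ j * (k * (1 - τ)) :=
                mul_le_mul_of_nonneg_left (one_sub_pow_le hτ0.le k) (by positivity)
            _ = _ := by ring
        refine le_of_mul_le_mul_left ?_ (by linarith : (0 : ℝ) < k)
        linarith
      have i3 : (1 - τ) ^ 2 ≤ 1 - τ ^ j - j * τ ^ j * (1 - τ) := by
        have : (1 - τ) * (1 - τ) ≤ (1 - τ) * ∑ i ∈ Finset.range j, (τ ^ i - τ ^ j) := by
          refine mul_le_mul_of_nonneg_left ?_ (by linarith)
          refine (one_sub_le_one_sub_pow hτ0.le hτ1 hj).trans ?_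
          have := Finset.single_le_sum (f := fun i => τ ^ i - τ ^ j) (s := Finset.range j)
            (fun i hi => sub_nonneg.2 (pow_le_pow_of_le_one hτ0.le hτ1
              (Finset.mem_range.1 hi).le)) (Finset.mem_range.2 hj)
          simpa using this
        rw [Finset.sum_sub_distrib, mul_sub (1 - τ) (∑ i ∈ Finset.range j, τ ^ i),
          mul_neg_geom_sum] at this
        simp only [Finset.sum_const, Finset.card_range, nsmul_eq_mul] at this
        linarith
      have i4 : u * (1 - τ) ^ 2 ≤ 2 := by
        have := mul_le_mul_of_nonneg_left i3 hu.le
        linarith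
      calc u ≤ u * (A - B) ^ 2 := le_mul_of_one_le_right hu.le hAB2
        _ = u * (1 - τ) ^ 2 * A ^ 2 := by rw [← eA]; ring
        _ ≤ 2 * A ^ 2 := mul_le_mul_of_nonneg_right i4 (by positivity)
        _ = _ := by ring
    · have i1 : k * v * τ⁻¹ ^ k * (τ⁻¹ - 1) ≤ u * (1 - τ ^ j) := by
        have hτj : τ ^ j * τ⁻¹ ^ j = 1 := by rw [← mul_pow, hσ, one_pow]
        have i2 : k * v * τ⁻¹ ^ k * (j * (τ⁻¹ - 1)) ≤ j * (u * (1 - τ ^ j)) := by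
          calc _ ≤ k * v * τ⁻¹ ^ k * (τ⁻¹ ^ j - 1) :=
                mul_le_mul_of_nonneg_left (mul_sub_one_le_pow_sub_one hσ0.le j) (by positivity)
            _ = (k * v) * (τ⁻¹ ^ k * (τ⁻¹ ^ j - 1)) := by ring
            _ ≤ (j * u * τ ^ (k + j)) * (τ⁻¹ ^ k * (τ⁻¹ ^ j - 1)) :=
                mul_le_mul_of_nonneg_right hb2
                  (mul_nonneg (by positivity) (by linarith [one_le_pow₀ hσ1 (n := j)]))
            _ = _ := by
                rw [pow_add]
                linear_combination j * u * τ ^ j * (τ⁻¹ ^ j - 1) * hτk + j * u * hτj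
        refine le_of_mul_le_mul_left ?_ (by linarith : (0 : ℝ) < j)
        linarith
      have i3 : τ⁻¹ ^ k - 1 ≤ k * τ⁻¹ ^ k * (1 - τ) := by
        have := mul_le_mul_of_nonneg_left (one_sub_pow_le hτ0.le k)
          (by positivity : 0 ≤ τ⁻¹ ^ k)
        linarith
      have i4 : v * (τ⁻¹ - 1) ^ 2 ≤ 2 := by
        have j1 := mul_le_mul_of_nonneg_left i3 hv.le
        have j2 : v * (τ⁻¹ - 1) ^ 2 ≤ k * v * τ⁻¹ ^ k * ((τ⁻¹ - 1) - (1 - τ)) := by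
          have j3 : (τ⁻¹ - 1) - (1 - τ) = τ * (τ⁻¹ - 1) ^ 2 := by
            linear_combination (-τ⁻¹ + 2) * hσ
          obtain ⟨m, rfl⟩ : ∃ m, k = m + 1 := ⟨k - 1, by omega⟩
          have j4 : τ⁻¹ ^ (m + 1) * τ = τ⁻¹ ^ m := by
            rw [pow_succ]; linear_combination τ⁻¹ ^ m * hσ
          rw [j3]
          calc v * (τ⁻¹ - 1) ^ 2 ≤ (((m + 1 : ℕ) : ℝ) * τ⁻¹ ^ m) * (v * (τ⁻¹ - 1) ^ 2) :=
                le_mul_of_one_le_left (by positivity)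
                  (one_le_mul_of_one_le_of_one_le hkR (one_le_pow₀ hσ1))
            _ = _ := by rw [← j4]; ring
        linarith
      calc v ≤ v * (A - B) ^ 2 := le_mul_of_one_le_right hv.le hAB2
        _ = v * (τ⁻¹ - 1) ^ 2 * B ^ 2 := by
            have : A - B = (τ⁻¹ - 1) * B := by linear_combination -eB
            rw [this]; ring
        _ ≤ 2 * B ^ 2 := mul_le_mul_of_nonneg_right i4 (by positivity)
        _ ≤ _ := by nlinarith

theorem exists_sorted_seq {β : Type*} {S : Set β} (D : β → ℤ) {Z : ℕ} (h : (Z : ℕ∞) < S.encard) :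
    ∃ s : ℕ → β, (∀ i ≤ Z, s i ∈ S) ∧ (∀ i j, i < j → j ≤ Z → s i ≠ s j) ∧
      ∀ i j, i ≤ j → j ≤ Z → D (s i) ≤ D (s j) := by
  obtain ⟨t, htS, ht⟩ := Set.exists_subset_encard_eq ((ENat.add_one_le_iff (ENat.natCast_ne_top Z)).2 h)
  have hfin : t.Finite := Set.finite_of_encard_eq_coe (k := Z + 1) (by rw [ht]; norm_cast)
  have hcard : hfin.toFinset.card = Z + 1 := by
    have := hfin.encard_eq_coe_toFinset_card
    rw [ht] at this
    exact_mod_cast this.symm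
  let f := (hfin.toFinset.equivFinOfCardEq hcard).symm
  let σ := Tuple.sort (fun i => D (f i))
  have hmono : Monotone (fun i => D (f (σ i))) := Tuple.monotone_sort (fun i => D (f i))
  refine ⟨fun i => f (σ (Fin.ofNat (Z + 1) i)), fun i _ => htS ?_, fun i j hij hj he => ?_,
    fun i j hij hj => hmono ?_⟩
  · exact hfin.mem_toFinset.1 (f _).2
  · have := σ.injective (f.injective (Subtype.ext he))
    rw [Fin.ext_iff] at this
    simp only [Fin.ofNat] at this
    rw [Nat.mod_eq_of_lt (by omega), Nat.mod_eq_of_lt (by omega)] at this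
    omega
  · rw [Fin.le_def]
    simp only [Fin.ofNat]
    rwa [Nat.mod_eq_of_lt (by omega), Nat.mod_eq_of_lt (by omega)]

/-- The trinomial form `a x ^ (k + j) + b x ^ k y ^ j + c y ^ (k + j)`. -/
def trinomialForm (a b c : ℤ) (k j : ℕ) (s : ℤ × ℤ) : ℤ :=
  a * s.1 ^ (k + j) + b * (s.1 ^ k * s.2 ^ j) + c * s.2 ^ (k + j)

theorem trinomialForm_swap (a b c : ℤ) (k j : ℕ) (s : ℤ × ℤ) :
    trinomialForm c b a j k s.swap = trinomialForm a b c k j s := by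
  simp only [trinomialForm, Prod.fst_swap, Prod.snd_swap, add_comm j k]
  ring

theorem isCoprime_of_trinomialForm {a b c : ℤ} {k j : ℕ} (hk : 0 < k) {s : ℤ × ℤ}
    (h : |trinomialForm a b c k j s| = 1) : IsCoprime s.1 s.2 := by
  rw [Int.isCoprime_iff_gcd_eq_one]
  have h1 : (Int.gcd s.1 s.2 : ℤ) ∣ trinomialForm a b c k j s := by
    have hp := Int.gcd_dvd_left s.1 s.2
    have hq := Int.gcd_dvd_right s.1 s.2
    refine dvd_add (dvd_add ?_ ?_) ?_
    · exact (hp.trans (dvd_pow_self _ (by omega))).mul_left _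
    · exact ((hp.trans (dvd_pow_self _ hk.ne')).mul_right _).mul_left _
    · exact (hq.trans (dvd_pow_self _ (by omega))).mul_left _
  rw [← dvd_abs, h] at h1
  exact_mod_cast Int.eq_one_of_dvd_one (by positivity) h1

theorem eq_of_mul_eq_mul_of_isCoprime {s t : ℤ × ℤ} (hs1 : 0 < s.1) (ht1 : 0 < t.1)
    (hs : IsCoprime s.1 s.2) (ht : IsCoprime t.1 t.2) (h : s.1 * t.2 = t.1 * s.2) : s = t := by
  have h1 : s.1 ∣ t.1 := hs.dvd_of_dvd_mul_right (Dvd.intro _ h)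
  have h2 : t.1 ∣ s.1 := ht.dvd_of_dvd_mul_right (Dvd.intro _ h.symm)
  have h3 : s.1 = t.1 := Int.dvd_antisymm hs1.le ht1.le h1 h2
  refine Prod.ext h3 ?_
  rw [h3] at h
  exact (mul_left_cancel₀ ht1.ne' h).symm

theorem fst_le_of_trinomialForm {a b c H : ℤ} {k j : ℕ} (hj : 0 < j) (ha0 : a ≠ 0)
    (ha : |a| ≤ H) (hb : |b| ≤ H) (hc : |c| ≤ H) {s : ℤ × ℤ} (hs1 : 0 < s.1) (hs2 : 0 < s.2)
    (h : |trinomialForm a b c k j s| = 1) : s.1 ≤ 4 * H * s.2 := by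
  obtain ⟨p, q⟩ := s
  simp only [trinomialForm] at *
  have ha1 := Int.one_le_abs ha0
  have hH : 1 ≤ H := ha1.trans ha
  rcases le_total p q with hpq | hpq
  · nlinarith
  obtain ⟨m, rfl⟩ : ∃ m, j = m + 1 := ⟨j - 1, by omega⟩
  have e1 : p ^ k * q ^ (m + 1) ≤ p ^ (k + m) * q := by
    rw [pow_succ, ← mul_assoc, pow_add]
    gcongr
  have e2 : q ^ (k + (m + 1)) ≤ p ^ (k + m) * q := by
    rw [← add_assoc, pow_succ]
    gcongr
  have e3 : 1 ≤ p ^ (k + m) * q :=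
    one_le_mul_of_one_le_of_one_le (one_le_pow₀ hs1) hs2
  have e4 : p ^ (k + (m + 1)) ≤ |a * p ^ (k + (m + 1))| := by
    rw [abs_mul, abs_of_pos (by positivity : 0 < p ^ (k + (m + 1)))]
    exact le_mul_of_one_le_left (by positivity) ha1
  have e5 : |b * (p ^ k * q ^ (m + 1))| ≤ H * (p ^ (k + m) * q) := by
    rw [abs_mul, abs_of_pos (by positivity : 0 < p ^ k * q ^ (m + 1))]
    exact mul_le_mul hb e1 (by positivity) (by linarith)
  have e6 : |c * q ^ (k + (m + 1))| ≤ H * (p ^ (k + m) * q) := by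
    rw [abs_mul, abs_of_pos (by positivity : 0 < q ^ (k + (m + 1)))]
    exact mul_le_mul hc e2 (by positivity) (by linarith)
  have e7 : |a * p ^ (k + (m + 1))| ≤ 1 + |b * (p ^ k * q ^ (m + 1))| + |c * q ^ (k + (m + 1))| := by
    rw [← h]
    have := abs_add_three (a * p ^ (k + (m + 1)) + b * (p ^ k * q ^ (m + 1)) + c * q ^ (k + (m + 1)))
      (-(b * (p ^ k * q ^ (m + 1)))) (-(c * q ^ (k + (m + 1))))
    rw [abs_neg, abs_neg] at this
    refine le_trans (le_of_eq ?_) this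
    congr 1; ring
  have e8 : p ^ (k + m) * q ≤ H * (p ^ (k + m) * q) := le_mul_of_one_le_left (by positivity) hH
  have e9 : p ^ (k + m) * p ≤ p ^ (k + m) * (4 * H * q) := by
    rw [← pow_succ, add_assoc]
    linarith
  exact le_of_mul_le_mul_left e9 (by positivity)

/-- Larger coordinate of a pair. -/
def maxCoord (s : ℤ × ℤ) : ℤ := max s.1 s.2

/-- Pairwise gap principle on a branch `S`. -/
def HasGap (a c : ℤ) (k j : ℕ) (S : Set (ℤ × ℤ)) : Prop :=
  ∀ s ∈ S, ∀ t ∈ S, s ≠ t → s.1 ^ k * s.2 ^ j ≤ t.1 ^ k * t.2 ^ j →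
    |a| * s.1 ^ (k + j) ≤ 2 * (maxCoord s * maxCoord t) ^ 2 ∧
    |c| * s.2 ^ (k + j) ≤ 2 * (maxCoord s * maxCoord t) ^ 2

/-- The points of a branch `S` with large `q` approximate a common real root. -/
def HasApprox (a b c H : ℤ) (k j : ℕ) (S : Set (ℤ × ℤ)) : Prop :=
  (∃ s ∈ S, (4 * (k + j : ℕ) ^ 2 * H) ^ 2 ≤ s.2) →
    ∃ α : ℝ, a * α ^ (k + j) + b * α ^ k + c = 0 ∧ ∀ s ∈ S, (4 * (k + j : ℕ) ^ 2 * H) ^ 2 ≤ s.2 →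
      |α - s.1 / s.2| ≤ (4 * (k + j : ℕ) ^ 2 * H) ^ (k + j + 1) / (s.2 : ℝ) ^ (k + j)

theorem encard_branch_le {a b c H : ℤ} {k j : ℕ} (hk : 0 < k) (hj : 0 < j) (hn : 6 ≤ k + j)
    (ha0 : a ≠ 0) (hc0 : c ≠ 0) (ha : |a| ≤ H) (hb : |b| ≤ H) (hc : |c| ≤ H)
    (hH : H = |a| ∨ H = |b| ∨ H = |c|)
    (hirr : Irreducible (C (a : ℚ) * X ^ (k + j) + C (b : ℚ) * X ^ k + C (c : ℚ)))
    {S : Set (ℤ × ℤ)}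
    (hS : ∀ s ∈ S, 0 < s.1 ∧ 0 < s.2 ∧ s.1 ≠ s.2 ∧ |trinomialForm a b c k j s| = 1)
    (hgap : HasGap a c k j S) (happ : HasApprox a b c H k j S) :
    S.encard ≤ z (k + j) := by
  by_contra hlt
  rw [not_le] at hlt
  have hZ : 4 ≤ z (k + j) := by unfold z; split_ifs <;> norm_num
  obtain ⟨s, hsS, hsne, hsD⟩ := exists_sorted_seq (fun s : ℤ × ℤ => s.1 ^ k * s.2 ^ j) hlt
  have hgap' : ∀ i < z (k + j), |a| * (s i).1 ^ (k + j) ≤ 2 * (maxCoord (s i) * maxCoord (s (i + 1))) ^ 2 ∧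
      |c| * (s i).2 ^ (k + j) ≤ 2 * (maxCoord (s i) * maxCoord (s (i + 1))) ^ 2 := fun i hi =>
    hgap _ (hsS i hi.le) _ (hsS (i + 1) hi) (hsne i (i + 1) (by omega) hi)
      (hsD i (i + 1) (by omega) hi)
  have ha1 := Int.one_le_abs ha0
  have hc1 := Int.one_le_abs hc0
  have hM : ∀ i ≤ z (k + j), 2 ≤ maxCoord (s i) := by
    intro i hi
    obtain ⟨h1, h2, h3, -⟩ := hS _ (hsS i hi)
    rcases lt_or_gt_of_ne h3 with h | h
    · exact le_max_of_le_right (by omega)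
    · exact le_max_of_le_left (by omega)
  refine no_long_chain (P := fun i => (s i).1) (Q := fun i => (s i).2)
    (M := fun i => maxCoord (s i)) hk (by omega) hn ha0 ha hb hc hirr
    (fun i hi => (hS _ (hsS i hi)).2.1)
    (fun i hi => isCoprime_of_trinomialForm hk (hS _ (hsS i hi)).2.2.2) hM ?_ ?_
    (fun i hi => le_max_right _ _) ?_ ?_ ?_
  · intro i hi
    obtain ⟨g1, g2⟩ := hgap' i hi
    obtain ⟨h1, h2, -⟩ := hS _ (hsS i hi.le)
    have e1 : maxCoord (s i) ^ (k + j) ≤ 2 * (maxCoord (s i) * maxCoord (s (i + 1))) ^ 2 := by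
      rcases le_total (s i).1 (s i).2 with h | h
      · rw [show maxCoord (s i) ^ (k + j) = (s i).2 ^ (k + j) by rw [maxCoord, max_eq_right h]]
        exact (le_mul_of_one_le_left (by positivity) hc1).trans g2
      · rw [show maxCoord (s i) ^ (k + j) = (s i).1 ^ (k + j) by rw [maxCoord, max_eq_left h]]
        exact (le_mul_of_one_le_left (by positivity) ha1).trans g1
    have e2 := hM i hi.le
    have e3 : maxCoord (s i) ^ 2 * maxCoord (s i) ^ (k + j - 2) = maxCoord (s i) ^ (k + j) := by
      rw [← pow_add]; congr 1; omega
    refine le_of_mul_le_mul_left (a := maxCoord (s i) ^ 2) ?_ (by positivity)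
    rw [e3]
    linarith
  · obtain ⟨g1, g2⟩ := hgap' 0 (by omega)
    have e0 := hM 0 (by omega)
    have e1 := hM 1 (by omega)
    obtain ⟨h1, h2, -, h4⟩ := hS _ (hsS 0 (by omega))
    have e2 : 1 ≤ (maxCoord (s 0) * maxCoord (s 1)) ^ 2 :=
      one_le_pow₀ (one_le_mul_of_one_le_of_one_le (by omega) (by omega))
    have p1 : 1 ≤ (s 0).1 ^ (k + j) := one_le_pow₀ h1
    have p2 : 1 ≤ (s 0).2 ^ (k + j) := one_le_pow₀ h2
    have goal : H ≤ 5 * (maxCoord (s 0) * maxCoord (s 1)) ^ 2 := by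
      rcases hH with h | h | h
      · have : |a| ≤ |a| * (s 0).1 ^ (k + j) := le_mul_of_one_le_right (by linarith) p1
        rw [h]; linarith
      · have p3 : 1 ≤ (s 0).1 ^ k * (s 0).2 ^ j :=
          one_le_mul_of_one_le_of_one_le (one_le_pow₀ h1) (one_le_pow₀ h2)
        have e4 : |b| ≤ |b * ((s 0).1 ^ k * (s 0).2 ^ j)| := by
          rw [abs_mul, abs_of_nonneg (by linarith : 0 ≤ (s 0).1 ^ k * (s 0).2 ^ j)]
          exact le_mul_of_one_le_right (abs_nonneg _) p3
        have e5 : |b * ((s 0).1 ^ k * (s 0).2 ^ j)| ≤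
            1 + |a * (s 0).1 ^ (k + j)| + |c * (s 0).2 ^ (k + j)| := by
          rw [← h4]
          have := abs_add_three (trinomialForm a b c k j (s 0)) (-(a * (s 0).1 ^ (k + j)))
            (-(c * (s 0).2 ^ (k + j)))
          rw [abs_neg, abs_neg] at this
          refine le_trans (le_of_eq ?_) this
          rw [trinomialForm]; congr 1; ring
        rw [abs_mul a, abs_mul c, abs_of_nonneg (by linarith : 0 ≤ (s 0).1 ^ (k + j)),
          abs_of_nonneg (by linarith : 0 ≤ (s 0).2 ^ (k + j))] at e5
        rw [h]; linarith
      · have : |c| ≤ |c| * (s 0).2 ^ (k + j) := le_mul_of_one_le_right (by linarith) p2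
        rw [h]; linarith
    rw [mul_pow] at goal
    linarith
  · intro i hi
    obtain ⟨h1, h2, -, h4⟩ := hS _ (hsS i hi)
    have e1 := fst_le_of_trinomialForm hj ha0 ha hb hc h1 h2 h4
    refine max_le e1 ?_
    have : 1 ≤ H := ha1.trans ha
    nlinarith
  · intro i hi he
    obtain ⟨h1, -, -, h4⟩ := hS _ (hsS i hi.le)
    obtain ⟨h1', -, -, h4'⟩ := hS _ (hsS (i + 1) hi)
    exact hsne i (i + 1) (by omega) hi (eq_of_mul_eq_mul_of_isCoprime h1 h1'
      (isCoprime_of_trinomialForm hk h4) (isCoprime_of_trinomialForm hk h4') he)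
  · rintro ⟨i, hi, hi'⟩
    obtain ⟨α, hα, hα'⟩ := happ ⟨_, hsS i hi, hi'⟩
    exact ⟨α, hα, fun i hi h => hα' _ (hsS i hi) h⟩

theorem hasGap_of_elimination {a b c : ℤ} {k j : ℕ} (hk : 0 < k) {S : Set (ℤ × ℤ)}
    (hS : ∀ s ∈ S, 0 < s.1 ∧ 0 < s.2 ∧ |trinomialForm a b c k j s| = 1)
    (key : ∀ s ∈ S, ∀ t ∈ S, ∀ A B τ : ℝ, A = s.1 * t.2 → B = t.1 * s.2 → 1 ≤ A → 1 ≤ B →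
      1 ≤ |A - B| → τ = B / A →
      |a * (s.1 : ℝ) ^ (k + j) * (τ ^ j - 1) - c * (s.2 : ℝ) ^ (k + j) * (1 - τ⁻¹ ^ k)| ≤ 2 →
      |(a : ℝ)| * (s.1 : ℝ) ^ (k + j) ≤ 2 * (A * max A B) ∧
        |(c : ℝ)| * (s.2 : ℝ) ^ (k + j) ≤ 2 * (B * max A B)) :
    HasGap a c k j S := by
  intro s hs t ht hst hD
  obtain ⟨hs1, hs2, hs3⟩ := hS s hs
  obtain ⟨ht1, ht2, ht3⟩ := hS t ht
  have hA : 1 ≤ s.1 * t.2 := one_le_mul_of_one_le_of_one_le hs1 ht2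
  have hB : 1 ≤ t.1 * s.2 := one_le_mul_of_one_le_of_one_le ht1 hs2
  have hAB : 1 ≤ |s.1 * t.2 - t.1 * s.2| := by
    refine Int.one_le_abs (sub_ne_zero.2 fun h => hst ?_)
    exact eq_of_mul_eq_mul_of_isCoprime hs1 ht1 (isCoprime_of_trinomialForm hk hs3)
      (isCoprime_of_trinomialForm hk ht3) h
  have hs1' : (0 : ℝ) < s.1 := by exact_mod_cast hs1
  have hs2' : (0 : ℝ) < s.2 := by exact_mod_cast hs2
  have ht1' : (0 : ℝ) < t.1 := by exact_mod_cast ht1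
  have ht2' : (0 : ℝ) < t.2 := by exact_mod_cast ht2
  have he := abs_elimination_le (a := a) (b := b) (c := c) (k := k) (j := j) hs1' hs2' ht1' ht2'
    (by rw [trinomialForm] at hs3; exact_mod_cast hs3.le)
    (by rw [trinomialForm] at ht3; exact_mod_cast ht3.le) (by exact_mod_cast hD) rfl
  obtain ⟨g1, g2⟩ := key s hs t ht _ _ _ rfl rfl (by exact_mod_cast hA) (by exact_mod_cast hB)
    (by exact_mod_cast hAB) rfl he
  replace g1 : |a| * s.1 ^ (k + j) ≤ 2 * (s.1 * t.2 * max (s.1 * t.2) (t.1 * s.2)) := by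
    exact_mod_cast g1
  replace g2 : |c| * s.2 ^ (k + j) ≤ 2 * (t.1 * s.2 * max (s.1 * t.2) (t.1 * s.2)) := by
    exact_mod_cast g2
  have m1 : s.1 ≤ maxCoord s := le_max_left _ _
  have m2 : s.2 ≤ maxCoord s := le_max_right _ _
  have m3 : t.1 ≤ maxCoord t := le_max_left _ _
  have m4 : t.2 ≤ maxCoord t := le_max_right _ _
  have n1 : s.1 * t.2 ≤ maxCoord s * maxCoord t := mul_le_mul m1 m4 ht2.le (by linarith)
  have n2 : t.1 * s.2 ≤ maxCoord s * maxCoord t := by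
    rw [mul_comm]; exact mul_le_mul m2 m3 ht1.le (by linarith)
  have n3 := max_le n1 n2
  have n4 : 0 ≤ max (s.1 * t.2) (t.1 * s.2) := le_max_of_le_left (by linarith)
  have r1 := mul_le_mul n1 n3 n4 (by linarith)
  have r2 := mul_le_mul n2 n3 n4 (by linarith)
  rw [sq]
  constructor <;> linarith

theorem hasGap_of_neg {a b c : ℤ} {k j : ℕ} (hk : 0 < k) (hj : 0 < j) (ha : 0 < a) (hc : c < 0)
    {S : Set (ℤ × ℤ)} (hS : ∀ s ∈ S, 0 < s.1 ∧ 0 < s.2 ∧ |trinomialForm a b c k j s| = 1) :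
    HasGap a c k j S := by
  refine hasGap_of_elimination hk hS fun s hs t ht A B τ _ _ hA hB hAB hτ h => ?_
  have ha' : (0 : ℝ) < a := by exact_mod_cast ha
  have hc' : (c : ℝ) < 0 := by exact_mod_cast hc
  have hs1 : (0 : ℝ) < s.1 := by exact_mod_cast (hS s hs).1
  have hs2 : (0 : ℝ) < s.2 := by exact_mod_cast (hS s hs).2.1
  rw [abs_of_pos ha', abs_of_neg hc']
  obtain ⟨h1, h2⟩ := gap_one_sign_change (u := a * (s.1 : ℝ) ^ (k + j))
    (v := -c * (s.2 : ℝ) ^ (k + j)) hk hj (by positivity)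
    (mul_pos (by linarith) (by positivity)) hA hB hAB hτ
    (by rwa [neg_mul (c : ℝ), neg_neg])
  have hm : 1 ≤ max A B := le_max_of_le_left hA
  constructor
  · exact h1.trans (by gcongr; exact le_mul_of_one_le_right (by linarith) hm)
  · exact h2.trans (by gcongr; exact le_mul_of_one_le_right (by linarith) hm)

theorem hasGap_of_pos {a b c : ℤ} {k j : ℕ} (hk : 0 < k) (hj : 0 < j) (ha : 0 < a) (hc : 0 < c)
    {S : Set (ℤ × ℤ)} (hS : ∀ s ∈ S, 0 < s.1 ∧ 0 < s.2 ∧ |trinomialForm a b c k j s| = 1)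
    (hS' : ∀ s ∈ S, k * (c * s.2 ^ (k + j)) ≤ j * (a * s.1 ^ (k + j))) :
    HasGap a c k j S := by
  refine hasGap_of_elimination hk hS fun s hs t ht A B τ eA eB hA hB hAB hτ h => ?_
  have ha' : (0 : ℝ) < a := by exact_mod_cast ha
  have hc' : (0 : ℝ) < c := by exact_mod_cast hc
  have hs1 : (0 : ℝ) < s.1 := by exact_mod_cast (hS s hs).1
  have hs2 : (0 : ℝ) < s.2 := by exact_mod_cast (hS s hs).2.1
  have ht1 : (0 : ℝ) < t.1 := by exact_mod_cast (hS t ht).1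
  have ht2 : (0 : ℝ) < t.2 := by exact_mod_cast (hS t ht).2.1
  rw [abs_of_pos ha', abs_of_pos hc']
  have b1 : (k : ℝ) * (c * (s.2 : ℝ) ^ (k + j)) ≤ j * (a * (s.1 : ℝ) ^ (k + j)) := by
    exact_mod_cast hS' s hs
  have b2 : (k : ℝ) * (c * (t.2 : ℝ) ^ (k + j)) ≤ j * (a * (t.1 : ℝ) ^ (k + j)) := by
    exact_mod_cast hS' t ht
  refine gap_two_sign_changes hk hj (by positivity) (by positivity) hA hB hAB hτ b1 ?_ h
  have e : (s.1 : ℝ) ^ (k + j) * τ ^ (k + j) * (t.2 : ℝ) ^ (k + j) =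
      (t.1 : ℝ) ^ (k + j) * (s.2 : ℝ) ^ (k + j) := by
    rw [← mul_pow, ← mul_pow, ← mul_pow, hτ, eA, eB]
    congr 1
    field_simp
  refine le_of_mul_le_mul_right ?_ (by positivity : (0 : ℝ) < (t.2 : ℝ) ^ (k + j))
  have := mul_le_mul_of_nonneg_right b2 (by positivity : (0 : ℝ) ≤ (s.2 : ℝ) ^ (k + j))
  have e' : (j : ℝ) * (a * (s.1 : ℝ) ^ (k + j)) * τ ^ (k + j) * (t.2 : ℝ) ^ (k + j) =
      j * (a * ((s.1 : ℝ) ^ (k + j) * τ ^ (k + j) * (t.2 : ℝ) ^ (k + j))) := by ring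
  rw [e', e]
  linarith

theorem trinomial_nonneg_of_two_mul_le {a b c H x : ℝ} {k j : ℕ} (hk : 0 < k) (hj : 0 < j)
    (ha : 1 ≤ a) (hH : 1 ≤ H) (hb : |b| ≤ H) (hc : |c| ≤ H) (hx : 2 * H ≤ x) :
    0 ≤ a * x ^ (k + j) + b * x ^ k + c := by
  obtain ⟨m, rfl⟩ : ∃ m, j = m + 1 := ⟨j - 1, by omega⟩
  have hx1 : 1 ≤ x := by linarith
  have e1 : 1 ≤ x ^ (k + m) := one_le_pow₀ hx1
  have e2 : x ^ k ≤ x ^ (k + m) := pow_le_pow_right₀ hx1 (by omega)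
  have e3 : -(H * x ^ (k + m)) ≤ b * x ^ k := by
    have : |b * x ^ k| ≤ H * x ^ (k + m) := by
      rw [abs_mul, abs_of_pos (by positivity : 0 < x ^ k)]
      gcongr
    exact (abs_le.1 this).1
  have e4 : -(H * x ^ (k + m)) ≤ c := by
    have : |c| ≤ H * x ^ (k + m) := hc.trans (le_mul_of_one_le_right (by linarith) e1)
    exact (abs_le.1 this).1
  have e5 : 2 * H * x ^ (k + m) ≤ a * x ^ (k + (m + 1)) := by
    calc _ ≤ x * x ^ (k + m) := by gcongr
      _ = x ^ (k + (m + 1)) := by rw [← add_assoc, pow_succ']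
      _ ≤ _ := le_mul_of_one_le_left (by positivity) ha
  linarith

theorem abs_sub_mul_pow_le {x y : ℝ} (hx : 0 ≤ x) (hy : 0 ≤ y) (m : ℕ) :
    |x - y| * x ^ m ≤ |x ^ (m + 1) - y ^ (m + 1)| := by
  rw [pow_succ, pow_succ]
  rcases le_total x y with h | h
  · have h1 : x ^ m ≤ y ^ m := pow_le_pow_left₀ hx h m
    rw [abs_of_nonpos (by linarith), abs_of_nonpos (by nlinarith [pow_nonneg hx m])]
    nlinarith
  · have h1 : y ^ m ≤ x ^ m := pow_le_pow_left₀ hy h m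
    rw [abs_of_nonneg (by linarith), abs_of_nonneg (by nlinarith [pow_nonneg hy m])]
    nlinarith

theorem trinomial_eval_div {a b c p q : ℝ} {k j : ℕ} (hq : 0 < q) :
    (a * (p / q) ^ (k + j) + b * (p / q) ^ k + c) * q ^ (k + j) =
      a * p ^ (k + j) + b * (p ^ k * q ^ j) + c * q ^ (k + j) := by
  rw [div_pow, div_pow, pow_add q]
  field_simp

theorem abs_trinomial_eval_div {a b c : ℤ} {k j : ℕ} {s : ℤ × ℤ} (hs : 0 < s.2)
    (h : |trinomialForm a b c k j s| = 1) :
    |(a * (s.1 / s.2 : ℝ) ^ (k + j) + b * (s.1 / s.2 : ℝ) ^ k + c)| * (s.2 : ℝ) ^ (k + j) = 1 := by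
  have hs' : (0 : ℝ) < s.2 := by exact_mod_cast hs
  rw [← abs_of_pos (by positivity : 0 < (s.2 : ℝ) ^ (k + j)), ← abs_mul,
    trinomial_eval_div hs']
  rw [trinomialForm] at h
  exact_mod_cast h

theorem hasApprox_of_neg {a b c H : ℤ} {k j : ℕ} (hk : 0 < k) (hj : 0 < j) (ha : 0 < a)
    (hc : c < 0) (haH : |a| ≤ H) (hbH : |b| ≤ H) (hcH : |c| ≤ H)
    {S : Set (ℤ × ℤ)} (hS : ∀ s ∈ S, 0 < s.1 ∧ 0 < s.2 ∧ |trinomialForm a b c k j s| = 1) :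
    HasApprox a b c H k j S := by
  intro _
  have ha1 : (1 : ℝ) ≤ a := by exact_mod_cast ha
  have hc' : (c : ℝ) < 0 := by exact_mod_cast hc
  have hH1 : 1 ≤ H := by rw [abs_of_pos ha] at haH; linarith
  have hH : (1 : ℝ) ≤ H := by exact_mod_cast hH1
  have hcont : Continuous fun x : ℝ => a * x ^ (k + j) + b * x ^ k + c := by fun_prop
  have h0 : (a * (0 : ℝ) ^ (k + j) + b * 0 ^ k + c) = c := by
    rw [zero_pow (by omega), zero_pow hk.ne']; ring
  obtain ⟨α, ⟨hα0, -⟩, hα⟩ : (0 : ℝ) ∈ (fun x : ℝ => a * x ^ (k + j) + b * x ^ k + c) ''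
      Set.Icc 0 (2 * H : ℝ) := by
    refine intermediate_value_Icc (by linarith) hcont.continuousOn ⟨by simp only [h0]; exact hc'.le, ?_⟩
    exact trinomial_nonneg_of_two_mul_le hk hj ha1 hH (by exact_mod_cast hbH)
      (by exact_mod_cast hcH) le_rfl
  simp only at hα
  replace hα0 : 0 < α := by
    refine lt_of_le_of_ne hα0 fun h => ?_
    rw [← h, h0] at hα
    linarith
  refine ⟨α, hα, fun s hs _ => ?_⟩
  obtain ⟨hs1, hs2, hs3⟩ := hS s hs
  have hs1' : (0 : ℝ) < s.1 := by exact_mod_cast hs1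
  have hs2' : (0 : ℝ) < s.2 := by exact_mod_cast hs2
  have hx0 : (0 : ℝ) < s.1 / s.2 := by positivity
  have hfx := abs_trinomial_eval_div hs2 hs3
  have hxl : 1 ≤ (4 * H : ℝ) * (s.1 / s.2) := by
    have := fst_le_of_trinomialForm (s := s.swap) hk hc.ne hcH hbH haH hs2 hs1
      (by rwa [trinomialForm_swap])
    simp only [Prod.fst_swap, Prod.snd_swap] at this
    rw [mul_div_assoc', one_le_div hs2']
    exact_mod_cast this
  generalize (s.1 / s.2 : ℝ) = x at *
  set f := (a * x ^ (k + j) + b * x ^ k + c : ℝ) with hf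
  obtain ⟨m, rfl⟩ : ∃ m, j = m + 1 := ⟨j - 1, by omega⟩
  have e1 : α ^ k * f = (x * α) ^ k * (a * (x ^ (m + 1) - α ^ (m + 1))) + -c * (x ^ k - α ^ k) := by
    rw [hf, mul_pow]
    simp only [pow_add] at hα ⊢
    linear_combination x ^ k * hα
  have e2 : |x ^ (m + 1) - α ^ (m + 1)| * x ^ k ≤ |f| := by
    have hpos : 0 < (x * α) ^ k := by positivity
    have : (x * α) ^ k * |x ^ (m + 1) - α ^ (m + 1)| ≤ α ^ k * |f| := by
      have e3 : α ^ k * |f| = |α ^ k * f| := by rw [abs_mul, abs_of_pos (by positivity : 0 < α ^ k)]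
      rw [e3, e1]
      rcases le_total x α with h | h
      · have g1 : x ^ (m + 1) ≤ α ^ (m + 1) := pow_le_pow_left₀ hx0.le h _
        have g2 : x ^ k ≤ α ^ k := pow_le_pow_left₀ hx0.le h _
        have g3 : -c * (x ^ k - α ^ k) ≤ 0 := mul_nonpos_of_nonneg_of_nonpos (by linarith) (by linarith)
        have g4 : a * (x ^ (m + 1) - α ^ (m + 1)) ≤ x ^ (m + 1) - α ^ (m + 1) := by nlinarith
        have g5 := mul_le_mul_of_nonneg_left g4 hpos.le
        rw [abs_of_nonpos (by linarith)]
        refine le_trans ?_ (neg_le_abs _)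
        linarith
      · have g1 : α ^ (m + 1) ≤ x ^ (m + 1) := pow_le_pow_left₀ hα0.le h _
        have g2 : α ^ k ≤ x ^ k := pow_le_pow_left₀ hα0.le h _
        have g3 : 0 ≤ -c * (x ^ k - α ^ k) := mul_nonneg (by linarith) (by linarith)
        have g4 : x ^ (m + 1) - α ^ (m + 1) ≤ a * (x ^ (m + 1) - α ^ (m + 1)) := by nlinarith
        have g5 := mul_le_mul_of_nonneg_left g4 hpos.le
        rw [abs_of_nonneg (by linarith)]
        refine le_trans ?_ (le_abs_self _)
        linarith
    rw [mul_pow] at this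
    refine le_of_mul_le_mul_left ?_ (by positivity : 0 < α ^ k)
    linarith
  have e3 := abs_sub_mul_pow_le hx0.le hα0.le m
  have e4 : |x - α| * x ^ (k + m) ≤ |f| := by
    refine le_trans ?_ e2
    rw [add_comm k m, pow_add, ← mul_assoc]
    gcongr
  rw [le_div_iff₀ (by positivity), abs_sub_comm]
  have hK : (4 * H : ℝ) ≤ 4 * (k + (m + 1) : ℕ) ^ 2 * H := by
    have : (1 : ℝ) ≤ (k + (m + 1) : ℕ) ^ 2 := one_le_pow₀ (by exact_mod_cast (by omega))
    nlinarith
  have hone : 1 ≤ (4 * H * x) ^ (k + m) := one_le_pow₀ hxl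
  calc |x - α| * (s.2 : ℝ) ^ (k + (m + 1))
      ≤ |x - α| * (s.2 : ℝ) ^ (k + (m + 1)) * (4 * H * x) ^ (k + m) :=
        le_mul_of_one_le_right (by positivity) hone
    _ = (|x - α| * x ^ (k + m)) * (s.2 : ℝ) ^ (k + (m + 1)) * (4 * H) ^ (k + m) := by
        rw [mul_pow]; ring
    _ ≤ |f| * (s.2 : ℝ) ^ (k + (m + 1)) * (4 * H) ^ (k + m) := by gcongr
    _ = (4 * H) ^ (k + m) := by rw [hfx, one_mul]
    _ ≤ (4 * H) ^ (k + (m + 1) + 1) := pow_le_pow_right₀ (by linarith) (by omega)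
    _ ≤ _ := by gcongr

theorem add_mul_pow_le {t : ℝ} (ht : 0 < t) {k : ℕ} (hk : 0 < k) (j : ℕ) :
    (k + j) * t ^ k ≤ k * t ^ (k + j) + j := by
  obtain ⟨m, rfl⟩ : ∃ m, k = m + 1 := ⟨k - 1, by omega⟩
  have e1 := mul_le_mul_of_nonneg_left (mul_sub_one_le_pow_sub_one ht.le j)
    (by positivity : 0 ≤ ((m + 1 : ℕ) : ℝ) * t ^ (m + 1))
  have e2 := mul_le_mul_of_nonneg_left (mul_sub_one_le_pow_sub_one (inv_pos.2 ht).le (m + 1))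
    (by positivity : 0 ≤ (j : ℝ) * t ^ (m + 1))
  have e3 : t ^ (m + 1) * t⁻¹ ^ (m + 1) = 1 := by rw [← mul_pow, mul_inv_cancel₀ ht.ne', one_pow]
  have e4 : t ^ (m + 1) * t⁻¹ = t ^ m := by rw [pow_succ]; field_simp
  have e5 : 0 ≤ (m + 1 : ℕ) * (j : ℝ) * (t ^ m * (t - 1) ^ 2) := by positivity
  have e6 : (j : ℝ) * t ^ (m + 1) * ((m + 1 : ℕ) * (t⁻¹ - 1)) =
      (m + 1 : ℕ) * (j : ℝ) * (t ^ m * (1 - t)) := by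
    rw [← e4, pow_succ]; field_simp
  have e7 : (j : ℝ) * t ^ (m + 1) * (t⁻¹ ^ (m + 1) - 1) = j - j * t ^ (m + 1) := by
    linear_combination j * e3
  rw [e6, e7] at e2
  rw [pow_add t (m + 1) j]
  have e8 : ((m + 1 : ℕ) : ℝ) * t ^ (m + 1) * (j * (t - 1)) =
    (m + 1 : ℕ) * (j : ℝ) * (t ^ m * (t - 1) ^ 2) + (m + 1 : ℕ) * (j : ℝ) * (t ^ m * (t - 1)) := by
    rw [pow_succ]; ring
  linarith

theorem convexOn_pow_add_inv_pow {a c : ℝ} (ha : 0 ≤ a) (hc : 0 ≤ c) (j k : ℕ) :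
    ConvexOn ℝ (Set.Ioi 0) fun x : ℝ => a * x ^ j + c * (x ^ k)⁻¹ := by
  have h1 : ConvexOn ℝ (Set.Ioi 0) fun x : ℝ => x ^ j :=
    (convexOn_pow j).subset Set.Ioi_subset_Ici_self (convex_Ioi 0)
  have h2 : ConvexOn ℝ (Set.Ioi 0) fun x : ℝ => (x ^ k)⁻¹ := by
    simpa using convexOn_zpow (𝕜 := ℝ) (-k : ℤ)
  exact (h1.smul ha).add (h2.smul hc)

theorem abs_sub_root_mul_le {a b c α β γ x : ℝ} {k j : ℕ} (ha : 0 ≤ a) (hc : 0 ≤ c)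
    (hβ : 0 < β) (hβα : β < α) (hβx : β ≤ x) (hγ : 0 ≤ γ)
    (hfβ : a * β ^ (k + j) + b * β ^ k + c = -(γ * β ^ k))
    (hfα : a * α ^ (k + j) + b * α ^ k + c = 0) :
    |α - x| * γ * x ^ k ≤ (α - β) * |a * x ^ (k + j) + b * x ^ k + c| := by
  have hconv := convexOn_pow_add_inv_pow ha hc j k
  set g := fun x : ℝ => a * x ^ j + c * (x ^ k)⁻¹ with hg
  have eg : ∀ y, 0 < y → a * y ^ (k + j) + b * y ^ k + c = (g y + b) * y ^ k := by
    intro y hy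
    have : y ^ k * (y ^ k)⁻¹ = 1 := mul_inv_cancel₀ (by positivity)
    simp only [hg, pow_add]
    linear_combination -c * this
  have hα : 0 < α := hβ.trans hβα
  have hx : 0 < x := hβ.trans_le hβx
  rw [eg β hβ] at hfβ
  rw [eg α hα] at hfα
  have gβ : g β = -γ - b := by
    have : (g β + b + γ) * β ^ k = 0 := by linear_combination hfβ
    rcases mul_eq_zero.1 this with h | h
    · linarith
    · exact absurd h (by positivity)
  have gα : g α = -b := by
    rcases mul_eq_zero.1 hfα with h | h
    · linarith
    · exact absurd h (by positivity)
  rw [eg x hx, abs_mul, abs_of_pos (by positivity : 0 < x ^ k), ← mul_assoc]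
  refine mul_le_mul_of_nonneg_right ?_ (by positivity)
  rcases hβx.eq_or_lt with rfl | hβx
  · rw [gβ, abs_of_pos (by linarith), show -γ - b + b = -γ by ring, abs_neg, abs_of_nonneg hγ]
  rcases lt_trichotomy x α with h | rfl | h
  · have := hconv.slope_mono_adjacent (Set.mem_Ioi.2 hβ) (Set.mem_Ioi.2 hα) hβx h
    rw [gα, gβ, div_le_div_iff₀ (by linarith) (by linarith)] at this
    rw [abs_of_pos (by linarith)]
    refine le_trans ?_ (mul_le_mul_of_nonneg_left (neg_le_abs (g x + b)) (by linarith))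
    linarith
  · rw [sub_self, abs_zero, zero_mul]
    exact mul_nonneg (by linarith) (abs_nonneg _)
  · have := hconv.slope_mono_adjacent (Set.mem_Ioi.2 hβ) (Set.mem_Ioi.2 hx) hβα h
    rw [gα, gβ, div_le_div_iff₀ (by linarith) (by linarith)] at this
    rw [abs_of_neg (by linarith)]
    refine le_trans ?_ (mul_le_mul_of_nonneg_left (le_abs_self (g x + b)) (by linarith))
    linarith

theorem derivative_ne_zero_of_irreducible {a b c : ℤ} {n k : ℕ} (hn : 0 < n) (hk : 0 < k)
    (hirr : Irreducible (C (a : ℚ) * X ^ n + C (b : ℚ) * X ^ k + C (c : ℚ))) {β : ℝ} (hβ0 : β ≠ 0)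
    (hβ : a * β ^ n + b * β ^ k + c = 0) :
    n * (a * β ^ n) + k * (b * β ^ k) ≠ 0 := by
  intro h
  have hsep := hirr.separable
  have h1 : aeval β (C (a : ℚ) * X ^ n + C (b : ℚ) * X ^ k + C (c : ℚ)) = 0 := by
    simpa using hβ
  have h2 := hsep.aeval_derivative_ne_zero h1
  have h3 : β * aeval β (derivative (C (a : ℚ) * X ^ n + C (b : ℚ) * X ^ k + C (c : ℚ))) =
      n * (a * β ^ n) + k * (b * β ^ k) := by
    obtain ⟨m, rfl⟩ : ∃ m, n = m + 1 := ⟨n - 1, by omega⟩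
    obtain ⟨l, rfl⟩ : ∃ l, k = l + 1 := ⟨k - 1, by omega⟩
    rw [derivative_add, derivative_add, derivative_C_mul_X_pow, derivative_C_mul_X_pow,
      derivative_C]
    simp only [map_add, map_mul, map_pow, aeval_X, map_natCast, map_intCast, map_zero,
      Nat.add_sub_cancel]
    ring
  rw [← h3] at h
  exact (mul_ne_zero hβ0 h2) h

theorem one_le_mul_abs_add {a b c H : ℤ} {k j : ℕ} {V : ℝ} (hk : 0 < k) (hj : 0 < j) (hb : b < 0)
    (ha : 0 < a) (hc : 0 < c) (haH : |a| ≤ H) (hbH : |b| ≤ H) (hcH : |c| ≤ H) (hV : 0 < V)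
    (hVb : V + b ≠ 0)
    (h : (k : ℝ) ^ k * j ^ j * V ^ (k + j) = (k + j : ℕ) ^ (k + j) * (a ^ k * c ^ j)) :
    1 ≤ ((k + j : ℕ) : ℝ) ^ (2 * (k + j)) * (H : ℝ) ^ (k + j - 1) * |V + b| := by
  set n := k + j with hn
  have hH1 : (1 : ℝ) ≤ H := by
    rw [abs_of_pos ha] at haH
    exact_mod_cast (by linarith : 1 ≤ H)
  have haH' : (a : ℝ) ≤ H := by exact_mod_cast (le_abs_self a).trans haH
  have hcH' : (c : ℝ) ≤ H := by exact_mod_cast (le_abs_self c).trans hcH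
  have hbH' : -(b : ℝ) ≤ H := by exact_mod_cast (neg_le_abs b).trans hbH
  have ha' : (0 : ℝ) < a := by exact_mod_cast ha
  have hc' : (0 : ℝ) < c := by exact_mod_cast hc
  have hb' : (b : ℝ) < 0 := by exact_mod_cast hb
  have hk1 : (1 : ℝ) ≤ k := by exact_mod_cast hk
  have hj1 : (1 : ℝ) ≤ j := by exact_mod_cast hj
  have hn1 : (1 : ℝ) ≤ n := by exact_mod_cast (by omega)
  have hP1 : (1 : ℝ) ≤ (k : ℝ) ^ k * j ^ j :=
    one_le_mul_of_one_le_of_one_le (one_le_pow₀ hk1) (one_le_pow₀ hj1)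
  have hP2 : (k : ℝ) ^ k * j ^ j ≤ (n : ℝ) ^ n := by
    rw [hn, pow_add]
    gcongr <;> omega
  have hVH : V ≤ n * H := by
    refine le_of_pow_le_pow_left₀ (n := n) (by omega) (by positivity) ?_
    calc V ^ n ≤ (k : ℝ) ^ k * j ^ j * V ^ n := le_mul_of_one_le_left (by positivity) hP1
      _ = (n : ℝ) ^ n * ((a : ℝ) ^ k * (c : ℝ) ^ j) := h
      _ ≤ (n : ℝ) ^ n * ((H : ℝ) ^ k * (H : ℝ) ^ j) := by gcongr
      _ = (n * H) ^ n := by rw [mul_pow, ← pow_add]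
  have hbn : -(b : ℝ) ≤ n * H := hbH'.trans (le_mul_of_one_le_left (by linarith) hn1)
  have hne : V ^ n - (-b : ℝ) ^ n ≠ 0 := by
    rw [sub_ne_zero]
    intro he
    exact hVb (by linarith [(pow_left_inj₀ hV.le (by linarith) (by omega)).1 he])
  have hint : (k : ℝ) ^ k * j ^ j * (V ^ n - (-b : ℝ) ^ n) =
      (((n : ℤ) ^ n * (a ^ k * c ^ j) - (k : ℤ) ^ k * j ^ j * (-b) ^ n : ℤ) : ℝ) := by
    rw [mul_sub, h]; push_cast; ring
  have h1 : 1 ≤ |(k : ℝ) ^ k * j ^ j * (V ^ n - (-b : ℝ) ^ n)| := by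
    rw [hint]
    have : ((n : ℤ) ^ n * (a ^ k * c ^ j) - (k : ℤ) ^ k * j ^ j * (-b) ^ n : ℤ) ≠ 0 := by
      intro he
      rw [he, Int.cast_zero] at hint
      exact mul_ne_zero (by positivity) hne hint
    exact_mod_cast Int.one_le_abs this
  have h2 : |V ^ n - (-b : ℝ) ^ n| ≤ |V + b| * n * (n * H) ^ (n - 1) := by
    refine (abs_pow_sub_pow_le V (-b : ℝ) n).trans ?_
    rw [sub_neg_eq_add]
    gcongr
    refine max_le ?_ ?_
    · rwa [abs_of_pos hV]
    · rwa [abs_of_pos (by linarith)]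
  calc (1 : ℝ) ≤ _ := h1
    _ = (k : ℝ) ^ k * j ^ j * |V ^ n - (-b : ℝ) ^ n| := by rw [abs_mul, abs_of_pos (by positivity)]
    _ ≤ (n : ℝ) ^ n * (|V + b| * n * (n * H) ^ (n - 1)) := by gcongr
    _ = (n : ℝ) ^ n * ((n : ℝ) ^ (n - 1) * n) * (H : ℝ) ^ (n - 1) * |V + b| := by
        rw [mul_pow]; ring
    _ = _ := by rw [← pow_succ, Nat.sub_add_cancel (by omega), ← pow_add, two_mul]

theorem exists_critical_point {a c : ℝ} {k j : ℕ} (ha : 0 < a) (hc : 0 < c) (hk : 0 < k)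
    (hj : 0 < j) : ∃ β : ℝ, 0 < β ∧ j * (a * β ^ (k + j)) = k * c := by
  have hk' : (0 : ℝ) < k := by exact_mod_cast hk
  have hj' : (0 : ℝ) < j := by exact_mod_cast hj
  refine ⟨(k * c / (j * a)) ^ (((k + j : ℕ) : ℝ)⁻¹), by positivity, ?_⟩
  rw [Real.rpow_inv_natCast_pow (by positivity) (by omega)]
  field_simp

theorem critical_value_pow {a c β V : ℝ} {k j : ℕ} (hβ : 0 < β)
    (h : j * (a * β ^ (k + j)) = k * c) (hV : V * β ^ k = a * β ^ (k + j) + c) :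
    (k : ℝ) ^ k * j ^ j * V ^ (k + j) = (k + j : ℕ) ^ (k + j) * (a ^ k * c ^ j) := by
  have h1 : k * V = (k + j : ℕ) * (a * β ^ j) := by
    refine mul_right_cancel₀ (by positivity : β ^ k ≠ 0) ?_
    rw [pow_add] at h hV
    push_cast
    linear_combination k * hV - h
  have h2 : j * V * β ^ k = (k + j : ℕ) * c := by
    push_cast
    linear_combination j * hV + h
  refine mul_right_cancel₀ (by positivity : (β ^ k) ^ j ≠ 0) ?_
  calc _ = (k * V) ^ k * (j * V * β ^ k) ^ j := by rw [pow_add]; ring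
    _ = _ := by rw [h1, h2, pow_add]; ring

theorem critical_value_le {a c β V x : ℝ} {k j : ℕ} (hk : 0 < k) (hj : 0 < j) (hβ : 0 < β)
    (ha : 0 < a) (hx : 0 < x)
    (h : j * (a * β ^ (k + j)) = k * c) (hV : V * β ^ k = a * β ^ (k + j) + c) :
    V * x ^ k ≤ a * x ^ (k + j) + c := by
  have hk' : (0 : ℝ) < k := by exact_mod_cast hk
  have hj' : (0 : ℝ) < j := by exact_mod_cast hj
  obtain ⟨t, rfl⟩ : ∃ t, x = β * t := ⟨x / β, by field_simp⟩
  have ht : 0 < t := (mul_pos_iff_of_pos_left hβ).1 hx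
  have e1 := mul_le_mul_of_nonneg_left (add_mul_pow_le ht hk j)
    (by positivity : 0 ≤ a * β ^ (k + j))
  refine le_of_mul_le_mul_left ?_ hk'
  have e2 : (k : ℝ) * (V * (β * t) ^ k) = a * β ^ (k + j) * ((k + j) * t ^ k) := by
    rw [mul_pow]
    linear_combination k * t ^ k * hV - t ^ k * h
  have e3 : (k : ℝ) * (a * (β * t) ^ (k + j) + c) =
      a * β ^ (k + j) * (k * t ^ (k + j) + j) := by
    rw [mul_pow]
    linear_combination -h
  rw [e2, e3]
  exact e1

theorem one_le_mul_pow_of_branch {a c H x : ℝ} {k j : ℕ} (hk : 0 < k) (hc : 1 ≤ c)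
    (ha : 1 ≤ a) (haH : a ≤ H) (hx : 0 < x) (h : k * c ≤ j * (a * x ^ (k + j))) :
    1 ≤ (k + j : ℕ) * H * x ^ k := by
  have hk' : (1 : ℝ) ≤ k := by exact_mod_cast hk
  have hkc : 1 ≤ k * c := one_le_mul_of_one_le_of_one_le hk' hc
  have hjn : (j : ℝ) ≤ (k + j : ℕ) := by exact_mod_cast (by omega : j ≤ k + j)
  have hH : 1 ≤ H := ha.trans haH
  rcases le_total x 1 with h1 | h1
  · calc 1 ≤ k * c := hkc
      _ ≤ j * (a * x ^ (k + j)) := h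
      _ ≤ (k + j : ℕ) * (H * x ^ k) := by
          have hpow : x ^ (k + j) ≤ x ^ k := pow_le_pow_of_le_one hx.le h1 (by omega)
          exact mul_le_mul hjn (mul_le_mul haH hpow (by positivity) (by linarith))
            (mul_nonneg (by linarith) (by positivity)) (by positivity)
      _ = _ := by ring
  · have hn1 : (1 : ℝ) ≤ (k + j : ℕ) := by exact_mod_cast (by omega : 1 ≤ k + j)
    exact one_le_mul_of_one_le_of_one_le (one_le_mul_of_one_le_of_one_le hn1 hH) (one_le_pow₀ h1)

theorem hasApprox_of_pos {a b c H : ℤ} {k j : ℕ} (hk : 0 < k) (hj : 0 < j) (ha : 0 < a)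
    (hb : b < 0) (hc : 0 < c) (haH : |a| ≤ H) (hbH : |b| ≤ H) (hcH : |c| ≤ H)
    (hirr : Irreducible (C (a : ℚ) * X ^ (k + j) + C (b : ℚ) * X ^ k + C (c : ℚ)))
    {S : Set (ℤ × ℤ)} (hS : ∀ s ∈ S, 0 < s.1 ∧ 0 < s.2 ∧ |trinomialForm a b c k j s| = 1)
    (hS' : ∀ s ∈ S, k * (c * s.2 ^ (k + j)) ≤ j * (a * s.1 ^ (k + j))) :
    HasApprox a b c H k j S := by
  rintro ⟨s₀, hs₀, hs₀'⟩
  have ha1 : (1 : ℝ) ≤ a := by exact_mod_cast ha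
  have hc1 : (1 : ℝ) ≤ c := by exact_mod_cast hc
  have hH1 : 1 ≤ H := by rw [abs_of_pos ha] at haH; linarith
  have hH : (1 : ℝ) ≤ H := by exact_mod_cast hH1
  have haR : (a : ℝ) ≤ H := by exact_mod_cast (le_abs_self a).trans haH
  have hn1 : (1 : ℝ) ≤ (k + j : ℕ) := by exact_mod_cast (by omega : 1 ≤ k + j)
  obtain ⟨β, hβ, hβn⟩ := exists_critical_point (a := a) (c := c) (by linarith) (by linarith) hk hj
  obtain ⟨V, hV⟩ : ∃ V : ℝ, V * β ^ k = a * β ^ (k + j) + c :=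
    ⟨(a * β ^ (k + j) + c) / β ^ k, by field_simp⟩
  have hV0 : 0 < V := by
    have : 0 < V * β ^ k := by rw [hV]; positivity
    exact (pos_iff_pos_of_mul_pos this).2 (by positivity)
  have hVb : V + b ≠ 0 := by
    intro h
    have h0 : (b : ℝ) = -V := by linarith
    refine derivative_ne_zero_of_irreducible (by omega) hk hirr hβ.ne' ?_ ?_
    · rw [h0]; linear_combination -hV
    · rw [h0]; push_cast; linear_combination -k * hV + hβn
  have hgap := one_le_mul_abs_add hk hj hb ha hc haH hbH hcH hV0 hVb (critical_value_pow hβ hβn hV)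
  have hfβ : a * β ^ (k + j) + b * β ^ k + c = (V + b) * β ^ k := by linear_combination -hV
  -- lower bound for `x ^ k` on the branch
  have hbr : ∀ s ∈ S, k * (c : ℝ) ≤ j * (a * (s.1 / s.2 : ℝ) ^ (k + j)) := by
    intro s hs
    have hs2 : (0 : ℝ) < s.2 := by exact_mod_cast (hS s hs).2.1
    have := hS' s hs
    rw [div_pow, mul_div_assoc', mul_div_assoc', le_div_iff₀ (by positivity), mul_assoc]
    exact_mod_cast this
  have hxk : ∀ s ∈ S, 1 ≤ (k + j : ℕ) * H * (s.1 / s.2 : ℝ) ^ k := by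
    intro s hs
    have hs1 : (0 : ℝ) < s.1 := by exact_mod_cast (hS s hs).1
    have hs2 : (0 : ℝ) < s.2 := by exact_mod_cast (hS s hs).2.1
    exact one_le_mul_pow_of_branch hk hc1 ha1 haR (by positivity) (hbr s hs)
  rcases lt_or_gt_of_ne hVb with hneg | hpos
  · have h2H := trinomial_nonneg_of_two_mul_le (b := (b : ℝ)) (c := c) hk hj ha1 hH
      (by exact_mod_cast hbH) (by exact_mod_cast hcH) (le_max_left (2 * H : ℝ) β)
    have hcont : Continuous fun x : ℝ => a * x ^ (k + j) + b * x ^ k + c := by fun_prop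
    have hfβ0 : a * β ^ (k + j) + b * β ^ k + c < 0 := by
      rw [hfβ]; exact mul_neg_of_neg_of_pos hneg (by positivity)
    obtain ⟨α, ⟨hαβ, -⟩, hα⟩ : (0 : ℝ) ∈ (fun x : ℝ => a * x ^ (k + j) + b * x ^ k + c) ''
        Set.Icc β (max (2 * H) β) :=
      intermediate_value_Icc (le_max_right _ _) hcont.continuousOn ⟨hfβ0.le, h2H⟩
    simp only at hα
    replace hαβ : β < α := by
      refine lt_of_le_of_ne hαβ fun h => ?_
      rw [h, hα] at hfβ0
      exact lt_irrefl _ hfβ0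
    have hα2 := (le_abs_self α).trans
      (abs_root_le_two_mul (by omega : k < k + j) ha.ne' haH hbH hcH hα)
    refine ⟨α, hα, fun s hs _ => ?_⟩
    have hs1 : (0 : ℝ) < s.1 := by exact_mod_cast (hS s hs).1
    have hs2 : (0 : ℝ) < s.2 := by exact_mod_cast (hS s hs).2.1
    have hx0 : (0 : ℝ) < s.1 / s.2 := by positivity
    have hfx := abs_trinomial_eval_div (hS s hs).2.1 (hS s hs).2.2
    have hxk := hxk s hs
    have hβx : β ≤ (s.1 / s.2 : ℝ) := by
      refine le_of_pow_le_pow_left₀ (n := k + j) (by omega) hx0.le ?_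
      have := hbr s hs
      rw [← hβn] at this
      have hj' : (0 : ℝ) < j := by exact_mod_cast hj
      exact le_of_mul_le_mul_left (le_of_mul_le_mul_left this hj') (by linarith)
    generalize (s.1 / s.2 : ℝ) = x at *
    have key := abs_sub_root_mul_le (γ := -(V + b)) (by linarith) (by linarith) hβ hαβ hβx
      (by linarith) (by rw [hfβ]; ring) hα
    rw [abs_of_neg hneg] at hgap
    rw [le_div_iff₀ (by positivity)]
    set n := k + j with hn
    set f := |a * x ^ n + b * x ^ k + c| with hf
    have hH0 : (0 : ℝ) < H := by linarith
    have hγ : 0 < -(V + b) := by linarith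
    calc |α - x| * (s.2 : ℝ) ^ n
        ≤ |α - x| * (s.2 : ℝ) ^ n * ((n * H * x ^ k) *
            ((n : ℝ) ^ (2 * n) * (H : ℝ) ^ (n - 1) * -(V + b))) :=
          le_mul_of_one_le_right (by positivity) (one_le_mul_of_one_le_of_one_le hxk hgap)
      _ = (|α - x| * -(V + b) * x ^ k) *
            ((s.2 : ℝ) ^ n * (n * H * ((n : ℝ) ^ (2 * n) * (H : ℝ) ^ (n - 1)))) := by ring
      _ ≤ ((α - β) * f) * ((s.2 : ℝ) ^ n * (n * H * ((n : ℝ) ^ (2 * n) * (H : ℝ) ^ (n - 1)))) := by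
          gcongr
      _ ≤ (2 * H * f) * ((s.2 : ℝ) ^ n * (n * H * ((n : ℝ) ^ (2 * n) * (H : ℝ) ^ (n - 1)))) := by
          gcongr
          linarith
      _ = (f * (s.2 : ℝ) ^ n) * (2 * ((n : ℝ) ^ (2 * n) * n) * (((H : ℝ) ^ (n - 1) * H) * H)) := by
          ring
      _ = 2 * (n : ℝ) ^ (2 * n + 1) * (H : ℝ) ^ (n + 1) := by
          rw [hfx, ← pow_succ, ← pow_succ, ← pow_succ, Nat.sub_add_cancel (by omega), one_mul]
      _ ≤ 4 ^ (n + 1) * (n : ℝ) ^ (2 * (n + 1)) * (H : ℝ) ^ (n + 1) := by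
          gcongr
          · calc (2 : ℝ) ≤ 4 ^ 1 := by norm_num
              _ ≤ 4 ^ (n + 1) := pow_le_pow_right₀ (by norm_num) (by omega)
          · omega
      _ = _ := by rw [mul_pow, mul_pow, ← pow_mul]
  · exfalso
    have hs1 : (0 : ℝ) < s₀.1 := by exact_mod_cast (hS s₀ hs₀).1
    have hs2 : (0 : ℝ) < s₀.2 := by exact_mod_cast (hS s₀ hs₀).2.1
    have hx0 : (0 : ℝ) < s₀.1 / s₀.2 := by positivity
    have hfx := abs_trinomial_eval_div (hS s₀ hs₀).2.1 (hS s₀ hs₀).2.2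
    have hxk := hxk s₀ hs₀
    have hq : (4 * ((k + j : ℕ) : ℝ) ^ 2 * H) ^ 2 ≤ s₀.2 := by exact_mod_cast hs₀'
    have key := critical_value_le hk hj hβ (by linarith) hx0 hβn hV
    generalize (s₀.1 / s₀.2 : ℝ) = x at *
    rw [abs_of_pos hpos] at hgap
    set n := k + j with hn
    have hH0 : (0 : ℝ) < H := by linarith
    have key2 : (V + b) * x ^ k ≤ |a * x ^ n + b * x ^ k + c| :=
      le_trans (by linarith) (le_abs_self _)
    have h1 : (s₀.2 : ℝ) ^ n ≤ (n : ℝ) ^ (2 * n + 1) * (H : ℝ) ^ n := by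
      calc (s₀.2 : ℝ) ^ n ≤ (s₀.2 : ℝ) ^ n * ((n * H * x ^ k) *
            ((n : ℝ) ^ (2 * n) * (H : ℝ) ^ (n - 1) * (V + b))) :=
          le_mul_of_one_le_right (by positivity) (one_le_mul_of_one_le_of_one_le hxk hgap)
        _ = ((V + b) * x ^ k) * (s₀.2 : ℝ) ^ n *
              ((n : ℝ) ^ (2 * n) * n * ((H : ℝ) ^ (n - 1) * H)) := by ring
        _ ≤ |a * x ^ n + b * x ^ k + c| * (s₀.2 : ℝ) ^ n *
              ((n : ℝ) ^ (2 * n) * n * ((H : ℝ) ^ (n - 1) * H)) := by gcongr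
        _ = _ := by rw [hfx, ← pow_succ, ← pow_succ, Nat.sub_add_cancel (by omega), one_mul]
    have h2 : (n : ℝ) ^ (2 * n + 1) * (H : ℝ) ^ n < (s₀.2 : ℝ) ^ n := by
      calc (n : ℝ) ^ (2 * n + 1) * (H : ℝ) ^ n ≤ (n : ℝ) ^ (3 * n) * (H : ℝ) ^ n := by
            gcongr
            · omega
        _ < 2 ^ n * ((n : ℝ) ^ (3 * n) * (H : ℝ) ^ n) :=
            lt_mul_of_one_lt_left (by positivity) (one_lt_pow₀ (by norm_num) (by omega))
        _ = (2 * (n : ℝ) ^ 3 * H) ^ n := by rw [mul_pow, mul_pow, ← pow_mul]; ring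
        _ ≤ ((4 * (n : ℝ) ^ 2 * H) ^ 2) ^ n := by
            gcongr
            calc 2 * (n : ℝ) ^ 3 * H ≤ 16 * (n : ℝ) ^ 4 * (H : ℝ) ^ 2 := by
                  gcongr
                  · norm_num
                  · norm_num
                  · exact le_self_pow₀ hH (by norm_num)
              _ = _ := by ring
        _ ≤ _ := by gcongr
    linarith

/-- The binary trinomial `a x ^ (k + j) + b x ^ k y ^ j + c y ^ (k + j)` as a polynomial. -/
noncomputable def trinomialMv (a b c : ℤ) (k j : ℕ) : MvPolynomial (Fin 2) ℤ :=
  MvPolynomial.C a * MvPolynomial.X 0 ^ (k + j)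
    + MvPolynomial.C b * MvPolynomial.X 0 ^ k * MvPolynomial.X 1 ^ j
    + MvPolynomial.C c * MvPolynomial.X 1 ^ (k + j)

theorem irreducible_trinomialMv_neg {a b c : ℤ} {k j : ℕ}
    (h : Irreducible (trinomialMv a b c k j)) : Irreducible (trinomialMv (-a) (-b) (-c) k j) := by
  have e : trinomialMv (-a) (-b) (-c) k j = -trinomialMv a b c k j := by
    simp only [trinomialMv, map_neg]; ring
  rw [e]
  exact (Associated.refl _).neg_left.irreducible_iff.2 h

theorem irreducible_trinomialMv_swap {a b c : ℤ} {k j : ℕ}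
    (h : Irreducible (trinomialMv a b c k j)) : Irreducible (trinomialMv c b a j k) := by
  rw [← MulEquiv.irreducible_iff (MvPolynomial.renameEquiv ℤ (Equiv.swap (0 : Fin 2) 1))] at h
  convert h using 1
  simp only [trinomialMv, map_add, map_mul, map_pow, MvPolynomial.renameEquiv_apply,
    MvPolynomial.rename_C, MvPolynomial.rename_X, Equiv.swap_apply_left, Equiv.swap_apply_right,
    add_comm j k]
  ring

theorem irreducible_trinomialMv_neg_X {a b c : ℤ} {k j : ℕ}
    (h : Irreducible (trinomialMv a b c k j)) :
    Irreducible (trinomialMv ((-1) ^ (k + j) * a) ((-1) ^ k * b) c k j) := by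
  let f : MvPolynomial (Fin 2) ℤ →ₐ[ℤ] MvPolynomial (Fin 2) ℤ :=
    MvPolynomial.aeval ![-MvPolynomial.X 0, MvPolynomial.X 1]
  have hf : f.comp f = AlgHom.id ℤ _ := by
    ext i : 1
    fin_cases i <;> simp [f]
  rw [← MulEquiv.irreducible_iff (AlgEquiv.ofAlgHom f f hf hf)] at h
  convert h using 1
  simp [trinomialMv, f, neg_pow (MvPolynomial.X (0 : Fin 2) : MvPolynomial (Fin 2) ℤ)]
  ring

theorem irreducible_of_homogenize {p : ℤ[X]} {n : ℕ} (hp : p.natDegree = n) (hn : n ≠ 0)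
    (h : Irreducible (p.homogenize n)) : Irreducible p := by
  refine ⟨fun hu => hn (hp ▸ natDegree_eq_zero_of_isUnit hu), fun q r he => ?_⟩
  have hp0 : p ≠ 0 := by rintro rfl; exact hn (by simpa using hp.symm)
  rw [he] at hp hp0
  rw [natDegree_mul (left_ne_zero_of_mul hp0) (right_ne_zero_of_mul hp0)] at hp
  rw [he, ← hp, homogenize_mul _ _ le_rfl le_rfl] at h
  refine (h.isUnit_or_isUnit rfl).imp (fun hu => ?_) fun hu => ?_
  · have := hu.map (MvPolynomial.aeval (R := ℤ) (![X, 1] : Fin 2 → ℤ[X]))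
    rwa [aeval_homogenize_X_one _ le_rfl] at this
  · have := hu.map (MvPolynomial.aeval (R := ℤ) (![X, 1] : Fin 2 → ℤ[X]))
    rwa [aeval_homogenize_X_one _ le_rfl] at this

theorem irreducible_trinomial_rat {a b c : ℤ} {k j : ℕ} (hk : 0 < k) (hj : 0 < j) (ha : a ≠ 0)
    (h : Irreducible (trinomialMv a b c k j)) :
    Irreducible (C (a : ℚ) * X ^ (k + j) + C (b : ℚ) * X ^ k + C (c : ℚ)) := by
  have hdeg : (C a * X ^ (k + j) + C b * X ^ k + C c : ℤ[X]).natDegree = k + j := by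
    compute_degree!
    all_goals simp [hk.ne', hj.ne', ha]
  have hhom : (C a * X ^ (k + j) + C b * X ^ k + C c : ℤ[X]).homogenize (k + j) =
      trinomialMv a b c k j := by
    rw [homogenize_add, homogenize_add, homogenize_C_mul, homogenize_C_mul, homogenize_C,
      homogenize_X_pow le_rfl, homogenize_X_pow (Nat.le_add_right k j), Nat.sub_self, pow_zero,
      mul_one, Nat.add_sub_cancel_left, ← mul_assoc, trinomialMv]
  rw [← hhom] at h
  have hirr := irreducible_of_homogenize hdeg (by omega) h
  have := (IsPrimitive.Int.irreducible_iff_irreducible_map_cast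
    (hirr.isPrimitive (by omega))).1 hirr
  simpa using this

/-- Number of sign changes of `a x ^ n + b x ^ k + c` (for nonzero coefficients). -/
def signChanges (a b c : ℤ) : ℕ := if a * c < 0 then 1 else if a * b < 0 then 2 else 0

theorem signChanges_neg (a b c : ℤ) : signChanges (-a) (-b) (-c) = signChanges a b c := by
  simp only [signChanges, neg_mul_neg]

/-- Regular solutions of `|F| = 1` in the open first quadrant. -/
def positiveSolutions (a b c : ℤ) (k j : ℕ) : Set (ℤ × ℤ) :=
  {s | 0 < s.1 ∧ 0 < s.2 ∧ s.1 ≠ s.2 ∧ |trinomialForm a b c k j s| = 1}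

theorem encard_right_branch_le {a b c H : ℤ} {k j : ℕ} (hk : 0 < k) (hj : 0 < j)
    (hn : 6 ≤ k + j) (ha : 0 < a) (hb : b < 0) (hc : 0 < c) (haH : |a| ≤ H) (hbH : |b| ≤ H)
    (hcH : |c| ≤ H) (hH : H = |a| ∨ H = |b| ∨ H = |c|)
    (hirr : Irreducible (trinomialMv a b c k j)) :
    {s ∈ positiveSolutions a b c k j |
      k * (c * s.2 ^ (k + j)) ≤ j * (a * s.1 ^ (k + j))}.encard ≤ z (k + j) := by
  have hirr' := irreducible_trinomial_rat hk hj ha.ne' hirr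
  exact encard_branch_le hk hj hn ha.ne' hc.ne' haH hbH hcH hH hirr' (fun s hs => hs.1)
    (hasGap_of_pos hk hj ha hc (fun s hs => ⟨hs.1.1, hs.1.2.1, hs.1.2.2.2⟩) fun s hs => hs.2)
    (hasApprox_of_pos hk hj ha hb hc haH hbH hcH hirr'
      (fun s hs => ⟨hs.1.1, hs.1.2.1, hs.1.2.2.2⟩) fun s hs => hs.2)

theorem encard_positiveSolutions_le_of_pos {a b c : ℤ} {k j : ℕ} (hk : 0 < k) (hj : 0 < j)
    (hn : 6 ≤ k + j) (ha : 0 < a) (hb : b ≠ 0) (hc : c ≠ 0)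
    (hirr : Irreducible (trinomialMv a b c k j)) :
    (positiveSolutions a b c k j).encard ≤ (signChanges a b c * z (k + j) : ℕ) := by
  obtain ⟨H, haH, hbH, hcH, hH⟩ : ∃ H : ℤ, |a| ≤ H ∧ |b| ≤ H ∧ |c| ≤ H ∧
      (H = |a| ∨ H = |b| ∨ H = |c|) := by
    refine ⟨max |a| (max |b| |c|), le_max_left _ _, le_max_of_le_right (le_max_left _ _),
      le_max_of_le_right (le_max_right _ _), ?_⟩
    rcases max_choice |a| (max |b| |c|) with h | h
    · exact Or.inl h
    · rw [h]
      exact Or.inr (max_choice _ _)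
  rcases lt_or_gt_of_ne hc with hc | hc
  · rw [signChanges, if_pos (mul_neg_of_pos_of_neg ha hc), one_mul]
    have hS : ∀ s ∈ positiveSolutions a b c k j, 0 < s.1 ∧ 0 < s.2 ∧
      |trinomialForm a b c k j s| = 1 := fun s hs => ⟨hs.1, hs.2.1, hs.2.2.2⟩
    exact encard_branch_le hk hj hn ha.ne' hc.ne haH hbH hcH hH
      (irreducible_trinomial_rat hk hj ha.ne' hirr) (fun s hs => hs)
      (hasGap_of_neg hk hj ha hc hS) (hasApprox_of_neg hk hj ha hc haH hbH hcH hS)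
  rw [signChanges, if_neg (mul_pos ha hc).le.not_gt]
  rcases lt_or_gt_of_ne hb with hb | hb
  · rw [if_pos (mul_neg_of_pos_of_neg ha hb)]
    have hsub : positiveSolutions a b c k j ⊆
        {s ∈ positiveSolutions a b c k j | k * (c * s.2 ^ (k + j)) ≤ j * (a * s.1 ^ (k + j))} ∪
        Prod.swap '' {s ∈ positiveSolutions c b a j k |
          j * (a * s.2 ^ (j + k)) ≤ k * (c * s.1 ^ (j + k))} := by
      intro s hs
      rcases le_total (k * (c * s.2 ^ (k + j))) (j * (a * s.1 ^ (k + j))) with h | h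
      · exact Or.inl ⟨hs, h⟩
      · refine Or.inr ⟨s.swap, ⟨⟨hs.2.1, hs.1, hs.2.2.1.symm, ?_⟩, ?_⟩, s.swap_swap⟩
        · rw [trinomialForm_swap]; exact hs.2.2.2
        · rw [add_comm j k]; exact h
    refine (Set.encard_le_encard hsub).trans ((Set.encard_union_le _ _).trans ?_)
    rw [two_mul, Nat.cast_add]
    refine add_le_add (encard_right_branch_le hk hj hn ha hb hc haH hbH hcH hH hirr) ?_
    refine (Set.encard_image_le _ _).trans ?_
    rw [add_comm k j]
    exact encard_right_branch_le hj hk (by omega) hc hb ha hcH hbH haH (by tauto)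
      (irreducible_trinomialMv_swap hirr)
  · have : positiveSolutions a b c k j = ∅ := by
      rw [Set.eq_empty_iff_forall_notMem]
      rintro s ⟨h1, h2, -, h4⟩
      have e1 : 0 < a * s.1 ^ (k + j) := by positivity
      have e2 : 0 < b * (s.1 ^ k * s.2 ^ j) := by positivity
      have e3 : 0 < c * s.2 ^ (k + j) := by positivity
      rw [trinomialForm, abs_of_pos (by linarith)] at h4
      linarith
    rw [this, Set.encard_empty]
    exact bot_le

theorem encard_positiveSolutions_le {a b c : ℤ} {k j : ℕ} (hk : 0 < k) (hj : 0 < j)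
    (hn : 6 ≤ k + j) (ha : a ≠ 0) (hb : b ≠ 0) (hc : c ≠ 0)
    (hirr : Irreducible (trinomialMv a b c k j)) :
    (positiveSolutions a b c k j).encard ≤ (signChanges a b c * z (k + j) : ℕ) := by
  rcases lt_or_gt_of_ne ha with ha | ha
  · have h := encard_positiveSolutions_le_of_pos hk hj hn (neg_pos.2 ha) (neg_ne_zero.2 hb)
      (neg_ne_zero.2 hc) (irreducible_trinomialMv_neg hirr)
    rw [signChanges_neg] at h
    convert h using 2
    ext s
    have : trinomialForm (-a) (-b) (-c) k j s = -trinomialForm a b c k j s := by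
      simp only [trinomialForm]; ring
    simp only [positiveSolutions, Set.mem_ofPred_eq, this, abs_neg]
  · exact encard_positiveSolutions_le_of_pos hk hj hn ha hb hc hirr

theorem signChanges_add_le {a b c : ℤ} {n k : ℕ} (ha : a ≠ 0) (hc : c ≠ 0) :
    signChanges a b c + signChanges ((-1) ^ n * a) ((-1) ^ k * b) c ≤ v n := by
  unfold signChanges v
  rcases Nat.even_or_odd n with h | h
  · rw [if_neg (Nat.not_odd_iff_even.2 h)]
    split_ifs <;> norm_num
  · rw [if_pos h, h.neg_one_pow]
    have hac : a * c ≠ 0 := mul_ne_zero ha hc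
    have hneg : -1 * a * c = -(a * c) := by ring
    split_ifs <;> omega

theorem stmt1 (hn hk h0 : ℤ) (n k : ℕ) (hk0 : 0 < k) (hkn : k < n) (hn6 : 6 ≤ n)
    (hhn : hn ≠ 0) (hhk : hk ≠ 0) (hh0 : h0 ≠ 0)
    (hirr : Irreducible
      (MvPolynomial.C hn * MvPolynomial.X 0 ^ n
        + MvPolynomial.C hk * MvPolynomial.X 0 ^ k * MvPolynomial.X 1 ^ (n - k)
        + MvPolynomial.C h0 * MvPolynomial.X 1 ^ n : MvPolynomial (Fin 2) ℤ)) :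
    {p : ℤ × ℤ | |hn * p.1 ^ n + hk * p.1 ^ k * p.2 ^ (n - k) + h0 * p.2 ^ n| = 1
      ∧ p.1 ≠ 0 ∧ 0 < p.2 ∧ |p.1| ≠ p.2}.encard
      ≤ ((v n * z n : ℕ) : ℕ∞) := by
  obtain ⟨j, rfl⟩ : ∃ j, n = k + j := ⟨n - k, by omega⟩
  rw [Nat.add_sub_cancel_left] at *
  have hj : 0 < j := by omega
  have hsub : {p : ℤ × ℤ | |hn * p.1 ^ (k + j) + hk * p.1 ^ k * p.2 ^ j + h0 * p.2 ^ (k + j)| = 1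
      ∧ p.1 ≠ 0 ∧ 0 < p.2 ∧ |p.1| ≠ p.2} ⊆ positiveSolutions hn hk h0 k j ∪
      (fun s : ℤ × ℤ => (-s.1, s.2)) ''
        positiveSolutions ((-1) ^ (k + j) * hn) ((-1) ^ k * hk) h0 k j := by
    rintro ⟨p, q⟩ ⟨h1, h2, h3, h4⟩
    simp only at h1 h2 h3 h4
    rcases lt_or_gt_of_ne h2 with h | h
    · rw [abs_of_neg h] at h4
      refine Or.inr ⟨(-p, q), ⟨neg_pos.2 h, h3, h4, ?_⟩, by simp⟩
      have e : trinomialForm ((-1) ^ (k + j) * hn) ((-1) ^ k * hk) h0 k j (-p, q) =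
          hn * p ^ (k + j) + hk * p ^ k * q ^ j + h0 * q ^ (k + j) := by
        have e1 : ∀ m : ℕ, (-1 : ℤ) ^ m * (-p) ^ m = p ^ m := fun m => by
          rw [← mul_pow, neg_one_mul, neg_neg]
        simp only [trinomialForm]
        linear_combination hn * e1 (k + j) + hk * q ^ j * e1 k
      rw [e, h1]
    · rw [abs_of_pos h] at h4
      refine Or.inl ⟨h, h3, h4, ?_⟩
      simpa only [trinomialForm, mul_assoc] using h1
  have hpos := encard_positiveSolutions_le hk0 hj hn6 hhn hhk hh0 hirr
  have hneg := encard_positiveSolutions_le hk0 hj hn6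
    (mul_ne_zero (pow_ne_zero _ (by norm_num)) hhn)
    (mul_ne_zero (pow_ne_zero _ (by norm_num)) hhk) hh0 (irreducible_trinomialMv_neg_X hirr)
  refine (Set.encard_le_encard hsub).trans ((Set.encard_union_le _ _).trans ?_)
  refine (add_le_add hpos ((Set.encard_image_le _ _).trans hneg)).trans ?_
  rw [← Nat.cast_add, ← add_mul]
  exact_mod_cast Nat.mul_le_mul_right _ (signChanges_add_le hhn hh0)
end

section
/- Suppose L, M, T, p, y_0, …, y_ℓ are positive real numbers satisfying: (1) L ≤ y_0 ≤ y_1 ≤ … ≤ y_ℓ ≤ M; (2) p > 2; (3) L^(p−2) > T; and (4) y_{i+1} ≥ (1/T)·y_i^(p−1) for each 0 ≤ i < ℓ, where ℓ is a nonnegative integer. Then ℓ ≤ log( log(M·T^(−1/(p−2))) / log(L·T^(−1/(p−2))) ) / log(p−1). -/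
theorem log_mul_rpow_neg_one_div {x T q : ℝ} (hx : 0 < x) (hT : 0 < T) :
    Real.log (x * T ^ (-1 / q)) = Real.log x - Real.log T / q := by
  rw [Real.log_mul hx.ne' (Real.rpow_pos_of_pos hT _).ne', Real.log_rpow hT]
  ring

theorem mul_log_sub_le_log_sub {x z T p : ℝ} (hx : 0 < x) (hT : 0 < T) (hp : p - 2 ≠ 0)
    (h : (1 / T) * x ^ (p - 1) ≤ z) :
    (p - 1) * (Real.log x - Real.log T / (p - 2)) ≤ Real.log z - Real.log T / (p - 2) := by
  have hlog := Real.log_le_log (by positivity) h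
  rw [Real.log_mul (by positivity) (by positivity), Real.log_rpow hx, one_div,
    Real.log_inv] at hlog
  have hc : Real.log T / (p - 2) * (p - 2) = Real.log T := div_mul_cancel₀ _ hp
  linarith


theorem stmt3 (L M T p : ℝ) (ℓ : ℕ) (y : ℕ → ℝ)
    (hL : 0 < L) (hM : 0 < M) (hT : 0 < T) (hp0 : 0 < p)
    (hy : ∀ i ≤ ℓ, 0 < y i)
    (h1a : L ≤ y 0) (h1b : ∀ i < ℓ, y i ≤ y (i + 1)) (h1c : y ℓ ≤ M)
    (h2 : 2 < p)
    (h3 : T < L ^ (p - 2))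
    (h4 : ∀ i < ℓ, (1 / T) * y i ^ (p - 1) ≤ y (i + 1)) :
    (ℓ : ℝ) ≤
      Real.log (Real.log (M * T ^ (-1 / (p - 2))) / Real.log (L * T ^ (-1 / (p - 2))))
        / Real.log (p - 1) := by
  have hp2 : 0 < p - 2 := by linarith
  rw [log_mul_rpow_neg_one_div hM hT, log_mul_rpow_neg_one_div hL hT]
  have hpos : 0 < Real.log L - Real.log T / (p - 2) := by
    have h := Real.log_lt_log hT h3
    rw [Real.log_rpow hL] at h
    rw [sub_pos, div_lt_iff₀ hp2]
    linarith
  have growth : ∀ i ≤ ℓ, (p - 1) ^ i * (Real.log L - Real.log T / (p - 2)) ≤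
      Real.log (y i) - Real.log T / (p - 2) := by
    intro i
    induction i with
    | zero =>
      intro _
      have := Real.log_le_log hL h1a
      simpa using this
    | succ k ih =>
      intro hk
      have step := mul_log_sub_le_log_sub (hy k (by omega)) hT hp2.ne' (h4 k (by omega))
      have := mul_le_mul_of_nonneg_left (ih (by omega)) (by linarith : 0 ≤ p - 1)
      rw [pow_succ']
      linarith
  have hlogM := Real.log_le_log (hy ℓ le_rfl) h1c
  have hpow : (p - 1) ^ ℓ ≤
      (Real.log M - Real.log T / (p - 2)) / (Real.log L - Real.log T / (p - 2)) := by
    rw [le_div_iff₀ hpos]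
    linarith [growth ℓ le_rfl]
  rw [le_div_iff₀ (Real.log_pos (by linarith)), ← Real.log_pow]
  exact Real.log_le_log (pow_pos (by linarith) _) hpow
end

section
/- Let F(x,y) = h_n·x^n + h_k·x^k·y^(n−k) + h_0·y^n be an irreducible trinomial binary form of degree n ≥ 6, and let f(x) = F(x,1). Then R_F + C_F ≤ v(n), i.e., the number of real roots of f plus the number of proper critical points of f is at most 3 when n is odd and at most 4 when n is even. -/
open Polynomial

/-- A real number `τ` is a proper critical point of a real polynomial `g` if it is a
critical point of `g` and there is a neighborhood `U` of `τ` with `g''(x)·g(x) > 0`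
for all `x ∈ U \ {τ}`. -/
def IsProperCriticalPoint (g : Polynomial ℝ) (τ : ℝ) : Prop :=
  (Polynomial.derivative g).eval τ = 0 ∧
    ∃ U ∈ nhds τ, ∀ x ∈ U, x ≠ τ →
      0 < (Polynomial.derivative (Polynomial.derivative g)).eval x * g.eval x

open Filter Topology in
/-- A convexity criterion for strict local minima which tolerates a vanishing second derivative at
the point itself. -/
theorem Polynomial.eventually_lt_eval_of_derivative2_pos (p : ℝ[X]) (a : ℝ)
    (h1 : p.derivative.eval a = 0)
    (h2 : ∀ᶠ x in 𝓝[≠] a, 0 < p.derivative.derivative.eval x) :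
    ∀ᶠ x in 𝓝[≠] a, p.eval a < p.eval x := by
  rw [eventually_nhdsWithin_iff, Metric.eventually_nhds_iff] at h2 ⊢
  obtain ⟨ε, hε, h2⟩ := h2
  refine ⟨ε, hε, fun x hx hxa => ?_⟩
  have mvt (q : ℝ[X]) {c d : ℝ} (hcd : c < d) :
      ∃ e ∈ Set.Ioo c d, q.eval d - q.eval c = q.derivative.eval e * (d - c) := by
    obtain ⟨e, he, h⟩ := exists_hasDerivAt_eq_slope (fun x => q.eval x)
      (fun x => q.derivative.eval x) hcd q.continuousOn (fun x _ => q.hasDerivAt x)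
    refine ⟨e, he, ?_⟩
    rw [h, div_mul_cancel₀ _ (sub_pos.2 hcd).ne']
  rw [Real.dist_eq, abs_lt] at hx
  rcases lt_or_gt_of_ne (show x ≠ a from hxa) with hlt | hgt
  · obtain ⟨y, hy, ey⟩ := mvt p hlt
    obtain ⟨z, hz, ez⟩ := mvt p.derivative hy.2
    have hpos := h2 (y := z)
      (by rw [Real.dist_eq, abs_lt]; constructor <;> linarith [hy.1, hz.1, hz.2])
      hz.2.ne
    have := mul_pos hpos (sub_pos.2 hy.2)
    nlinarith
  · obtain ⟨y, hy, ey⟩ := mvt p hgt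
    obtain ⟨z, hz, ez⟩ := mvt p.derivative hy.1
    have hpos := h2 (y := z)
      (by rw [Real.dist_eq, abs_lt]; constructor <;> linarith [hy.2, hz.1, hz.2])
      hz.1.ne'
    have := mul_pos hpos (sub_pos.2 hy.1)
    nlinarith

open Filter Topology in
theorem IsProperCriticalPoint.eventually_sq_lt {f : ℝ[X]} {a : ℝ}
    (h : IsProperCriticalPoint f a) : ∀ᶠ x in 𝓝[≠] a, f.eval a ^ 2 < f.eval x ^ 2 := by
  obtain ⟨h1, U, hU, h2⟩ := h
  have := (f ^ 2).eventually_lt_eval_of_derivative2_pos a (by simp [derivative_pow, h1]) (by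
    rw [eventually_nhdsWithin_iff]
    filter_upwards [hU] with x hx hxa
    have := h2 x hx hxa
    simp only [derivative_pow, derivative_mul, eval_mul, eval_add, derivative_C, eval_C,
      Nat.add_one_sub_one, pow_one, eval_zero, Nat.cast_ofNat]
    nlinarith [sq_nonneg (f.derivative.eval x)])
  simpa using this

open Filter Topology in
theorem Polynomial.eventually_eval_ne_zero {f : ℝ[X]} (hf : f ≠ 0) (a : ℝ) :
    ∀ᶠ x in 𝓝[≠] a, f.eval x ≠ 0 := by
  have h : ((f.roots.toFinset : Set ℝ) \ {a})ᶜ ∈ 𝓝 a :=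
    (f.roots.toFinset.finite_toSet.subset Set.sdiff_subset).isClosed.isOpen_compl.mem_nhds (by simp)
  rw [eventually_nhdsWithin_iff]
  filter_upwards [h] with x hx hxa h0
  exact hx ⟨by simp [hf, h0], hxa⟩

open Filter Topology in
/-- Between two strict local minima of `f ^ 2` there is a local maximum, which is a critical point
of `f` that is not proper. -/
theorem Polynomial.exists_isLocalMax_sq_of_lt (f : ℝ[X]) {a b : ℝ} (hab : a < b)
    (ha : ∀ᶠ x in 𝓝[≠] a, f.eval a ^ 2 < f.eval x ^ 2)
    (hb : ∀ᶠ x in 𝓝[≠] b, f.eval b ^ 2 < f.eval x ^ 2) :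
    ∃ z ∈ Set.Ioo a b, f.eval z ≠ 0 ∧ f.derivative.eval z = 0 ∧
      IsLocalMax (fun x => f.eval x ^ 2) z ∧ ¬ IsProperCriticalPoint f z := by
  obtain ⟨z, hz, hmax⟩ := isCompact_Icc.exists_isMaxOn (Set.nonempty_Icc.2 hab.le)
    ((f.continuous.pow 2).continuousOn (s := Set.Icc a b))
  have hmax' : ∀ x ∈ Set.Icc a b, f.eval x ^ 2 ≤ f.eval z ^ 2 := fun x hx => hmax hx
  obtain ⟨a', ha', haI⟩ := ((ha.filter_mono (nhdsWithin_mono a (s := Set.Ioi a) fun x hx => ne_of_gt hx)).and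
    (Ioo_mem_nhdsGT hab)).exists
  obtain ⟨b', hb', hbI⟩ := ((hb.filter_mono (nhdsWithin_mono b (s := Set.Iio b) fun x hx => ne_of_lt hx)).and
    (Ioo_mem_nhdsLT hab)).exists
  have hza := ha'.trans_le (hmax' a' ⟨haI.1.le, haI.2.le⟩)
  have hzb := hb'.trans_le (hmax' b' ⟨hbI.1.le, hbI.2.le⟩)
  have hzI : z ∈ Set.Ioo a b :=
    ⟨hz.1.lt_of_ne (by rintro rfl; exact hza.false), hz.2.lt_of_ne (by rintro rfl; exact hzb.false)⟩
  have hf0 : f.eval z ≠ 0 := fun h => by nlinarith [sq_nonneg (f.eval a)]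
  have hloc : IsLocalMax (fun x => f.eval x ^ 2) z := hmax.isLocalMax (Icc_mem_nhds hzI.1 hzI.2)
  refine ⟨z, hzI, hf0, ?_, hloc, fun hp => ?_⟩
  · have := hloc.hasDerivAt_eq_zero ((f.hasDerivAt z).pow 2)
    simpa [hf0] using this
  · obtain ⟨x, hx, hx'⟩ := (hp.eventually_sq_lt.and (hloc.filter_mono nhdsWithin_le_nhds)).exists
    exact hx.not_ge hx'

theorem Polynomial.encard_zeros_add_encard_properCriticalPoints_le {f : ℝ[X]} (hf : f ≠ 0)
    (K : Finset ℝ) (hproper : ∀ z, IsProperCriticalPoint f z → z ∈ K)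
    (hmax : ∀ z, f.eval z ≠ 0 → f.derivative.eval z = 0 →
      IsLocalMax (fun x => f.eval x ^ 2) z → z ∈ K) :
    {x : ℝ | f.eval x = 0}.encard + {τ : ℝ | IsProperCriticalPoint f τ}.encard
      ≤ ((K.card + 1 : ℕ) : ℕ∞) := by
  classical
  set P := K.filter (IsProperCriticalPoint f) with hP
  have hR : {x : ℝ | f.eval x = 0} = (f.roots.toFinset : Set ℝ) := by ext; simp [hf]
  have hC : {τ : ℝ | IsProperCriticalPoint f τ} = (P : Set ℝ) := by
    ext x; simpa [hP] using hproper x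
  have hmin : ∀ x ∈ f.roots.toFinset ∪ P,
      ∀ᶠ y in nhdsWithin x {x}ᶜ, f.eval x ^ 2 < f.eval y ^ 2 := by
    intro x hx
    rcases Finset.mem_union.1 hx with h | h
    · have h0 : f.eval x = 0 := by simpa [hf] using h
      filter_upwards [eventually_eval_ne_zero hf x] with y hy
      rw [h0, zero_pow two_ne_zero]
      exact sq_pos_of_ne_zero hy
    · exact (Finset.mem_filter.1 h).2.eventually_sq_lt
  have hcard : (f.roots.toFinset ∪ P).card ≤ (K \ P).card + 1 := by
    refine Finset.card_le_of_interleaved fun x hx y hy hxy _ => ?_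
    obtain ⟨z, hz, h0, h1, hm, hnp⟩ := f.exists_isLocalMax_sq_of_lt hxy (hmin x hx) (hmin y hy)
    exact ⟨z, Finset.mem_sdiff.2 ⟨hmax z h0 h1 hm, fun h => hnp (Finset.mem_filter.1 h).2⟩, hz⟩
  have hsub := Finset.card_sdiff_add_card_eq_card (Finset.filter_subset (IsProperCriticalPoint f) K)
  have hle := Finset.card_le_card (Finset.subset_union_left (s₁ := f.roots.toFinset) (s₂ := P))
  rw [hR, hC, Set.encard_coe_eq_coe_finsetCard, Set.encard_coe_eq_coe_finsetCard]
  rw [← hP] at hsub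
  norm_cast
  omega

section RealTrinomial

variable {a b c : ℝ} {n k : ℕ}

theorem Polynomial.derivative_trinomial_eval_eq_zero {x : ℝ} (hkn : k < n) (hk0 : 0 < k) (hx : x ≠ 0)
    (h : (derivative (C a * X ^ n + C b * X ^ k + C c)).eval x = 0) :
    n * a * x ^ (n - k) = -(k * b) := by
  obtain ⟨m, rfl⟩ := Nat.exists_eq_add_of_lt hkn
  obtain ⟨l, rfl⟩ := Nat.exists_eq_add_of_lt hk0
  simp only [derivative_add, derivative_mul, derivative_C, derivative_X_pow, eval_add, eval_mul,
    eval_C, eval_pow, eval_X, zero_mul, zero_add, add_zero] at h ⊢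
  rw [show l + 1 + m + 1 - (l + 1) = m + 1 by omega]
  rw [show l + 1 + m + 1 - 1 = l + (m + 1) by omega, Nat.add_sub_cancel, pow_add] at h
  have h' : x ^ l * (((l + 1 + m + 1 : ℕ) : ℝ) * a * x ^ (m + 1) + ((l + 1 : ℕ) : ℝ) * b) = 0 := by
    linear_combination h
  linarith [(mul_eq_zero.1 h').resolve_left (pow_ne_zero l hx)]

theorem Polynomial.pow_eq_pow_of_derivative_trinomial_eval_eq_zero {x y : ℝ} (hkn : k < n)
    (hk0 : 0 < k) (ha : a ≠ 0) (hx : x ≠ 0) (hy : y ≠ 0)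
    (h : (derivative (C a * X ^ n + C b * X ^ k + C c)).eval x = 0)
    (h' : (derivative (C a * X ^ n + C b * X ^ k + C c)).eval y = 0) :
    x ^ (n - k) = y ^ (n - k) := by
  have hn : (n : ℝ) * a ≠ 0 := mul_ne_zero (Nat.cast_ne_zero.2 (hk0.trans hkn).ne') ha
  exact mul_left_cancel₀ hn ((derivative_trinomial_eval_eq_zero hkn hk0 hx h).trans
    (derivative_trinomial_eval_eq_zero hkn hk0 hy h').symm)

open Filter Topology in
/-- If both exponents are odd, `f ^ 2` has neither a local maximum nor a strict local minimum at
the origin. -/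
theorem Polynomial.not_extremum_trinomial_sq_zero (hkn : k < n) (hk0 : 0 < k) (ha : a ≠ 0)
    (hc : c ≠ 0) (hn : Odd n) (hk : Odd k) {f : ℝ[X]}
    (hf : f = C a * X ^ n + C b * X ^ k + C c) :
    ¬ IsLocalMax (fun x => f.eval x ^ 2) 0 ∧
      ¬ ∀ᶠ x in 𝓝[≠] 0, f.eval 0 ^ 2 < f.eval x ^ 2 := by
  have h0 : f.eval 0 = c := by simp [hf, hk0.ne', (hk0.trans hkn).ne']
  have hsum (x : ℝ) : f.eval (-x) = 2 * c - f.eval x := by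
    simp [hf, hn.neg_pow, hk.neg_pow]; ring
  have hneg : Tendsto (fun x : ℝ => -x) (𝓝[≠] 0) (𝓝[≠] 0) := by
    refine tendsto_nhdsWithin_of_tendsto_nhds_of_eventually_within _ ?_ ?_
    · simpa using (continuous_neg.tendsto (0 : ℝ)).mono_left nhdsWithin_le_nhds
    · filter_upwards [self_mem_nhdsWithin] with x hx
      simpa using hx
  constructor
  · intro h
    have hne : f - C c ≠ 0 := by
      intro h0
      have := congrArg (coeff · n) h0
      simp [hf, coeff_X_pow, hkn.ne'] at this
      exact ha this
    have h' : ∀ᶠ x in 𝓝[≠] 0, f.eval x ^ 2 ≤ f.eval 0 ^ 2 := h.filter_mono nhdsWithin_le_nhds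
    obtain ⟨x, h1, h2, h3⟩ :=
      (h'.and ((hneg.eventually h').and (eventually_eval_ne_zero hne 0))).exists
    rw [hsum] at h2
    rw [h0] at h1 h2
    apply h3
    have : (f.eval x - c) ^ 2 ≤ 0 := by nlinarith
    simpa using pow_eq_zero_iff two_ne_zero |>.1 (le_antisymm this (sq_nonneg _))
  · intro h
    have hsmall : ∀ᶠ x in 𝓝[≠] 0, (f.eval x - c) ^ 2 < c ^ 2 := by
      have hcont : Continuous fun x => (f.eval x - c) ^ 2 := by fun_prop
      refine (hcont.continuousAt.eventually_lt_const ?_).filter_mono nhdsWithin_le_nhds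
      simp only [h0, sub_self, zero_pow two_ne_zero]
      positivity
    obtain ⟨x, h1, h2, h3⟩ := (h.and ((hneg.eventually h).and hsmall)).exists
    rw [hsum] at h2
    rw [h0] at h1 h2
    rw [sq_lt_sq] at h3
    rcases abs_cases (f.eval x - c) with ⟨e, _⟩ | ⟨e, _⟩ <;>
      rcases abs_cases c with ⟨e', _⟩ | ⟨e', _⟩ <;> rw [e, e'] at h3 <;> nlinarith

end RealTrinomial

theorem stmt5 (hn hk h0 : ℤ) (n k : ℕ) (hk0 : 0 < k) (hkn : k < n) (hn6 : 6 ≤ n)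
    (hhn : hn ≠ 0) (hhk : hk ≠ 0) (hh0 : h0 ≠ 0)
    (hirr : Irreducible
      (MvPolynomial.C hn * MvPolynomial.X 0 ^ n
        + MvPolynomial.C hk * MvPolynomial.X 0 ^ k * MvPolynomial.X 1 ^ (n - k)
        + MvPolynomial.C h0 * MvPolynomial.X 1 ^ n : MvPolynomial (Fin 2) ℤ))
    (f : Polynomial ℝ)
    (hf : f = C (hn : ℝ) * X ^ n + C (hk : ℝ) * X ^ k + C (h0 : ℝ)) :
    {x : ℝ | f.eval x = 0}.encard + {τ : ℝ | IsProperCriticalPoint f τ}.encard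
      ≤ ((v n : ℕ) : ℕ∞) := by
  classical
  have ha : (hn : ℝ) ≠ 0 := by exact_mod_cast hhn
  have hc : (h0 : ℝ) ≠ 0 := by exact_mod_cast hh0
  have hf0 : f ≠ 0 := by
    intro h
    have := congrArg (eval 0) h
    simp [hf, hk0.ne', (hk0.trans hkn).ne', hh0] at this
  obtain ⟨τ, hτ⟩ : ∃ τ : ℝ, ∀ x ≠ 0, f.derivative.eval x = 0 → x ^ (n - k) = τ ^ (n - k) := by
    by_cases h : ∃ y ≠ 0, f.derivative.eval y = 0
    · obtain ⟨y, hy, h⟩ := h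
      refine ⟨y, fun x hx h' => ?_⟩
      rw [hf] at h h'
      exact pow_eq_pow_of_derivative_trinomial_eval_eq_zero hkn hk0 ha hx hy h' h
    · exact ⟨0, fun x hx h' => (h ⟨x, hx, h'⟩).elim⟩
  have habs {x : ℝ} (hx : x ≠ 0) (h : f.derivative.eval x = 0) : x = τ ∨ x = -τ := by
    refine abs_eq_abs.1 ((pow_left_inj₀ (abs_nonneg x) (abs_nonneg τ)
      (Nat.sub_ne_zero_of_lt hkn)).1 ?_)
    rw [← abs_pow, ← abs_pow, hτ x hx h]
  have bound (K : Finset ℝ) (N : ℕ) (hcard : K.card + 1 ≤ N)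
      (hK : ∀ z, f.derivative.eval z = 0 →
        (IsLocalMax (fun x => f.eval x ^ 2) z ∨
          ∀ᶠ x in nhdsWithin z {z}ᶜ, f.eval z ^ 2 < f.eval x ^ 2) → z ∈ K) :
      {x : ℝ | f.eval x = 0}.encard + {τ : ℝ | IsProperCriticalPoint f τ}.encard ≤ (N : ℕ∞) :=
    (encard_zeros_add_encard_properCriticalPoints_le hf0 K
      (fun z hz => hK z hz.1 (Or.inr hz.eventually_sq_lt))
      (fun z _ h1 hm => hK z h1 (Or.inl hm))).trans (by exact_mod_cast hcard)
  unfold v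
  split_ifs with hodd
  · rcases Nat.even_or_odd k with hk | hk
    · refine bound {0, τ} _ (Nat.succ_le_succ Finset.card_le_two) fun z hz _ => ?_
      by_cases h : z = 0
      · simp [h]
      · simp [(Nat.Odd.sub_even hkn.le hodd hk).strictMono_pow.injective (hτ z h hz)]
    · refine bound {τ, -τ} _ (Nat.succ_le_succ Finset.card_le_two) fun z hz hz' => ?_
      by_cases h : z = 0
      · subst h
        obtain ⟨h1, h2⟩ := not_extremum_trinomial_sq_zero hkn hk0 ha hc hodd hk hf
        exact (hz'.elim h1 h2).elim
      · simpa using habs h hz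
  · refine bound {0, τ, -τ} _ (Nat.succ_le_succ Finset.card_le_three) fun z hz _ => ?_
    by_cases h : z = 0
    · simp [h]
    · simpa [h] using habs h hz
end
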